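/- Let X₀, X₁ be n-dimensional and Y₀, Y₁ be m-dimensional Banach lattices, E and F finite-dimensional Banach spaces of cotype 2, and 0 < θ < 1. Then d_θ[X₀(E),X₁(E);Y₀(F),Y₁(F)] ≤ 16·[(M_(2)(X₀)M_(2)(Y₀))^{1-θ}(M_(2)(X₁)M_(2)(Y₁))^{θ}]^{5/2}·C₂(E)^{5/2}·C₂(F)^{5/2}, where d_θ[M₀,M₁;N₀,N₁] is the norm of the identity [M₀,M₁]_θ⊗_ε[N₀,N₁]_θ → [M₀⊗_εN₀,M₁⊗_εN₁]_θ. -/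

import Mathlib

open Complex MeasureTheory Finset

noncomputable section

namespace Paper

/-- The closed unit strip in the complex plane. -/
def Strip : Set ℂ := {z : ℂ | 0 ≤ z.re ∧ z.re ≤ 1}

/-- The open unit strip in the complex plane. -/
def OStrip : Set ℂ := {z : ℂ | 0 < z.re ∧ z.re < 1}

/-- `N` is a norm on the complex vector space `V`. -/
def IsNormC {V : Type*} [AddCommGroup V] [Module ℂ V] (N : V → ℝ) : Prop :=
  (∀ x, 0 ≤ N x) ∧ (∀ x, N x = 0 → x = 0) ∧
  (∀ (c : ℂ) (x), N (c • x) = ‖c‖ * N x) ∧ (∀ x y, N (x + y) ≤ N x + N y)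

/-- `N` is a lattice norm on `ℝⁿ`. -/
def IsLatticeNorm {n : ℕ} (N : (Fin n → ℝ) → ℝ) : Prop :=
  (∀ x, 0 ≤ N x) ∧ (∀ x, N x = 0 → x = 0) ∧
  (∀ (c : ℝ) (x), N (c • x) = |c| * N x) ∧ (∀ x y, N (x + y) ≤ N x + N y) ∧
  (∀ x y, (∀ i, |x i| ≤ |y i|) → N x ≤ N y)

/-- The `r`-th power `X^r` of a lattice norm: `‖x‖_{X^r} = ‖ |x|^{1/r} ‖_X^r`. -/
def powNorm {n : ℕ} (r : ℝ) (N : (Fin n → ℝ) → ℝ) (x : Fin n → ℝ) : ℝ :=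
  (N fun i => |x i| ^ (1 / r)) ^ r

/-- `N` is `p`-convex with constant `C`. -/
def ConvexWith {n : ℕ} (p C : ℝ) (N : (Fin n → ℝ) → ℝ) : Prop :=
  ∀ (m : ℕ) (x : Fin m → Fin n → ℝ),
    N (fun j => (∑ i, |x i j| ^ p) ^ (1 / p)) ≤ C * (∑ i, N (x i) ^ p) ^ (1 / p)

/-- `N` is `p`-concave with constant `C`. -/
def ConcaveWith {n : ℕ} (p C : ℝ) (N : (Fin n → ℝ) → ℝ) : Prop :=
  ∀ (m : ℕ) (x : Fin m → Fin n → ℝ),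
    (∑ i, N (x i) ^ p) ^ (1 / p) ≤ C * N (fun j => (∑ i, |x i j| ^ p) ^ (1 / p))

/-- The dual lattice norm on `ℝⁿ`. -/
def dualNR {n : ℕ} (N : (Fin n → ℝ) → ℝ) (y : Fin n → ℝ) : ℝ :=
  sSup {r : ℝ | ∃ x, N x ≤ 1 ∧ r = |∑ i, x i * y i|}

/-- The Calderón product norm `X₀^{1-θ}X₁^θ` on `ℝⁿ`. -/
def calNorm {n : ℕ} (θ : ℝ) (N₀ N₁ : (Fin n → ℝ) → ℝ) (f : Fin n → ℝ) : ℝ :=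
  sInf {c : ℝ | ∃ g h : Fin n → ℝ, (∀ i, |f i| = |g i| ^ (1 - θ) * |h i| ^ θ) ∧
    c = N₀ g ^ (1 - θ) * N₁ h ^ θ}

/-- The complex interpolation norm `[N₀,N₁]_θ`, computed via analytic functions
of finite type `z ↦ ∑ φᵢ(z) • vᵢ` on the strip (which, by density, gives the
complex interpolation norm on the intersection for couples with dense intersection). -/
def interpN {D : Type*} [AddCommGroup D] [Module ℂ D]
    (θ : ℝ) (N₀ N₁ : D → ℝ) (x : D) : ℝ :=
  sInf {c : ℝ | ∃ (m : ℕ) (φ : Fin m → ℂ → ℂ) (v : Fin m → D),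
    (∀ i, ContinuousOn (φ i) Strip) ∧
    (∀ i, DifferentiableOn ℂ (φ i) OStrip) ∧
    (∀ i, ∃ B : ℝ, ∀ z ∈ Strip, ‖φ i z‖ ≤ B) ∧
    (∑ i, φ i (θ : ℂ) • v i) = x ∧
    (∀ t : ℝ, N₀ (∑ i, φ i (Complex.I * t) • v i) ≤ c) ∧
    (∀ t : ℝ, N₁ (∑ i, φ i (1 + Complex.I * t) • v i) ≤ c)}

/-- Operator "norm" of a map with respect to given norm functions. -/
def opN {X Y : Type*} (NX : X → ℝ) (NY : Y → ℝ) (T : X → Y) : ℝ :=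
  sSup {r : ℝ | ∃ x, NX x ≤ 1 ∧ r = NY (T x)}

/-- The Hilbert space `ℓ₂`. -/
abbrev Hilb := lp (fun _ : ℕ => ℂ) 2

def hilbNorm (x : Hilb) : ℝ := ‖x‖

/-- `d_θ[M₀,M₁]`: the norm of the identity
`L(ℓ₂,[M₀,M₁]_θ) → [L(ℓ₂,M₀),L(ℓ₂,M₁)]_θ`. -/
def dTheta {V : Type*} [NormedAddCommGroup V] [NormedSpace ℂ V]
    (θ : ℝ) (N₀ N₁ : V → ℝ) : ℝ :=
  sSup {r : ℝ | ∃ T : Hilb →L[ℂ] V,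
    opN hilbNorm (interpN θ N₀ N₁) ⇑T ≤ 1 ∧
    r = interpN θ (fun S : Hilb →L[ℂ] V => opN hilbNorm N₀ ⇑S)
        (fun S : Hilb →L[ℂ] V => opN hilbNorm N₁ ⇑S) T}

/-- Rademacher average `(2^{-m} ∑_ε ‖∑ ±xᵢ‖²)`. -/
def radAvg {V : Type*} [AddCommGroup V] (N : V → ℝ) {m : ℕ} (x : Fin m → V) : ℝ :=
  ((2 : ℝ) ^ m)⁻¹ * ∑ ε : Fin m → Bool, N (∑ i, if ε i then x i else -x i) ^ 2

/-- `N` has (Rademacher) type 2 with constant `C`. -/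
def Type2With {V : Type*} [AddCommGroup V] (N : V → ℝ) (C : ℝ) : Prop :=
  ∀ (m : ℕ) (x : Fin m → V), Real.sqrt (radAvg N x) ≤ C * Real.sqrt (∑ i, N (x i) ^ 2)

/-- `N` has (Rademacher) cotype 2 with constant `C`. -/
def Cotype2With {V : Type*} [AddCommGroup V] (N : V → ℝ) (C : ℝ) : Prop :=
  ∀ (m : ℕ) (x : Fin m → V), Real.sqrt (∑ i, N (x i) ^ 2) ≤ C * Real.sqrt (radAvg N x)

/-- The injective tensor norm of two norm functions. -/
def injN {V W : Type*} [AddCommGroup V] [Module ℂ V] [AddCommGroup W] [Module ℂ W]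
    (NV : V → ℝ) (NW : W → ℝ) (z : TensorProduct ℂ V W) : ℝ :=
  sSup {r : ℝ | ∃ (φ : V →ₗ[ℂ] ℂ) (ψ : W →ₗ[ℂ] ℂ),
    (∀ x, ‖φ x‖ ≤ NV x) ∧ (∀ y, ‖ψ y‖ ≤ NW y) ∧
    r = ‖TensorProduct.lift (((LinearMap.mul ℂ ℂ).comp φ).compl₂ ψ) z‖}

/-- Dual norm on linear functionals. -/
def dualNC {V : Type*} [AddCommGroup V] [Module ℂ V] (N : V → ℝ) (φ : V →ₗ[ℂ] ℂ) : ℝ :=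
  sSup {r : ℝ | ∃ x, N x ≤ 1 ∧ r = ‖φ x‖}

/-- The space of bounded linear functionals (dual space of the completion). -/
def BddDual {V : Type*} [AddCommGroup V] [Module ℂ V] (N : V → ℝ) :
    Submodule ℂ (V →ₗ[ℂ] ℂ) where
  carrier := {φ | ∃ c : ℝ, ∀ x, ‖φ x‖ ≤ c * N x}
  zero_mem' := ⟨0, by simp⟩
  add_mem' := by
    rintro φ ψ ⟨c, hc⟩ ⟨d, hd⟩
    exact ⟨c + d, fun x => by
      have h1 := hc x; have h2 := hd x
      calc ‖(φ + ψ) x‖ = ‖φ x + ψ x‖ := by simp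
        _ ≤ ‖φ x‖ + ‖ψ x‖ := norm_add_le _ _
        _ ≤ (c + d) * N x := by rw [add_mul]; exact add_le_add h1 h2⟩
  smul_mem' := by
    rintro a φ ⟨c, hc⟩
    exact ⟨‖a‖ * c, fun x => by
      have : ‖(a • φ) x‖ = ‖a‖ * ‖φ x‖ := by simp [norm_smul]
      rw [this, mul_assoc]
      exact mul_le_mul_of_nonneg_left (hc x) (norm_nonneg a)⟩

/-- Strictly simple functions with values in `V`: the span of
`v`-valued indicators of finite-measure measurable sets. -/
def SimpleSub {Ω : Type*} [MeasurableSpace Ω] (μ : Measure Ω)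
    (V : Type*) [AddCommGroup V] [Module ℂ V] : Submodule ℂ (Ω → V) :=
  Submodule.span ℂ {f | ∃ (s : Set Ω) (v : V), MeasurableSet s ∧ μ s < ⊤ ∧
    f = s.indicator fun _ => v}

/-- A Banach function space over a measure `μ`, with `K`-valued functions. -/
structure BFS (Ω : Type*) [MeasurableSpace Ω] (μ : Measure Ω) (K : Type*) [RCLike K] where
  mem : (Ω → K) → Prop
  nrm : (Ω → K) → ℝ
  mem_zero : mem 0
  mem_add : ∀ f g, mem f → mem g → mem (f + g)
  mem_smul : ∀ (c : K) (f), mem f → mem (c • f)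
  mem_meas : ∀ f, mem f → AEStronglyMeasurable f μ
  ideal : ∀ f g, AEStronglyMeasurable f μ → mem g →
    (∀ᵐ ω ∂μ, ‖f ω‖ ≤ ‖g ω‖) → mem f ∧ nrm f ≤ nrm g
  nrm_nonneg : ∀ f, 0 ≤ nrm f
  nrm_eq_zero : ∀ f, mem f → nrm f = 0 → f =ᵐ[μ] 0
  nrm_add : ∀ f g, mem f → mem g → nrm (f + g) ≤ nrm f + nrm g
  nrm_smul : ∀ (c : K) (f), nrm (c • f) = ‖c‖ * nrm f
  mem_indicator : ∀ s : Set Ω, MeasurableSet s → μ s < ⊤ →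
    mem (s.indicator fun _ => 1)
  complete : ∀ f : ℕ → Ω → K, (∀ k, mem (f k)) →
    (∀ ε : ℝ, 0 < ε → ∃ N : ℕ, ∀ p q, N ≤ p → N ≤ q → nrm (f p - f q) < ε) →
    ∃ g, mem g ∧ ∀ ε : ℝ, 0 < ε → ∃ N : ℕ, ∀ p, N ≤ p → nrm (f p - g) < ε

variable {Ω : Type*} [MeasurableSpace Ω] {μ : Measure Ω} {K : Type*} [RCLike K]

/-- `X` is `r`-convex with constant `C`. -/
def BFS.RConvexWith (X : BFS Ω μ K) (r C : ℝ) : Prop :=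
  ∀ (m : ℕ) (f : Fin m → Ω → K), (∀ i, X.mem (f i)) →
    X.mem (fun ω => ((((∑ i, ‖f i ω‖ ^ r) ^ (1 / r) : ℝ) : K))) ∧
    X.nrm (fun ω => ((((∑ i, ‖f i ω‖ ^ r) ^ (1 / r) : ℝ) : K))) ≤
      C * (∑ i, X.nrm (f i) ^ r) ^ (1 / r)

/-- `X` is `r`-concave with constant `C`. -/
def BFS.RConcaveWith (X : BFS Ω μ K) (r C : ℝ) : Prop :=
  ∀ (m : ℕ) (f : Fin m → Ω → K), (∀ i, X.mem (f i)) →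
    (∑ i, X.nrm (f i) ^ r) ^ (1 / r) ≤
      C * X.nrm (fun ω => ((((∑ i, ‖f i ω‖ ^ r) ^ (1 / r) : ℝ) : K)))

/-- Vector-valued lattice norm `X(E)` on `Eⁿ`. -/
def vecLatNorm {n : ℕ} {V : Type*} (N : (Fin n → ℝ) → ℝ) (NE : V → ℝ)
    (x : Fin n → V) : ℝ := N fun i => NE (x i)

/-- The sign attached to a Boolean. -/
def sgn (b : Bool) : ℝ := if b then 1 else -1

lemma sgn_mul_self (b : Bool) : sgn b * sgn b = 1 := by cases b <;> simp [sgn]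

lemma sgn_not (b : Bool) : sgn (!b) = -sgn b := by cases b <;> simp [sgn]

lemma abs_sgn (b : Bool) : |sgn b| = 1 := by cases b <;> simp [sgn]

section Walsh

variable {I : Type*}

/-- The Walsh function indexed by `A` on the cube `I → Bool`. -/
def walsh (A : Finset I) (a : I → Bool) : ℝ := ∏ i ∈ A, sgn (a i)

lemma walsh_empty (a : I → Bool) : walsh ∅ a = 1 := by simp [walsh]

lemma walsh_singleton (i : I) (a : I → Bool) : walsh {i} a = sgn (a i) := by simp [walsh]

lemma walsh_not (A : Finset I) (a : I → Bool) :
    walsh A (fun i => !a i) = (-1) ^ #A * walsh A a := by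
  simp [walsh, sgn_not, Finset.prod_neg]

variable [Fintype I] [DecidableEq I]

lemma sum_pow_mul_walsh (r : ℝ) (a b : I → Bool) :
    ∑ A : Finset I, r ^ #A * (walsh A a * walsh A b) = ∏ i, (1 + r * (sgn (a i) * sgn (b i))) := by
  rw [Finset.prod_one_add, Finset.powerset_univ]
  refine Finset.sum_congr rfl fun A _ => ?_
  simp [walsh, Finset.prod_mul_distrib]

lemma sum_walsh_mul_walsh (a b : I → Bool) :
    ∑ A : Finset I, walsh A a * walsh A b = if a = b then (2 : ℝ) ^ Fintype.card I else 0 := by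
  have h := sum_pow_mul_walsh 1 a b
  simp only [one_pow, one_mul] at h
  rw [h]
  split_ifs with hab
  · subst hab
    simp only [sgn_mul_self]
    norm_num [Finset.card_univ]
  · obtain ⟨i, hi⟩ := Function.ne_iff.1 hab
    refine Finset.prod_eq_zero (Finset.mem_univ i) ?_
    revert hi
    cases a i <;> cases b i <;> simp [sgn]

lemma sum_cube_walsh_mul_walsh (A B : Finset I) :
    ∑ a : I → Bool, walsh A a * walsh B a = if A = B then (2 : ℝ) ^ Fintype.card I else 0 := by
  have hc : Fintype.card (Finset I) = Fintype.card (I → Bool) := by simp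
  let e : Finset I ≃ (I → Bool) := Fintype.equivOfCardEq hc
  let M : Matrix (I → Bool) (Finset I) ℝ := Matrix.of fun a A => walsh A a
  let M' : Matrix (Finset I) (I → Bool) ℝ :=
    Matrix.of fun A a => ((2 : ℝ) ^ Fintype.card I)⁻¹ * walsh A a
  have h1 : M * M' = 1 := by
    ext a b
    have := sum_walsh_mul_walsh a b
    simp only [Matrix.mul_apply, M, M', Matrix.one_apply, Matrix.of_apply]
    rw [show ∑ A : Finset I, walsh A a * (((2 : ℝ) ^ Fintype.card I)⁻¹ * walsh A b)
      = ((2 : ℝ) ^ Fintype.card I)⁻¹ * ∑ A : Finset I, walsh A a * walsh A b by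
        rw [Finset.mul_sum]; exact Finset.sum_congr rfl fun A _ => by ring, this]
    split_ifs <;> simp
  have h2 : M' * M = 1 := (Matrix.mul_eq_one_comm_of_equiv e.symm).1 h1
  have h3 := congrFun (congrFun h2 A) B
  simp only [Matrix.mul_apply, M, M', Matrix.one_apply, Matrix.of_apply, mul_assoc, ← Finset.mul_sum] at h3
  have h4 : ∑ a : I → Bool, walsh A a * walsh B a
      = (2 : ℝ) ^ Fintype.card I * if A = B then 1 else 0 := by
    rw [← h3]; field_simp
  rw [h4]; split_ifs <;> simp

/-- Unnormalised Walsh coefficient. -/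
def wcoef (h : (I → Bool) → ℝ) (A : Finset I) : ℝ := ∑ a, h a * walsh A a

lemma sum_wcoef_mul (h g : (I → Bool) → ℝ) :
    ∑ A, wcoef h A * wcoef g A = (2 : ℝ) ^ Fintype.card I * ∑ a, h a * g a := by
  simp only [wcoef, Finset.sum_mul_sum]
  rw [Finset.sum_comm]
  simp only [Finset.sum_comm (s := (Finset.univ : Finset (Finset I)))]
  rw [Finset.mul_sum]
  refine Finset.sum_congr rfl fun a _ => ?_
  rw [Finset.sum_eq_single a]
  · rw [show ∑ A : Finset I, h a * walsh A a * (g a * walsh A a)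
      = h a * g a * ∑ A : Finset I, walsh A a * walsh A a by
        rw [Finset.mul_sum]; exact Finset.sum_congr rfl fun A _ => by ring, sum_walsh_mul_walsh]
    simp; ring
  · intro b _ hb
    rw [show ∑ A : Finset I, h a * walsh A a * (g b * walsh A b)
      = h a * g b * ∑ A : Finset I, walsh A a * walsh A b by
        rw [Finset.mul_sum]; exact Finset.sum_congr rfl fun A _ => by ring, sum_walsh_mul_walsh]
    simp [Ne.symm hb]
  · simp

/-- Flip the `i`-th coordinate. -/
def flip (i : I) (a : I → Bool) : I → Bool := Function.update a i (!a i)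

lemma flip_flip (i : I) (a : I → Bool) : flip i (flip i a) = a := by simp [flip]

/-- Flipping a coordinate, as a permutation of the cube. -/
def flipEquiv (i : I) : Equiv.Perm (I → Bool) := ⟨flip i, flip i, flip_flip i, flip_flip i⟩

lemma sgn_flip (i j : I) (a : I → Bool) :
    sgn (flip i a j) = if j = i then -sgn (a j) else sgn (a j) := by
  by_cases h : j = i
  · subst h; simp [flip, sgn_not]
  · simp [flip, h]

lemma walsh_flip (i : I) (A : Finset I) (a : I → Bool) :
    walsh A (flip i a) = (if i ∈ A then -1 else 1) * walsh A a := by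
  have : ∀ j, sgn (flip i a j) = (if j = i then -1 else 1) * sgn (a j) := fun j => by
    rw [sgn_flip]; split_ifs <;> simp
  simp only [walsh, this, Finset.prod_mul_distrib, Finset.prod_ite_eq']

lemma wcoef_flip (h : (I → Bool) → ℝ) (i : I) (A : Finset I) :
    wcoef (fun a => h (flip i a)) A = (if i ∈ A then -1 else 1) * wcoef h A := by
  rw [wcoef, ← Equiv.sum_comp (flipEquiv i), wcoef, Finset.mul_sum]
  refine Finset.sum_congr rfl fun a _ => ?_
  simp only [flipEquiv, Equiv.coe_fn_mk, flip_flip, walsh_flip]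
  ring

/-- The number operator of the cube. -/
def numOp (h : (I → Bool) → ℝ) (a : I → Bool) : ℝ := ∑ i, (h a - h (flip i a)) / 2

lemma wcoef_numOp (h : (I → Bool) → ℝ) (A : Finset I) :
    wcoef (numOp h) A = #A * wcoef h A := by
  have : wcoef (numOp h) A = ∑ i, (wcoef h A - wcoef (fun a => h (flip i a)) A) / 2 := by
    simp only [wcoef, numOp, Finset.sum_mul, ← Finset.sum_sub_distrib, Finset.sum_div]
    rw [Finset.sum_comm]
    exact Finset.sum_congr rfl fun i _ => Finset.sum_congr rfl fun a _ => by ring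
  rw [this]
  simp only [wcoef_flip]
  have : ∀ i : I, (wcoef h A - (if i ∈ A then -1 else 1) * wcoef h A) / 2
      = if i ∈ A then wcoef h A else 0 := fun i => by split_ifs <;> ring
  rw [Finset.sum_congr rfl fun i _ => this i]
  simp

lemma wcoef_odd (h : (I → Bool) → ℝ) (heven : ∀ a, h (fun i => !a i) = h a) (A : Finset I)
    (hA : Odd #A) : wcoef h A = 0 := by
  let e : Equiv.Perm (I → Bool) :=
    ⟨fun a i => !a i, fun a i => !a i, fun a => by simp, fun a => by simp⟩
  have : wcoef h A = -wcoef h A := by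
    conv_lhs => rw [wcoef, ← Equiv.sum_comp e]
    rw [wcoef, ← Finset.sum_neg_distrib]
    refine Finset.sum_congr rfl fun a _ => ?_
    simp only [e, Equiv.coe_fn_mk, heven, walsh_not, hA.neg_one_pow]
    ring
  linarith

/-- The Kahane inequality between the first and second moments, with its best constant. -/
lemma sum_sq_norm_rademacher_le {V : Type*} [SeminormedAddCommGroup V] [NormedSpace ℝ V]
    (x : I → V) :
    (2 : ℝ) ^ Fintype.card I * ∑ a : I → Bool, ‖∑ i, sgn (a i) • x i‖ ^ 2
      ≤ 2 * (∑ a : I → Bool, ‖∑ i, sgn (a i) • x i‖) ^ 2 := by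
  set h : (I → Bool) → ℝ := fun a => ‖∑ i, sgn (a i) • x i‖ with hh
  have heven : ∀ a, h (fun i => !a i) = h a := fun a => by
    simp only [hh, sgn_not, neg_smul, Finset.sum_neg_distrib, norm_neg]
  have hL : ∀ a, numOp h a ≤ h a := fun a => by
    have h1 : ((Fintype.card I : ℝ) - 2) * h a ≤ ∑ i, h (flip i a) := by
      calc ((Fintype.card I : ℝ) - 2) * h a ≤ |(Fintype.card I : ℝ) - 2| * h a :=
            mul_le_mul_of_nonneg_right (le_abs_self _) (norm_nonneg _)
        _ = ‖∑ i, ∑ j, sgn (flip i a j) • x j‖ := by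
            rw [← Real.norm_eq_abs, hh, ← norm_smul]
            congr 1
            rw [Finset.sum_comm, Finset.smul_sum]
            refine Finset.sum_congr rfl fun j _ => ?_
            rw [← Finset.sum_smul, smul_smul]
            congr 1
            have : ∀ i, sgn (flip i a j) = sgn (a j) - if j = i then 2 * sgn (a j) else 0 :=
              fun i => by rw [sgn_flip]; split_ifs <;> ring
            simp only [this, Finset.sum_sub_distrib, Finset.sum_ite_eq, Finset.mem_univ, if_true,
              Finset.sum_const, Finset.card_univ, nsmul_eq_mul]
            ring
        _ ≤ ∑ i, h (flip i a) := norm_sum_le _ _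
    have h2 : numOp h a = ((Fintype.card I : ℝ) * h a - ∑ i, h (flip i a)) / 2 := by
      simp [numOp, ← Finset.sum_div, Finset.sum_sub_distrib]
    rw [h2]; linarith
  have hpars := sum_wcoef_mul h h
  have henergy := sum_wcoef_mul h (numOp h)
  simp only [wcoef_numOp] at henergy
  have h1 : ∑ a, h a * numOp h a ≤ ∑ a, h a * h a :=
    Finset.sum_le_sum fun a _ => mul_le_mul_of_nonneg_left (hL a) (norm_nonneg _)
  have h2 : 2 * (∑ A, wcoef h A * wcoef h A - wcoef h ∅ * wcoef h ∅)
      ≤ ∑ A, wcoef h A * (#A * wcoef h A) := by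
    have : wcoef h ∅ * wcoef h ∅ = ∑ A : Finset I, if A = ∅ then wcoef h A * wcoef h A else 0 := by
      simp
    rw [this, ← Finset.sum_sub_distrib, Finset.mul_sum]
    refine Finset.sum_le_sum fun A _ => ?_
    by_cases hA : A = ∅
    · simp [hA]
    rcases Nat.even_or_odd #A with he | ho
    · have : 2 ≤ #A := by
        have : #A ≠ 0 := by simpa using hA
        obtain ⟨r, hr⟩ := he; omega
      have : (2 : ℝ) ≤ #A := by exact_mod_cast this
      simp only [hA, if_false, sub_zero]
      nlinarith [mul_self_nonneg (wcoef h A)]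
    · simp [wcoef_odd h heven A ho]
  have h3 : wcoef h ∅ = ∑ a, h a := by simp [wcoef, walsh_empty]
  rw [h3, hpars, henergy] at h2
  have hp : (0 : ℝ) < 2 ^ Fintype.card I := by positivity
  have h4 := mul_le_mul_of_nonneg_left h1 hp.le
  have h5 : ∑ a, h a ^ 2 = ∑ a, h a * h a := Finset.sum_congr rfl fun a _ => sq _
  change (2 : ℝ) ^ Fintype.card I * ∑ a, h a ^ 2 ≤ 2 * (∑ a, h a) ^ 2
  rw [h5]
  nlinarith

end Walsh

section Duality

variable {V : Type*} [NormedAddCommGroup V] [NormedSpace ℂ V]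

/-- Functionals are represented by bounded functions when the system `φ` satisfies a lower
square function estimate. -/
lemma exists_bounded_representation {S W : Type*} [Fintype S] [Fintype W] [DecidableEq W]
    (φ : S → W → ℂ) (c : ℝ)
    (h : ∀ e : S → V, √(∑ s, ‖e s‖ ^ 2) ≤ c * ∑ w, ‖∑ s, φ s w • e s‖) (hc : 0 ≤ c)
    (x : S → StrongDual ℂ V) :
    ∃ f : W → StrongDual ℂ V, (∀ w, ‖f w‖ ≤ c * √(∑ s, ‖x s‖ ^ 2)) ∧
      ∀ s, ∑ w, φ s w • f w = x s := by
  classical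
  let A : (S → V) →ₗ[ℂ] PiLp 1 (fun _ : W => V) :=
    { toFun := fun e => WithLp.toLp 1 fun w => ∑ s, φ s w • e s
      map_add' := fun e e' => by
        ext w; simp [Finset.sum_add_distrib]
      map_smul' := fun a e => by
        ext w; simp [Finset.smul_sum, smul_comm a] }
  have hA : ∀ e, ‖A e‖ = ∑ w, ‖∑ s, φ s w • e s‖ := fun e => by
    simp [A, PiLp.norm_eq_of_nat (p := 1) 1 (by simp)]
  have hinj : Function.Injective A := by
    rw [← LinearMap.ker_eq_bot, LinearMap.ker_eq_bot']
    intro e he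
    have h1 := h e
    rw [← hA, he, norm_zero, mul_zero] at h1
    have h2 := Real.sqrt_eq_zero'.1 (le_antisymm h1 (Real.sqrt_nonneg _))
    have h3 : ∑ s, ‖e s‖ ^ 2 = 0 := le_antisymm h2 (Finset.sum_nonneg fun _ _ => sq_nonneg _)
    rw [Finset.sum_eq_zero_iff_of_nonneg fun _ _ => sq_nonneg _] at h3
    funext s
    simpa using h3 s (Finset.mem_univ s)
  let B := LinearEquiv.ofInjective A hinj
  let X : (S → V) →ₗ[ℂ] ℂ := ∑ s, (x s).toLinearMap.comp (LinearMap.proj s)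
  have hX : ∀ e, X e = ∑ s, x s (e s) := fun e => by simp [X]
  have hXb : ∀ e, ‖X e‖ ≤ c * √(∑ s, ‖x s‖ ^ 2) * ‖A e‖ := fun e => by
    rw [hX, hA]
    calc ‖∑ s, x s (e s)‖ ≤ ∑ s, ‖x s‖ * ‖e s‖ :=
          norm_sum_le_of_le _ fun s _ => (x s).le_opNorm _
      _ ≤ √(∑ s, ‖x s‖ ^ 2) * √(∑ s, ‖e s‖ ^ 2) :=
          Real.sum_mul_le_sqrt_mul_sqrt _ _ _
      _ ≤ √(∑ s, ‖x s‖ ^ 2) * (c * ∑ w, ‖∑ s, φ s w • e s‖) :=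
          mul_le_mul_of_nonneg_left (h e) (Real.sqrt_nonneg _)
      _ = _ := by ring
  let ℓ : StrongDual ℂ (LinearMap.range A) :=
    (X.comp B.symm.toLinearMap).mkContinuous (c * √(∑ s, ‖x s‖ ^ 2)) fun u => by
      have := hXb (B.symm u)
      have h2 : A (B.symm u) = (u : PiLp 1 (fun _ : W => V)) := by
        have := B.apply_symm_apply u
        exact congrArg Subtype.val this
      rw [h2] at this
      exact this
  have hℓ : ‖ℓ‖ ≤ c * √(∑ s, ‖x s‖ ^ 2) :=
    LinearMap.mkContinuous_norm_le _ (mul_nonneg hc (Real.sqrt_nonneg _)) _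
  obtain ⟨g, hg, hgn⟩ := exists_extension_norm_eq _ ℓ
  have hgA : ∀ e, g (A e) = ∑ s, x s (e s) := fun e => by
    have h1 := hg (B e)
    have h2 : ℓ (B e) = X e := congrArg X (B.symm_apply_apply e)
    rw [h2, hX] at h1
    exact h1
  have hsingle : ∀ (w : W) (v : V), ‖(WithLp.toLp 1 (Pi.single w v) : PiLp 1 (fun _ : W => V))‖
      = ‖v‖ := fun w v => by
    exact PiLp.norm_single 1 (fun _ : W => V) w v
  let f : W → StrongDual ℂ V := fun w =>
    (g.toLinearMap.comp ((WithLp.linearEquiv 1 ℂ (W → V)).symm.toLinearMap.comp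
      (LinearMap.single ℂ (fun _ : W => V) w))).mkContinuous ‖g‖ fun v => by
        have := g.le_opNorm (WithLp.toLp 1 (Pi.single w v))
        rw [hsingle] at this
        exact this
  have hf : ∀ w v, f w v = g (WithLp.toLp 1 (Pi.single w v)) := fun w v => rfl
  refine ⟨f, fun w => ?_, fun s => ?_⟩
  · refine (LinearMap.mkContinuous_norm_le _ (norm_nonneg _) _).trans ?_
    rw [hgn]; exact hℓ
  · ext v
    have h1 := hgA (Pi.single s v)
    have h2 : ∑ t, x t ((Pi.single s v : S → V) t) = x s v := by
      rw [Finset.sum_eq_single s]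
      · simp
      · intro t _ ht; simp [Pi.single_eq_of_ne ht]
      · simp
    rw [h2] at h1
    rw [← h1]
    have h3 : A (Pi.single s v) = ∑ w, φ s w • WithLp.toLp 1 (Pi.single w v) := by
      ext w
      simp only [A, LinearMap.coe_mk, AddHom.coe_mk]
      rw [Finset.sum_eq_single s]
      · rw [WithLp.ofLp_sum, Finset.sum_apply, Finset.sum_eq_single w]
        · simp
        · intro t _ ht
          simp only [WithLp.ofLp_smul, Pi.smul_apply]
          rw [Pi.single_eq_of_ne ht.symm, smul_zero]
        · simp
      · intro t _ ht; simp [Pi.single_eq_of_ne ht]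
      · simp
    rw [h3, map_sum]
    simp [hf]

/-- Cotype 2 with constant `C` gives a lower first-moment estimate for Rademacher sums. -/
lemma cotype_first_moment {C : ℝ} (hC : 0 ≤ C) (hcot : Cotype2With (fun v : V => ‖v‖) C)
    {I : Type*} [Fintype I] [DecidableEq I] (e : I → V) :
    √(∑ i, ‖e i‖ ^ 2) ≤
      √2 * C * (((2 : ℝ) ^ Fintype.card I)⁻¹ * ∑ a : I → Bool, ‖∑ i, sgn (a i) • e i‖) := by
  have h1 := hcot (Fintype.card I) (e ∘ (Fintype.equivFin I).symm)
  have h2 : ∑ i, ‖(e ∘ (Fintype.equivFin I).symm) i‖ ^ 2 = ∑ i, ‖e i‖ ^ 2 :=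
    Equiv.sum_comp (Fintype.equivFin I).symm fun i => ‖e i‖ ^ 2
  have h3 : radAvg (fun v : V => ‖v‖) (e ∘ (Fintype.equivFin I).symm)
      = ((2 : ℝ) ^ Fintype.card I)⁻¹ * ∑ a : I → Bool, ‖∑ i, sgn (a i) • e i‖ ^ 2 := by
    rw [radAvg]
    congr 1
    rw [← Equiv.sum_comp (Equiv.arrowCongr (Fintype.equivFin I) (Equiv.refl Bool))]
    refine Finset.sum_congr rfl fun a _ => ?_
    congr 2
    rw [← Equiv.sum_comp (Fintype.equivFin I)]
    refine Finset.sum_congr rfl fun i _ => ?_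
    cases h : a i <;> simp [Equiv.arrowCongr, h, sgn]
  rw [h2, h3] at h1
  refine h1.trans ?_
  rw [mul_comm (√2), mul_assoc]
  refine mul_le_mul_of_nonneg_left ?_ hC
  set p : ℝ := (2 : ℝ) ^ Fintype.card I with hp
  have hp0 : 0 < p := by positivity
  have h4 := sum_sq_norm_rademacher_le e
  set Q := ∑ a : I → Bool, ‖∑ i, sgn (a i) • e i‖ ^ 2
  set R := ∑ a : I → Bool, ‖∑ i, sgn (a i) • e i‖ with hR
  have hR0 : 0 ≤ R := Finset.sum_nonneg fun _ _ => norm_nonneg _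
  rw [Real.sqrt_le_left (by positivity), mul_pow, Real.sq_sqrt (by norm_num), mul_pow]
  have : p⁻¹ * Q = p⁻¹ ^ 2 * (p * Q) := by field_simp
  rw [this]
  calc p⁻¹ ^ 2 * (p * Q) ≤ p⁻¹ ^ 2 * (2 * R ^ 2) := by gcongr
    _ = _ := by ring

end Duality

section CentralLimit

/-- The average of a function on the discrete cube. -/
def cubeAvg {I : Type*} [Fintype I] [DecidableEq I] (g : (I → Bool) → ℝ) : ℝ :=
  ((2 : ℝ) ^ Fintype.card I)⁻¹ * ∑ a, g a

section Avg

variable {I : Type*} [Fintype I] [DecidableEq I]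

lemma cubeAvg_mono {g g' : (I → Bool) → ℝ} (h : ∀ a, g a ≤ g' a) : cubeAvg g ≤ cubeAvg g' :=
  mul_le_mul_of_nonneg_left (Finset.sum_le_sum fun a _ => h a) (by positivity)

lemma cubeAvg_add (g g' : (I → Bool) → ℝ) :
    cubeAvg (fun a => g a + g' a) = cubeAvg g + cubeAvg g' := by
  simp [cubeAvg, Finset.sum_add_distrib, mul_add]

lemma cubeAvg_sub (g g' : (I → Bool) → ℝ) :
    cubeAvg (fun a => g a - g' a) = cubeAvg g - cubeAvg g' := by
  simp [cubeAvg, Finset.sum_sub_distrib, mul_sub]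

lemma cubeAvg_const_mul (c : ℝ) (g : (I → Bool) → ℝ) :
    cubeAvg (fun a => c * g a) = c * cubeAvg g := by
  simp only [cubeAvg, ← Finset.mul_sum]; ring

lemma cubeAvg_sum {J : Type*} (t : Finset J) (g : J → (I → Bool) → ℝ) :
    cubeAvg (fun a => ∑ j ∈ t, g j a) = ∑ j ∈ t, cubeAvg (g j) := by
  simp only [cubeAvg, ← Finset.mul_sum]
  rw [Finset.sum_comm]

lemma cubeAvg_const (c : ℝ) : cubeAvg (fun _ : I → Bool => c) = c := by
  simp [cubeAvg]

lemma cubeAvg_sgn_mul_sgn (i j : I) :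
    cubeAvg (fun a => sgn (a i) * sgn (a j)) = if i = j then 1 else 0 := by
  have := sum_cube_walsh_mul_walsh ({i} : Finset I) {j}
  simp only [walsh_singleton, Finset.singleton_inj] at this
  rw [cubeAvg, this]
  split_ifs <;> simp

end Avg

variable {S : Type*} [Fintype S] [DecidableEq S]

/-- Normalised sum of the `s`-th block of signs. -/
def blockSum (L : ℕ) (s : S) (a : S × Fin L → Bool) : ℝ := (√L)⁻¹ * ∑ t, sgn (a (s, t))

/-- Rotated block sums. -/
def rotSum (O : Matrix S S ℝ) (L : ℕ) (r : S) (a : S × Fin L → Bool) : ℝ :=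
  ∑ s, O s r * blockSum L s a

lemma rotSum_one (L : ℕ) (r : S) (a : S × Fin L → Bool) : rotSum 1 L r a = blockSum L r a := by
  simp [rotSum, Matrix.one_apply]

lemma cubeAvg_blockSum_mul (L : ℕ) (hL : 0 < L) (s s' : S) :
    cubeAvg (fun a => blockSum L s a * blockSum L s' a) = if s = s' then 1 else 0 := by
  have h1 : ∀ a : S × Fin L → Bool, blockSum L s a * blockSum L s' a
      = (L : ℝ)⁻¹ * ∑ t, ∑ t', sgn (a (s, t)) * sgn (a (s', t')) := fun a => by
    rw [blockSum, blockSum, ← Finset.sum_mul_sum]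
    have : (√L)⁻¹ * (√L)⁻¹ = (L : ℝ)⁻¹ := by rw [← mul_inv, Real.mul_self_sqrt (by positivity)]
    rw [← this]; ring
  simp only [h1, cubeAvg_const_mul, cubeAvg_sum, cubeAvg_sgn_mul_sgn, Prod.mk.injEq]
  by_cases h : s = s'
  · have : (L : ℝ) ≠ 0 := by positivity
    simp [h, this]
  · simp [h]

lemma cubeAvg_rotSum_sq (O : Matrix S S ℝ) (hO : O ∈ Matrix.orthogonalGroup S ℝ)
    (L : ℕ) (hL : 0 < L) (r : S) :
    cubeAvg (fun a => rotSum O L r a ^ 2) = 1 := by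
  have h1 : ∀ a : S × Fin L → Bool, rotSum O L r a ^ 2
      = ∑ s, ∑ s', (O s r * O s' r) * (blockSum L s a * blockSum L s' a) := fun a => by
    rw [sq, rotSum, Finset.sum_mul_sum]
    exact Finset.sum_congr rfl fun s _ => Finset.sum_congr rfl fun s' _ => by ring
  simp only [h1, cubeAvg_sum, cubeAvg_const_mul, cubeAvg_blockSum_mul L hL]
  have h2 := congrFun (congrFun ((Matrix.mem_orthogonalGroup_iff' S ℝ).1 hO) r) r
  simp only [Matrix.mul_apply, Matrix.transpose_apply, Matrix.one_apply_eq] at h2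
  simpa using h2

lemma tendsto_cos_pow (x : ℝ) :
    Filter.Tendsto (fun L : ℕ => Real.cos ((√L)⁻¹ * x) ^ L) Filter.atTop
      (nhds (Real.exp (-x ^ 2 / 2))) := by
  have h : Filter.Tendsto (fun L : ℕ => (L : ℝ) * (Real.cos ((√L)⁻¹ * x) - 1)) Filter.atTop
      (nhds (-x ^ 2 / 2)) := by
    have hinv : Filter.Tendsto (fun L : ℕ => (L : ℝ)⁻¹) Filter.atTop (nhds 0) :=
      tendsto_inv_atTop_nhds_zero_nat
    rw [tendsto_iff_norm_sub_tendsto_zero]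
    have hlim : Filter.Tendsto (fun L : ℕ => x ^ 4 * (5 / 96) * (L : ℝ)⁻¹) Filter.atTop
        (nhds 0) := by simpa using hinv.const_mul (x ^ 4 * (5 / 96))
    refine squeeze_zero' (Filter.Eventually.of_forall fun _ => norm_nonneg _) ?_ hlim
    have h0 : Filter.Tendsto (fun L : ℕ => x ^ 2 * (L : ℝ)⁻¹) Filter.atTop (nhds 0) := by
      simpa using hinv.const_mul (x ^ 2)
    filter_upwards [h0.eventually (gt_mem_nhds zero_lt_one), Filter.eventually_gt_atTop 0]
      with L hL hL0
    have hLp : (0 : ℝ) < L := by exact_mod_cast hL0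
    have hsq : ((√L)⁻¹ * x) ^ 2 = x ^ 2 * (L : ℝ)⁻¹ := by
      rw [mul_pow, inv_pow, Real.sq_sqrt hLp.le, mul_comm]
    have hle : |(√L)⁻¹ * x| ≤ 1 := by
      rw [← sq_le_one_iff_abs_le_one, hsq]; exact hL.le
    have hb := Real.cos_bound hle
    have h4 : |(√L)⁻¹ * x| ^ 4 = x ^ 4 * (L : ℝ)⁻¹ ^ 2 := by
      rw [show |(√L)⁻¹ * x| ^ 4 = (|(√L)⁻¹ * x| ^ 2) ^ 2 by ring, sq_abs, hsq]; ring
    rw [h4, hsq] at hb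
    have : (L : ℝ) * (Real.cos ((√L)⁻¹ * x) - 1) - -x ^ 2 / 2
        = L * (Real.cos ((√L)⁻¹ * x) - (1 - x ^ 2 * (L : ℝ)⁻¹ / 2)) := by
      field_simp; ring
    rw [this, norm_mul, Real.norm_eq_abs, Real.norm_eq_abs, abs_of_pos hLp]
    calc (L : ℝ) * |Real.cos ((√L)⁻¹ * x) - (1 - x ^ 2 * (L : ℝ)⁻¹ / 2)|
        ≤ L * (x ^ 4 * (L : ℝ)⁻¹ ^ 2 * (5 / 96)) := by gcongr
      _ = _ := by field_simp
  have := Real.tendsto_one_add_pow_exp_of_tendsto h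
  simpa using this

lemma sum_cexp_blockSum (L : ℕ) (x : S → ℝ) :
    ((2 : ℂ) ^ Fintype.card (S × Fin L))⁻¹ *
      ∑ a : S × Fin L → Bool, Complex.exp ((∑ s, blockSum L s a * x s : ℝ) * Complex.I)
      = ((∏ s, Real.cos ((√L)⁻¹ * x s) ^ L : ℝ) : ℂ) := by
  have h1 : ∀ a : S × Fin L → Bool,
      Complex.exp ((∑ s, blockSum L s a * x s : ℝ) * Complex.I)
        = ∏ i : S × Fin L, Complex.exp ((sgn (a i) * ((√L)⁻¹ * x i.1) : ℝ) * Complex.I) := fun a => by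
    rw [← Complex.exp_sum, ← Finset.sum_mul, ← Complex.ofReal_sum]
    congr 3
    rw [Fintype.sum_prod_type]
    refine Finset.sum_congr rfl fun s _ => ?_
    rw [blockSum, Finset.mul_sum, Finset.sum_mul]
    exact Finset.sum_congr rfl fun t _ => by ring
  simp only [h1]
  rw [← Fintype.prod_sum fun (i : S × Fin L) (b : Bool) =>
    Complex.exp ((sgn b * ((√L)⁻¹ * x i.1) : ℝ) * Complex.I)]
  have h2 : ∀ i : S × Fin L, ∑ b : Bool, Complex.exp ((sgn b * ((√L)⁻¹ * x i.1) : ℝ) * Complex.I)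
      = 2 * (Real.cos ((√L)⁻¹ * x i.1) : ℂ) := fun i => by
    rw [Complex.ofReal_cos, Complex.cos]
    simp [sgn]
    ring
  simp only [h2, Finset.prod_mul_distrib, Finset.prod_const, Finset.card_univ]
  rw [← mul_assoc, inv_mul_cancel₀ (pow_ne_zero _ two_ne_zero), one_mul, Fintype.prod_prod_type]
  simp

/-- The law of the rotated block sums. -/
def rotLaw (O : Matrix S S ℝ) (L : ℕ) : ProbabilityMeasure (EuclideanSpace ℝ S) :=
  ⟨(PMF.uniformOfFintype (S × Fin L → Bool)).toMeasure.map
      fun a => WithLp.toLp 2 fun r => rotSum O L r a,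
    Measure.isProbabilityMeasure_map (measurable_of_finite _).aemeasurable⟩

lemma integral_rotLaw {V : Type*} [NormedAddCommGroup V] [NormedSpace ℝ V] [CompleteSpace V]
    (O : Matrix S S ℝ) (L : ℕ) (G : EuclideanSpace ℝ S → V) (hG : Continuous G)
    [SecondCountableTopology V] :
    ∫ x, G x ∂(rotLaw O L : Measure (EuclideanSpace ℝ S)) =
      ((2 : ℝ) ^ Fintype.card (S × Fin L))⁻¹ • ∑ a : S × Fin L → Bool,
        G (WithLp.toLp 2 fun r => rotSum O L r a) := by
  rw [rotLaw]
  simp only [ProbabilityMeasure.coe_mk]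
  rw [integral_map (measurable_of_finite _).aemeasurable
    hG.stronglyMeasurable.aestronglyMeasurable, PMF.integral_eq_sum, Finset.smul_sum]
  simp

lemma tendsto_rotLaw (O : Matrix S S ℝ) (hO : O ∈ Matrix.orthogonalGroup S ℝ) :
    Filter.Tendsto (rotLaw O) Filter.atTop
      (nhds ⟨ProbabilityTheory.stdGaussian (EuclideanSpace ℝ S), inferInstance⟩) := by
  refine ProbabilityMeasure.tendsto_of_tendsto_charFun fun ξ => ?_
  simp only [ProbabilityMeasure.coe_mk]
  rw [ProbabilityTheory.charFun_stdGaussian]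
  set η : S → ℝ := fun s => ∑ r, O s r * ξ r with hη
  have hinner : ∀ (L : ℕ) (a : S × Fin L → Bool),
      inner ℝ (WithLp.toLp 2 fun r => rotSum O L r a : EuclideanSpace ℝ S) ξ
        = ∑ s, blockSum L s a * η s := fun L a => by
    simp only [PiLp.inner_apply, rotSum, hη, Finset.mul_sum]
    rw [Finset.sum_comm]
    refine Finset.sum_congr rfl fun r _ => ?_
    simp only [RCLike.inner_apply, conj_trivial, Finset.mul_sum]
    exact Finset.sum_congr rfl fun s _ => by ring
  have hchar : ∀ L, charFun (rotLaw O L : Measure (EuclideanSpace ℝ S)) ξ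
      = ((∏ s, Real.cos ((√L)⁻¹ * η s) ^ L : ℝ) : ℂ) := fun L => by
    rw [charFun_apply, integral_rotLaw _ _ _ (by fun_prop), ← sum_cexp_blockSum]
    simp only [hinner]
    rw [Complex.real_smul]
    push_cast
    rfl
  simp only [hchar]
  have hnorm : ∑ s, η s ^ 2 = ‖ξ‖ ^ 2 := by
    rw [EuclideanSpace.norm_sq_eq]
    have h1 : ∀ r r', ∑ s, O s r * O s r' = if r = r' then 1 else 0 := fun r r' => by
      have := congrFun (congrFun ((Matrix.mem_orthogonalGroup_iff' S ℝ).1 hO) r) r'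
      simpa [Matrix.mul_apply, Matrix.one_apply] using this
    have h2 : ∀ s, η s ^ 2 = ∑ r, ∑ r', ξ r * ξ r' * (O s r * O s r') := fun s => by
      rw [hη, sq, Finset.sum_mul_sum]
      exact Finset.sum_congr rfl fun r _ => Finset.sum_congr rfl fun r' _ => by ring
    simp only [h2]
    rw [Finset.sum_comm]
    simp only [Finset.sum_comm (s := (Finset.univ : Finset S)) (t := (Finset.univ : Finset S))
      (f := fun s r' => _ * (O s _ * O s r'))]
    simp only [← Finset.mul_sum, h1]
    simp [sq]
  have hlim := tendsto_finsetProd (Finset.univ : Finset S) fun s _ => tendsto_cos_pow (η s)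
  have hexp : ∏ s, Real.exp (-η s ^ 2 / 2) = Real.exp (-‖ξ‖ ^ 2 / 2) := by
    rw [← Real.exp_sum, ← hnorm, ← Finset.sum_div, Finset.sum_neg_distrib]
  rw [hexp] at hlim
  have := (Complex.continuous_ofReal.tendsto _).comp hlim
  simpa [Function.comp_def] using this

lemma cubeAvg_rotSum_compare (O : Matrix S S ℝ) (hO : O ∈ Matrix.orthogonalGroup S ℝ)
    (G : BoundedContinuousFunction (EuclideanSpace ℝ S) ℝ) {δ : ℝ} (hδ : 0 < δ) :
    ∀ᶠ L in Filter.atTop,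
      cubeAvg (fun a : S × Fin L → Bool => G (WithLp.toLp 2 fun r => blockSum L r a)) - δ <
        cubeAvg (fun a : S × Fin L → Bool => G (WithLp.toLp 2 fun r => rotSum O L r a)) := by
  have h1 := ProbabilityMeasure.tendsto_iff_forall_integral_tendsto.1 (tendsto_rotLaw O hO) G
  have h2 := ProbabilityMeasure.tendsto_iff_forall_integral_tendsto.1
    (tendsto_rotLaw (1 : Matrix S S ℝ) (one_mem _)) G
  have h3 := h1.sub h2
  rw [sub_self] at h3
  filter_upwards [h3.eventually (lt_mem_nhds (neg_lt_zero.2 hδ))] with L hL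
  rw [integral_rotLaw _ _ _ G.continuous, integral_rotLaw _ _ _ G.continuous] at hL
  simp only [rotSum_one, smul_eq_mul] at hL
  simp only [cubeAvg]
  linarith

end CentralLimit

section LowerEstimate

variable {S : Type*} [Fintype S] [DecidableEq S]
  {V : Type*} [NormedAddCommGroup V] [NormedSpace ℂ V]

lemma blockSum_lower {C : ℝ} (hC : 0 ≤ C) (hcot : Cotype2With (fun v : V => ‖v‖) C)
    (L : ℕ) (hL : 0 < L) (f : S → V) :
    √(∑ s, ‖f s‖ ^ 2) ≤ √2 * C *
      cubeAvg (fun a : S × Fin L → Bool => ‖∑ s, blockSum L s a • f s‖) := by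
  have h := cotype_first_moment hC hcot fun i : S × Fin L => (√L)⁻¹ • f i.1
  have h1 : ∑ i : S × Fin L, ‖(√L)⁻¹ • f i.1‖ ^ 2 = ∑ s, ‖f s‖ ^ 2 := by
    have hLp : (0 : ℝ) < L := by exact_mod_cast hL
    rw [Fintype.sum_prod_type]
    refine Finset.sum_congr rfl fun s _ => ?_
    simp only [norm_smul, mul_pow, Real.norm_eq_abs, sq_abs, inv_pow, Real.sq_sqrt hLp.le,
      Finset.sum_const, Finset.card_univ, Fintype.card_fin, nsmul_eq_mul]
    field_simp
  have h2 : ∀ a : S × Fin L → Bool, ∑ i, sgn (a i) • ((√L)⁻¹ • f i.1)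
      = ∑ s, blockSum L s a • f s := fun a => by
    rw [Fintype.sum_prod_type]
    refine Finset.sum_congr rfl fun s _ => ?_
    rw [blockSum, Finset.mul_sum, Finset.sum_smul]
    exact Finset.sum_congr rfl fun t _ => by rw [smul_smul, mul_comm]
  rw [h1] at h
  simp only [h2] at h
  exact h

lemma cubeAvg_norm_rotSum_sub_le (O : Matrix S S ℝ) (hO : O ∈ Matrix.orthogonalGroup S ℝ)
    (L : ℕ) (hL : 0 < L) (f g : S → V) :
    cubeAvg (fun a : S × Fin L → Bool => ‖∑ s, rotSum O L s a • f s‖)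
      - cubeAvg (fun a : S × Fin L → Bool => ‖∑ s, rotSum O L s a • g s‖)
      ≤ Fintype.card S * ‖f - g‖ := by
  rw [← cubeAvg_sub]
  calc _ ≤ cubeAvg (fun a : S × Fin L → Bool =>
        ∑ s, ‖f - g‖ * ((1 / 2) * (1 + rotSum O L s a ^ 2))) := cubeAvg_mono fun a => by
        refine (norm_sub_norm_le _ _).trans ?_
        rw [← Finset.sum_sub_distrib]
        refine norm_sum_le_of_le _ fun s _ => ?_
        rw [← smul_sub, norm_smul, Real.norm_eq_abs, mul_comm]
        refine mul_le_mul (norm_le_pi_norm (f - g) s) ?_ (abs_nonneg _) (norm_nonneg _)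
        nlinarith [sq_nonneg (|rotSum O L s a| - 1), sq_abs (rotSum O L s a)]
    _ = _ := by
        simp only [cubeAvg_sum, cubeAvg_const_mul, cubeAvg_add, cubeAvg_const,
          cubeAvg_rotSum_sq O hO L hL]
        norm_num

lemma exists_rotSum_lower_at {C : ℝ} (hC : 0 ≤ C) (hcot : Cotype2With (fun v : V => ‖v‖) C)
    (O : Matrix S S ℝ) (hO : O ∈ Matrix.orthogonalGroup S ℝ) (f : S → V)
    (hf : ∑ s, ‖f s‖ ^ 2 = 1) {δ : ℝ} (hδ : 0 < δ) :
    ∀ᶠ L in Filter.atTop, (√2 * C)⁻¹ - δ <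
      cubeAvg (fun a : S × Fin L → Bool => ‖∑ s, rotSum O L s a • f s‖) := by
  set c : ℝ := (Fintype.card S : ℝ) with hc
  obtain ⟨R, hR0, hR⟩ : ∃ R : ℝ, 0 < R ∧ c / R ≤ δ / 2 := by
    refine ⟨2 * (c + 1) / δ, by positivity, ?_⟩
    have : 0 ≤ c := by positivity
    rw [div_le_div_iff₀ (by positivity) (by norm_num)]
    field_simp
    nlinarith
  let G : BoundedContinuousFunction (EuclideanSpace ℝ S) ℝ :=
    BoundedContinuousFunction.ofNormedAddCommGroup (fun ξ => min ‖∑ s, ξ s • f s‖ R)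
      (by fun_prop) R fun ξ => by
        rw [Real.norm_eq_abs, abs_of_nonneg (le_min (norm_nonneg _) hR0.le)]
        exact min_le_right _ _
  have hG : ∀ ξ, G ξ = min ‖∑ s, ξ s • f s‖ R := fun ξ => rfl
  filter_upwards [cubeAvg_rotSum_compare O hO G (half_pos hδ), Filter.eventually_gt_atTop 0]
    with L hL hL0
  simp only [hG] at hL
  have h1 := blockSum_lower hC hcot L hL0 f
  rw [hf, Real.sqrt_one] at h1
  have h2 : cubeAvg (fun a : S × Fin L → Bool => min ‖∑ s, rotSum O L s a • f s‖ R)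
      ≤ cubeAvg (fun a : S × Fin L → Bool => ‖∑ s, rotSum O L s a • f s‖) :=
    cubeAvg_mono fun a => min_le_left _ _
  have h3 : cubeAvg (fun a : S × Fin L → Bool => ‖∑ s, blockSum L s a • f s‖ -
      R⁻¹ * ∑ s, blockSum L s a ^ 2)
      ≤ cubeAvg (fun a : S × Fin L → Bool => min ‖∑ s, blockSum L s a • f s‖ R) :=
    cubeAvg_mono fun a => by
      have h4 : ‖∑ s, blockSum L s a • f s‖ ^ 2 ≤ ∑ s, blockSum L s a ^ 2 := by
        have h5 : ‖∑ s, blockSum L s a • f s‖ ≤ ∑ s, |blockSum L s a| * ‖f s‖ :=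
          norm_sum_le_of_le _ fun s _ => by rw [norm_smul, Real.norm_eq_abs]
        have h6 := Finset.sum_mul_sq_le_sq_mul_sq Finset.univ (fun s => |blockSum L s a|)
          fun s => ‖f s‖
        simp only [sq_abs, hf, mul_one] at h6
        exact (pow_le_pow_left₀ (norm_nonneg _) h5 2).trans h6
      set N := ‖∑ s, blockSum L s a • f s‖
      set Q := ∑ s, blockSum L s a ^ 2
      have hQ : 0 ≤ Q := (sq_nonneg _).trans h4
      refine le_min (by have := mul_nonneg (inv_nonneg.2 hR0.le) hQ; linarith) ?_
      have : N - R⁻¹ * Q ≤ N - R⁻¹ * N ^ 2 := by gcongr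
      refine this.trans ?_
      have h7 : N - R⁻¹ * N ^ 2 = R - R⁻¹ * ((N - R / 2) ^ 2 + 3 / 4 * R ^ 2) := by
        field_simp; ring
      rw [h7]
      have : 0 ≤ R⁻¹ * ((N - R / 2) ^ 2 + 3 / 4 * R ^ 2) := by positivity
      linarith
  rw [cubeAvg_sub, cubeAvg_const_mul, cubeAvg_sum] at h3
  have h5 : ∀ s, cubeAvg (fun a : S × Fin L → Bool => blockSum L s a ^ 2) = 1 := fun s => by
    simp only [sq, cubeAvg_blockSum_mul L hL0, if_true]
  simp only [h5, Finset.sum_const, Finset.card_univ, nsmul_eq_mul, mul_one] at h3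
  have h6 : (√2 * C)⁻¹ ≤ cubeAvg (fun a : S × Fin L → Bool => ‖∑ s, blockSum L s a • f s‖) := by
    have hpos : 0 < √2 * C := by
      rcases (mul_nonneg (Real.sqrt_nonneg 2) hC).eq_or_lt with h | h
      · rw [← h, zero_mul] at h1; linarith
      · exact h
    rw [inv_le_iff_one_le_mul₀ hpos, mul_comm]
    exact h1
  have h7 : R⁻¹ * c = c / R := by rw [div_eq_inv_mul]
  rw [h7] at h3
  linarith

/-- After sufficiently many repetitions, rotated Rademacher systems satisfy the cotype 2 lower
estimate up to a universal factor. -/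
lemma exists_rotSum_lower [FiniteDimensional ℂ V] {C : ℝ} (hC : 0 ≤ C)
    (hcot : Cotype2With (fun v : V => ‖v‖) C)
    (O : Matrix S S ℝ) (hO : O ∈ Matrix.orthogonalGroup S ℝ) :
    ∃ L : ℕ, 0 < L ∧ ∀ f : S → V, √(∑ s, ‖f s‖ ^ 2) ≤ 3 / √2 * C *
      cubeAvg (fun a : S × Fin L → Bool => ‖∑ s, rotSum O L s a • f s‖) := by
  have : ProperSpace V := FiniteDimensional.proper ℂ V
  have h2 : 0 < √2 := by positivity
  rcases hC.eq_or_lt with rfl | hC0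
  · refine ⟨1, one_pos, fun f => ?_⟩
    have := blockSum_lower hC hcot 1 one_pos f
    simp only [mul_zero, zero_mul] at this ⊢
    exact this
  set δ : ℝ := ((√2 * C)⁻¹ - (3 / √2 * C)⁻¹) / 2 with hδdef
  have hδ : 0 < δ := by
    have : (3 / √2 * C)⁻¹ < (√2 * C)⁻¹ := by
      apply inv_strictAnti₀ (by positivity)
      apply mul_lt_mul_of_pos_right _ hC0
      rw [lt_div_iff₀ h2, Real.mul_self_sqrt (by norm_num)]; norm_num
    rw [hδdef]; linarith
  set B : Set (S → V) := {f | ∑ s, ‖f s‖ ^ 2 = 1} with hB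
  have hBc : IsCompact B := by
    refine Metric.isCompact_of_isClosed_isBounded
      (isClosed_eq (by fun_prop) continuous_const) ?_
    refine (Metric.isBounded_closedBall (x := (0 : S → V)) (r := 1)).subset fun f hf => ?_
    rw [mem_closedBall_zero_iff, pi_norm_le_iff_of_nonneg zero_le_one]
    intro s
    have : ‖f s‖ ^ 2 ≤ 1 := by
      rw [← show ∑ s, ‖f s‖ ^ 2 = 1 from hf]
      exact Finset.single_le_sum (f := fun s => ‖f s‖ ^ 2) (fun _ _ => sq_nonneg _)
        (Finset.mem_univ s)
    exact (sq_le_one_iff₀ (norm_nonneg _)).1 this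
  set r : ℝ := δ / (Fintype.card S + 1) with hr
  have hr0 : 0 < r := by positivity
  obtain ⟨t, htB, htc⟩ := hBc.elim_nhds_subcover (fun f => Metric.ball f r)
    fun f _ => Metric.ball_mem_nhds f hr0
  have hev : ∀ᶠ L in Filter.atTop, ∀ f ∈ t, (√2 * C)⁻¹ - δ <
      cubeAvg (fun a : S × Fin L → Bool => ‖∑ s, rotSum O L s a • f s‖) :=
    (Filter.eventually_all_finset t).2 fun f hf => exists_rotSum_lower_at hC hcot O hO f (htB f hf) hδ
  obtain ⟨L, hLt, hL0⟩ := (hev.and (Filter.eventually_gt_atTop 0)).exists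
  have key : ∀ f ∈ B, 1 ≤ 3 / √2 * C *
      cubeAvg (fun a : S × Fin L → Bool => ‖∑ s, rotSum O L s a • f s‖) := fun f hf => by
    obtain ⟨g, hg, hfg⟩ := Set.mem_iUnion₂.1 (htc hf)
    have h3 := hLt g hg
    have h4 := cubeAvg_norm_rotSum_sub_le O hO L hL0 g f
    have h5 : (Fintype.card S : ℝ) * ‖g - f‖ ≤ δ := by
      rw [Metric.mem_ball, dist_comm, dist_eq_norm] at hfg
      calc (Fintype.card S : ℝ) * ‖g - f‖ ≤ (Fintype.card S + 1) * r := by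
            gcongr; linarith
        _ = δ := by rw [hr]; field_simp
    rw [← inv_le_iff_one_le_mul₀' (by positivity)]
    rw [hδdef] at h3 h5
    linarith
  refine ⟨L, hL0, fun f => ?_⟩
  set q := √(∑ s, ‖f s‖ ^ 2) with hq
  have hq0 : 0 ≤ ∑ s, ‖f s‖ ^ 2 := Finset.sum_nonneg fun _ _ => sq_nonneg _
  rcases (Real.sqrt_nonneg (∑ s, ‖f s‖ ^ 2)).eq_or_lt with h | h
  · rw [hq, ← h]
    exact mul_nonneg (by positivity) (mul_nonneg (by positivity)
      (Finset.sum_nonneg fun _ _ => norm_nonneg _))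
  · have hfB : (fun s => q⁻¹ • f s) ∈ B := by
      change ∑ s, ‖q⁻¹ • f s‖ ^ 2 = 1
      simp only [norm_smul, mul_pow, Real.norm_eq_abs, sq_abs, ← Finset.mul_sum]
      rw [inv_pow, hq, Real.sq_sqrt hq0]
      exact inv_mul_cancel₀ (Real.sqrt_pos.1 h).ne'
    have h3 := key _ hfB
    have h4 : ∀ a : S × Fin L → Bool, ‖∑ s, rotSum O L s a • (q⁻¹ • f s)‖
        = q⁻¹ * ‖∑ s, rotSum O L s a • f s‖ := fun a => by
      simp only [smul_comm _ q⁻¹]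
      rw [← Finset.smul_sum, norm_smul, Real.norm_eq_abs, abs_of_pos (inv_pos.2 h)]
    simp only [h4, cubeAvg_const_mul] at h3
    have h5 := mul_le_mul_of_nonneg_left h3 h.le
    rw [mul_one] at h5
    refine h5.trans (le_of_eq ?_)
    rw [← hq]
    have : q ≠ 0 := h.ne'
    field_simp

end LowerEstimate

section WalshMatrix

variable {I : Type*} [Fintype I] [DecidableEq I]

/-- The matrix diagonalised by the Walsh functions, with prescribed eigenvalues. -/
def walshMat (β : Finset I → ℝ) : Matrix (I → Bool) (I → Bool) ℝ :=
  Matrix.of fun a b => ((2 : ℝ) ^ Fintype.card I)⁻¹ * ∑ A, β A * (walsh A a * walsh A b)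

lemma walshMat_mul (β γ : Finset I → ℝ) : walshMat β * walshMat γ = walshMat (β * γ) := by
  ext a b
  simp only [walshMat, Matrix.mul_apply, Matrix.of_apply, Pi.mul_apply]
  have h : ∀ c : I → Bool, (((2 : ℝ) ^ Fintype.card I)⁻¹ * ∑ A, β A * (walsh A a * walsh A c)) *
      (((2 : ℝ) ^ Fintype.card I)⁻¹ * ∑ A, γ A * (walsh A c * walsh A b)) =
      ∑ A, ∑ B, (((2 : ℝ) ^ Fintype.card I)⁻¹ ^ 2 * β A * γ B * walsh A a * walsh B b) *
        (walsh A c * walsh B c) := fun c => by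
    rw [mul_mul_mul_comm, Finset.sum_mul_sum, Finset.mul_sum]
    refine Finset.sum_congr rfl fun A _ => ?_
    rw [Finset.mul_sum]
    exact Finset.sum_congr rfl fun B _ => by ring
  simp only [h]
  rw [Finset.sum_comm, Finset.mul_sum]
  refine Finset.sum_congr rfl fun A _ => ?_
  rw [Finset.sum_comm]
  simp only [← Finset.mul_sum, sum_cube_walsh_mul_walsh, mul_ite, mul_zero, Finset.sum_ite_eq,
    Finset.mem_univ, if_true]
  field_simp

lemma walshMat_one : walshMat (1 : Finset I → ℝ) = 1 := by
  ext a b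
  simp only [walshMat, Matrix.of_apply, Pi.one_apply, one_mul, sum_walsh_mul_walsh,
    Matrix.one_apply]
  split_ifs <;> simp

lemma walshMat_add (β γ : Finset I → ℝ) : walshMat β + walshMat γ = walshMat (β + γ) := by
  ext a b
  simp [walshMat, add_mul, Finset.sum_add_distrib, mul_add]

lemma walshMat_transpose (β : Finset I → ℝ) : (walshMat β).transpose = walshMat β := by
  ext a b
  simp [walshMat, mul_comm]

lemma fromBlocks_walshMat_mem (β : Finset I → ℝ) (hβ : ∀ A, |β A| ≤ 1) :
    Matrix.fromBlocks (walshMat β) (walshMat fun A => √(1 - β A ^ 2))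
      (-walshMat fun A => √(1 - β A ^ 2)) (walshMat β) ∈
      Matrix.orthogonalGroup ((I → Bool) ⊕ (I → Bool)) ℝ := by
  rw [Matrix.mem_orthogonalGroup_iff, Matrix.fromBlocks_transpose, Matrix.fromBlocks_multiply]
  simp only [Matrix.transpose_neg, walshMat_transpose, walshMat_mul, Matrix.mul_neg, Matrix.neg_mul,
    neg_neg, walshMat_add]
  have h1 : β * β + ((fun A => √(1 - β A ^ 2)) * fun A => √(1 - β A ^ 2)) = 1 := by
    funext A
    have : 0 ≤ 1 - β A ^ 2 := by
      have := (sq_le_one_iff_abs_le_one _).2 (hβ A); linarith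
    simp only [Pi.add_apply, Pi.mul_apply, Pi.one_apply, Real.mul_self_sqrt this]
    ring
  rw [h1, add_comm _ (β * β), h1, walshMat_one, mul_comm β, neg_add_cancel, Matrix.fromBlocks_one]

/-- The kernel `∑ ρ^{|A|-1} w_A ⊗ w_A` over odd sets `A`. -/
def oddKer (ρ : ℝ) (a b : I → Bool) : ℝ :=
  (2 * ρ)⁻¹ * (∑ A : Finset I, ρ ^ #A * (walsh A a * walsh A b)
    - ∑ A : Finset I, (-ρ) ^ #A * (walsh A a * walsh A b))

/-- The Walsh multiplier of the error term. -/
def tailCoef (ρ : ℝ) (A : Finset I) : ℝ := if Odd #A ∧ 3 ≤ #A then ρ ^ (#A - 3) else 0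

lemma abs_tailCoef_le {ρ : ℝ} (h0 : 0 ≤ ρ) (h1 : ρ ≤ 1) (A : Finset I) : |tailCoef ρ A| ≤ 1 := by
  rw [tailCoef]
  split_ifs
  · rw [abs_of_nonneg (by positivity)]; exact pow_le_one₀ h0 h1
  · simp

lemma oddKer_eq {ρ : ℝ} (h0 : 0 < ρ) (a b : I → Bool) :
    oddKer ρ a b = ∑ i, sgn (a i) * sgn (b i) +
      ρ ^ 2 * ∑ A, tailCoef ρ A * (walsh A a * walsh A b) := by
  have h1 : ∑ i, sgn (a i) * sgn (b i) = ∑ A : Finset I,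
      (if #A = 1 then 1 else 0) * (walsh A a * walsh A b) := by
    simp only [ite_mul, one_mul, zero_mul]
    rw [← Finset.sum_filter]
    have : (Finset.univ.filter fun A : Finset I => #A = 1) = Finset.univ.map
        ⟨fun i : I => ({i} : Finset I), Finset.singleton_injective⟩ := by
      ext A
      simp [Finset.card_eq_one, eq_comm]
    rw [this, Finset.sum_map]
    simp [walsh_singleton]
  rw [h1, Finset.mul_sum, ← Finset.sum_add_distrib, oddKer, ← Finset.sum_sub_distrib,
    Finset.mul_sum]
  refine Finset.sum_congr rfl fun A _ => ?_
  suffices (2 * ρ)⁻¹ * (ρ ^ #A - (-ρ) ^ #A) =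
      (if #A = 1 then 1 else 0) + ρ ^ 2 * tailCoef ρ A by
    linear_combination (walsh A a * walsh A b) * this
  rw [tailCoef]
  rcases Nat.even_or_odd #A with he | ho
  · have hne : #A ≠ 1 := by rintro h; rw [h] at he; exact absurd he (by decide)
    have hno : ¬ Odd #A := Nat.not_odd_iff_even.2 he
    simp [he.neg_pow, hne, hno]
  · rw [ho.neg_pow]
    by_cases h : #A = 1
    · simp [h]; field_simp; norm_num
    · have h3 : 3 ≤ #A := by obtain ⟨r, hr⟩ := ho; omega
      obtain ⟨c, hc⟩ := Nat.exists_eq_add_of_le h3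
      rw [if_neg h, if_pos ⟨ho, h3⟩, hc, Nat.add_sub_cancel_left]
      field_simp
      ring

lemma sum_abs_oddKer_le {ρ : ℝ} (h0 : 0 < ρ) (h1 : ρ ≤ 1) :
    (((2 : ℝ) ^ Fintype.card I)⁻¹) ^ 2 * ∑ a : I → Bool, ∑ b : I → Bool, |oddKer ρ a b| ≤ 1 / ρ := by
  have hprod : ∀ r : ℝ, |r| ≤ 1 → ∀ a b : I → Bool,
      0 ≤ ∑ A : Finset I, r ^ #A * (walsh A a * walsh A b) := fun r hr a b => by
    rw [sum_pow_mul_walsh]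
    refine Finset.prod_nonneg fun i _ => ?_
    have : |r * (sgn (a i) * sgn (b i))| ≤ 1 := by
      rw [abs_mul, abs_mul, abs_sgn, abs_sgn]; simpa using hr
    have := neg_le_of_abs_le this
    linarith
  have hsum : ∀ r : ℝ, (((2 : ℝ) ^ Fintype.card I)⁻¹) ^ 2 * ∑ a : I → Bool, ∑ b : I → Bool,
      ∑ A : Finset I, r ^ #A * (walsh A a * walsh A b) = 1 := fun r => by
    have h2 : ∑ a : I → Bool, ∑ b : I → Bool, ∑ A : Finset I, r ^ #A * (walsh A a * walsh A b)
        = ∑ A : Finset I, r ^ #A * ((∑ a, walsh A a) * ∑ b, walsh A b) := by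
      rw [Finset.sum_congr rfl fun a _ => Finset.sum_comm, Finset.sum_comm]
      refine Finset.sum_congr rfl fun A _ => ?_
      simp only [← Finset.mul_sum, ← Finset.sum_mul]
    have h3 : ∀ A : Finset I, ∑ a, walsh A a = if A = ∅ then (2 : ℝ) ^ Fintype.card I else 0 :=
      fun A => by
        rw [← sum_cube_walsh_mul_walsh]
        simp [walsh_empty]
    rw [h2]
    simp only [h3]
    simp
    field_simp
  have habs : |ρ| ≤ 1 := by rwa [abs_of_pos h0]
  have hle : ∀ a b : I → Bool, |oddKer ρ a b| ≤ (2 * ρ)⁻¹ *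
      (∑ A : Finset I, ρ ^ #A * (walsh A a * walsh A b)
        + ∑ A : Finset I, (-ρ) ^ #A * (walsh A a * walsh A b)) := fun a b => by
    rw [oddKer, abs_mul, abs_of_pos (by positivity : 0 < (2 * ρ)⁻¹)]
    refine mul_le_mul_of_nonneg_left ?_ (by positivity)
    refine (abs_sub _ _).trans (le_of_eq ?_)
    rw [abs_of_nonneg (hprod ρ habs a b), abs_of_nonneg (hprod (-ρ) (by rwa [abs_neg]) a b)]
  calc _ ≤ (((2 : ℝ) ^ Fintype.card I)⁻¹) ^ 2 * ∑ a : I → Bool, ∑ b : I → Bool, (2 * ρ)⁻¹ *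
      (∑ A : Finset I, ρ ^ #A * (walsh A a * walsh A b)
        + ∑ A : Finset I, (-ρ) ^ #A * (walsh A a * walsh A b)) := by
        gcongr with a _ b _; exact hle a b
    _ = (2 * ρ)⁻¹ * (1 + 1) := by
        nth_rw 1 [← hsum ρ]
        rw [← hsum (-ρ)]
        simp only [← Finset.mul_sum, Finset.sum_add_distrib]
        ring
    _ = 1 / ρ := by field_simp; norm_num

end WalshMatrix

section Bootstrap

variable {V W : Type*} [NormedAddCommGroup V] [NormedSpace ℂ V]
  [NormedAddCommGroup W] [NormedSpace ℂ W] {ι κ : Type*}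

/-- `T` satisfies a square-function bound with constant `c`, stable under rotations. -/
def OrthBound (T : (ι → StrongDual ℂ V) →ₗ[ℂ] (κ → StrongDual ℂ W) →ₗ[ℂ] ℂ)
    (σ : ι → ℝ) (τ : κ → ℝ) (c : ℝ) : Prop :=
  ∀ (S : Type) [Fintype S] [DecidableEq S] (O : Matrix S S ℝ),
    O ∈ Matrix.orthogonalGroup S ℝ →
    ∀ (x : S → ι → StrongDual ℂ V) (y : S → κ → StrongDual ℂ W),
      (∀ i, ∑ s, ‖x s i‖ ^ 2 ≤ σ i ^ 2) → (∀ j, ∑ r, ‖y r j‖ ^ 2 ≤ τ j ^ 2) →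
      ‖∑ s, ∑ r, (O s r : ℂ) * T (x s) (y r)‖ ≤ c

variable {T : (ι → StrongDual ℂ V) →ₗ[ℂ] (κ → StrongDual ℂ W) →ₗ[ℂ] ℂ}
  {σ : ι → ℝ} {τ : κ → ℝ}

lemma OrthBound.scaled {c : ℝ} (h : OrthBound T σ τ c) {a b : ℝ} (ha : 0 < a) (hb : 0 < b)
    {S : Type} [Fintype S] [DecidableEq S] (O : Matrix S S ℝ)
    (hO : O ∈ Matrix.orthogonalGroup S ℝ)
    (x : S → ι → StrongDual ℂ V) (y : S → κ → StrongDual ℂ W)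
    (hx : ∀ i, ∑ s, ‖x s i‖ ^ 2 ≤ (a * σ i) ^ 2) (hy : ∀ j, ∑ r, ‖y r j‖ ^ 2 ≤ (b * τ j) ^ 2) :
    ‖∑ s, ∑ r, (O s r : ℂ) * T (x s) (y r)‖ ≤ a * b * c := by
  have ha' : ‖(a⁻¹ : ℂ)‖ = a⁻¹ := by rw [norm_inv, Complex.norm_of_nonneg ha.le]
  have hb' : ‖(b⁻¹ : ℂ)‖ = b⁻¹ := by rw [norm_inv, Complex.norm_of_nonneg hb.le]
  have h1 := h S O hO (fun s => (a⁻¹ : ℂ) • x s) (fun r => (b⁻¹ : ℂ) • y r)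
    (fun i => by
      simp only [Pi.smul_apply, norm_smul, mul_pow, ← Finset.mul_sum, ha']
      rw [inv_pow, inv_mul_le_iff₀ (by positivity), ← mul_pow]
      exact hx i)
    (fun j => by
      simp only [Pi.smul_apply, norm_smul, mul_pow, ← Finset.mul_sum, hb']
      rw [inv_pow, inv_mul_le_iff₀ (by positivity), ← mul_pow]
      exact hy j)
  have h2 : ∑ s, ∑ r, (O s r : ℂ) * T ((a⁻¹ : ℂ) • x s) ((b⁻¹ : ℂ) • y r)
      = ((a⁻¹ : ℂ) * (b⁻¹ : ℂ)) * ∑ s, ∑ r, (O s r : ℂ) * T (x s) (y r) := by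
    simp only [map_smul, LinearMap.smul_apply, smul_eq_mul, Finset.mul_sum]
    exact Finset.sum_congr rfl fun s _ => Finset.sum_congr rfl fun r _ => by ring
  rw [h2, norm_mul, norm_mul, ha', hb', ← mul_inv, inv_mul_le_iff₀ (by positivity)] at h1
  exact h1

/-- Walsh multipliers of modulus at most one preserve the bound. -/
lemma OrthBound.walshMat {c : ℝ} (h : OrthBound T σ τ c) {a b : ℝ} (ha : 0 < a) (hb : 0 < b)
    {I : Type} [Fintype I] [DecidableEq I] (β : Finset I → ℝ) (hβ : ∀ A, |β A| ≤ 1)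
    (f : (I → Bool) → ι → StrongDual ℂ V) (g : (I → Bool) → κ → StrongDual ℂ W)
    (hf : ∀ i, ∑ ω, ‖f ω i‖ ^ 2 ≤ (a * σ i) ^ 2) (hg : ∀ j, ∑ ω, ‖g ω j‖ ^ 2 ≤ (b * τ j) ^ 2) :
    ‖∑ ω, ∑ ω', (walshMat β ω ω' : ℂ) * T (f ω) (g ω')‖ ≤ a * b * c := by
  have h1 := h.scaled ha hb _ (fromBlocks_walshMat_mem β hβ) (Sum.elim f 0) (Sum.elim g 0)
    (fun i => by simpa using hf i) (fun j => by simpa using hg j)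
  simpa using h1

lemma OrthBound.sum_cube {c : ℝ} (h : OrthBound T σ τ c)
    (hT : ∀ x y, (∀ i, ‖x i‖ ≤ σ i) → (∀ j, ‖y j‖ ≤ τ j) → ‖T x y‖ ≤ 1)
    {a b : ℝ} (ha : 0 < a) (hb : 0 < b) {ρ : ℝ} (h0 : 0 < ρ) (hρ : ρ ≤ 1)
    {I : Type} [Fintype I] [DecidableEq I]
    (f : (I → Bool) → ι → StrongDual ℂ V) (g : (I → Bool) → κ → StrongDual ℂ W)
    (hf : ∀ ω i, ‖f ω i‖ ≤ a * σ i) (hg : ∀ ω j, ‖g ω j‖ ≤ b * τ j) :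
    ‖∑ i, T (∑ ω, ((((2 : ℝ) ^ Fintype.card I)⁻¹ * sgn (ω i) : ℝ) : ℂ) • f ω)
      (∑ ω, ((((2 : ℝ) ^ Fintype.card I)⁻¹ * sgn (ω i) : ℝ) : ℂ) • g ω)‖
      ≤ a * b * (1 / ρ + ρ ^ 2 * c) := by
  set p : ℝ := ((2 : ℝ) ^ Fintype.card I)⁻¹ with hp
  have hp0 : 0 < p := by positivity
  have hTab : ∀ ω ω', ‖T (f ω) (g ω')‖ ≤ a * b := fun ω ω' => by
    have ha' : ‖(a⁻¹ : ℂ)‖ = a⁻¹ := by rw [norm_inv, Complex.norm_of_nonneg ha.le]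
    have hb' : ‖(b⁻¹ : ℂ)‖ = b⁻¹ := by rw [norm_inv, Complex.norm_of_nonneg hb.le]
    have h1 := hT ((a⁻¹ : ℂ) • f ω) ((b⁻¹ : ℂ) • g ω')
      (fun i => by
        rw [Pi.smul_apply, norm_smul, ha', inv_mul_le_iff₀ ha]; exact hf ω i)
      (fun j => by
        rw [Pi.smul_apply, norm_smul, hb', inv_mul_le_iff₀ hb]; exact hg ω' j)
    simp only [map_smul, LinearMap.smul_apply, smul_eq_mul, norm_mul, ha', hb'] at h1
    rw [← mul_assoc, ← mul_inv, inv_mul_le_iff₀ (by positivity), mul_one] at h1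
    exact h1.trans_eq (mul_comm _ _)
  have hexp : ∑ i, T (∑ ω, ((p * sgn (ω i) : ℝ) : ℂ) • f ω)
      (∑ ω, ((p * sgn (ω i) : ℝ) : ℂ) • g ω)
      = ∑ ω, ∑ ω', ((p ^ 2 * ∑ i, sgn (ω i) * sgn (ω' i) : ℝ) : ℂ) * T (f ω) (g ω') := by
    have hterm : ∀ i, T (∑ ω, ((p * sgn (ω i) : ℝ) : ℂ) • f ω)
        (∑ ω, ((p * sgn (ω i) : ℝ) : ℂ) • g ω)
        = ∑ ω, ∑ ω', ((p ^ 2 * (sgn (ω i) * sgn (ω' i)) : ℝ) : ℂ) * T (f ω) (g ω') := fun i => by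
      simp only [map_sum, map_smul, LinearMap.sum_apply, LinearMap.smul_apply, smul_eq_mul,
        Finset.mul_sum]
      rw [Finset.sum_comm]
      refine Finset.sum_congr rfl fun ω _ => Finset.sum_congr rfl fun ω' _ => ?_
      push_cast
      ring
    simp only [hterm]
    rw [Finset.sum_comm]
    refine Finset.sum_congr rfl fun ω _ => ?_
    rw [Finset.sum_comm]
    refine Finset.sum_congr rfl fun ω' _ => ?_
    rw [← Finset.sum_mul, ← Complex.ofReal_sum, ← Finset.mul_sum]
  have hsplit : ∑ ω, ∑ ω', ((p ^ 2 * ∑ i, sgn (ω i) * sgn (ω' i) : ℝ) : ℂ) * T (f ω) (g ω')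
      = ∑ ω, ∑ ω', ((p ^ 2 * oddKer ρ ω ω' : ℝ) : ℂ) * T (f ω) (g ω')
        - (ρ ^ 2 : ℝ) * ∑ ω, ∑ ω', (Paper.walshMat (tailCoef ρ) ω ω' : ℂ) *
          T ((√p : ℂ) • f ω) ((√p : ℂ) • g ω') := by
    rw [Finset.mul_sum, ← Finset.sum_sub_distrib]
    refine Finset.sum_congr rfl fun ω _ => ?_
    rw [Finset.mul_sum, ← Finset.sum_sub_distrib]
    refine Finset.sum_congr rfl fun ω' _ => ?_
    have hs : (√p : ℂ) * (√p : ℂ) = (p : ℂ) := by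
      rw [← Complex.ofReal_mul, Real.mul_self_sqrt hp0.le]
    simp only [map_smul, LinearMap.smul_apply, smul_eq_mul]
    rw [oddKer_eq h0, Paper.walshMat, Matrix.of_apply, ← hp]
    push_cast
    linear_combination ((ρ : ℂ) ^ 2 * p * (∑ A, (tailCoef ρ A : ℂ) *
      ((walsh A ω : ℂ) * (walsh A ω' : ℂ))) * T (f ω) (g ω')) * hs
  have hmain : ‖∑ ω, ∑ ω', ((p ^ 2 * oddKer ρ ω ω' : ℝ) : ℂ) * T (f ω) (g ω')‖
      ≤ a * b * (1 / ρ) := by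
    calc _ ≤ ∑ ω, ∑ ω', p ^ 2 * |oddKer ρ ω ω'| * (a * b) := by
          refine norm_sum_le_of_le _ fun ω _ => norm_sum_le_of_le _ fun ω' _ => ?_
          rw [norm_mul, Complex.norm_real, Real.norm_eq_abs, abs_mul, abs_of_nonneg (sq_nonneg p)]
          gcongr
          exact hTab ω ω'
      _ = a * b * (p ^ 2 * ∑ ω, ∑ ω', |oddKer ρ ω ω'|) := by
          simp only [← Finset.sum_mul, ← Finset.mul_sum]; ring
      _ ≤ _ := by gcongr; exact sum_abs_oddKer_le h0 hρ
  have hcard : ∑ _ω : I → Bool, p = 1 := by simp [hp]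
  have hnsq : ‖(√p : ℂ)‖ ^ 2 = p := by
    rw [Complex.norm_real, Real.norm_eq_abs, sq_abs, Real.sq_sqrt hp0.le]
  have htail := h.walshMat ha hb (tailCoef ρ) (abs_tailCoef_le h0.le hρ)
    (fun ω => (√p : ℂ) • f ω) (fun ω => (√p : ℂ) • g ω)
    (fun i => by
      calc ∑ ω, ‖((√p : ℂ) • f ω) i‖ ^ 2 ≤ ∑ _ω : I → Bool, p * (a * σ i) ^ 2 := by
            refine Finset.sum_le_sum fun ω _ => ?_
            rw [Pi.smul_apply, norm_smul, mul_pow, hnsq]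
            gcongr
            exact hf ω i
        _ = _ := by rw [← Finset.sum_mul, hcard, one_mul])
    (fun j => by
      calc ∑ ω, ‖((√p : ℂ) • g ω) j‖ ^ 2 ≤ ∑ _ω : I → Bool, p * (b * τ j) ^ 2 := by
            refine Finset.sum_le_sum fun ω _ => ?_
            rw [Pi.smul_apply, norm_smul, mul_pow, hnsq]
            gcongr
            exact hg ω j
        _ = _ := by rw [← Finset.sum_mul, hcard, one_mul])
  rw [hexp, hsplit]
  refine (norm_sub_le _ _).trans ?_
  rw [norm_mul, Complex.norm_real, Real.norm_of_nonneg (sq_nonneg ρ)]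
  have := mul_le_mul_of_nonneg_left htail (sq_nonneg ρ)
  linarith

lemma OrthBound.step [FiniteDimensional ℂ W] {c : ℝ} (h : OrthBound T σ τ c)
    (hT : ∀ x y, (∀ i, ‖x i‖ ≤ σ i) → (∀ j, ‖y j‖ ≤ τ j) → ‖T x y‖ ≤ 1)
    (hσ : ∀ i, 0 ≤ σ i) (hτ : ∀ j, 0 ≤ τ j)
    {C D : ℝ} (hC : 0 < C) (hD : 0 < D) (hV : Cotype2With (fun v : V => ‖v‖) C)
    (hW : Cotype2With (fun w : W => ‖w‖) D) {ρ : ℝ} (h0 : 0 < ρ) (hρ : ρ ≤ 1) :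
    OrthBound T σ τ (3 * C * D * (1 / ρ + ρ ^ 2 * c)) := by
  intro S _ _ O hO x y hx hy
  have h2 : 0 < √2 := by positivity
  obtain ⟨L, hL, hlow⟩ := exists_rotSum_lower hD.le hW O hO
  have hLp : (0 : ℝ) < L := by exact_mod_cast hL
  set p : ℝ := ((2 : ℝ) ^ Fintype.card (S × Fin L))⁻¹ with hp
  have hp0 : 0 < p := by positivity
  have hfex : ∀ i, ∃ f : (S × Fin L → Bool) → StrongDual ℂ V, (∀ ω, ‖f ω‖ ≤ √2 * C * σ i) ∧
      ∀ q : S × Fin L, ∑ ω, ((p * sgn (ω q) : ℝ) : ℂ) • f ω = ((√L)⁻¹ : ℂ) • x q.1 i := fun i => by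
    obtain ⟨f, hf1, hf2⟩ := exists_bounded_representation
      (fun (q : S × Fin L) (ω : S × Fin L → Bool) => ((p * sgn (ω q) : ℝ) : ℂ)) (√2 * C)
      (fun e => by
        refine (cotype_first_moment hC.le hV e).trans (le_of_eq ?_)
        rw [← hp, Finset.mul_sum]
        congr 1
        refine Finset.sum_congr rfl fun ω _ => ?_
        simp only [Complex.ofReal_mul, mul_smul, ← Finset.smul_sum]
        rw [norm_smul, Complex.norm_real, Real.norm_of_nonneg hp0.le]
        simp only [Complex.coe_smul]) (by positivity)
      (fun q => ((√L)⁻¹ : ℂ) • x q.1 i)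
    refine ⟨f, fun ω => (hf1 ω).trans ?_, hf2⟩
    refine mul_le_mul_of_nonneg_left ?_ (by positivity)
    rw [Real.sqrt_le_left (hσ i), Fintype.sum_prod_type]
    refine le_trans (le_of_eq ?_) (hx i)
    refine Finset.sum_congr rfl fun s _ => ?_
    simp only [norm_smul, mul_pow, norm_inv, Complex.norm_real, Real.norm_eq_abs, inv_pow, sq_abs,
      Real.sq_sqrt hLp.le, Finset.sum_const, Finset.card_univ, Fintype.card_fin, nsmul_eq_mul]
    field_simp
  have hgex : ∀ j, ∃ g : (S × Fin L → Bool) → StrongDual ℂ W,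
      (∀ ω, ‖g ω‖ ≤ 3 / √2 * D * τ j) ∧
      ∀ r : S, ∑ ω, ((p * rotSum O L r ω : ℝ) : ℂ) • g ω = y r j := fun j => by
    obtain ⟨g, hg1, hg2⟩ := exists_bounded_representation
      (fun (r : S) (ω : S × Fin L → Bool) => ((p * rotSum O L r ω : ℝ) : ℂ)) (3 / √2 * D)
      (fun e => by
        refine (hlow e).trans (le_of_eq ?_)
        rw [cubeAvg, ← hp, Finset.mul_sum]
        congr 1
        refine Finset.sum_congr rfl fun ω _ => ?_
        simp only [Complex.ofReal_mul, mul_smul, ← Finset.smul_sum]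
        rw [norm_smul, Complex.norm_real, Real.norm_of_nonneg hp0.le]
        simp only [Complex.coe_smul]) (by positivity)
      (fun r => y r j)
    refine ⟨g, fun ω => (hg1 ω).trans ?_, hg2⟩
    refine mul_le_mul_of_nonneg_left ?_ (by positivity)
    rw [Real.sqrt_le_left (hτ j)]
    exact hy j
  choose f hf1 hf2 using hfex
  choose g hg1 hg2 using hgex
  have key := h.sum_cube hT (a := √2 * C) (b := 3 / √2 * D) (by positivity) (by positivity) h0 hρ
    (fun ω i => f i ω) (fun ω j => g j ω) (fun ω i => hf1 i ω) (fun ω j => hg1 j ω)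
  have hab : √2 * C * (3 / √2 * D) = 3 * C * D := by field_simp
  rw [hab, ← hp] at key
  refine le_trans (le_of_eq ?_) key
  congr 1
  have hfx : ∀ q : S × Fin L, ∑ ω, ((p * sgn (ω q) : ℝ) : ℂ) • (fun i => f i ω)
      = ((√L)⁻¹ : ℂ) • x q.1 := fun q => by
    funext i
    simpa using hf2 i q
  have hgy : ∀ r : S, ∑ ω, ((p * rotSum O L r ω : ℝ) : ℂ) • (fun j => g j ω) = y r := fun r => by
    funext j
    simpa using hg2 j r
  have hOO : ∀ s s', ∑ r, O s r * O s' r = if s = s' then 1 else 0 := fun s s' => by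
    have := congrFun (congrFun ((Matrix.mem_orthogonalGroup_iff S ℝ).1 hO) s) s'
    simpa [Matrix.mul_apply, Matrix.one_apply] using this
  have hblock : ∀ (s : S) (ω : S × Fin L → Bool),
      ∑ r, O s r * rotSum O L r ω = blockSum L s ω := fun s ω => by
    simp only [rotSum, Finset.mul_sum]
    rw [Finset.sum_comm]
    simp only [← mul_assoc, ← Finset.sum_mul, hOO]
    simp
  have hsum : ∀ s, ∑ t, ((√L)⁻¹ : ℂ) • ∑ ω, ((p * sgn (ω (s, t)) : ℝ) : ℂ) • (fun j => g j ω)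
      = ∑ r, (O s r : ℂ) • y r := fun s => by
    simp only [← hgy, Finset.smul_sum, smul_smul]
    rw [Finset.sum_comm]
    conv_rhs => rw [Finset.sum_comm]
    refine Finset.sum_congr rfl fun ω _ => ?_
    rw [← Finset.sum_smul, ← Finset.sum_smul]
    congr 1
    have h3 := hblock s ω
    rw [blockSum] at h3
    have h4 : ∑ t, (√L)⁻¹ * (p * sgn (ω (s, t))) = ∑ r, O s r * (p * rotSum O L r ω) := by
      calc ∑ t, (√L)⁻¹ * (p * sgn (ω (s, t))) = p * ((√L)⁻¹ * ∑ t, sgn (ω (s, t))) := by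
            simp only [Finset.mul_sum]; exact Finset.sum_congr rfl fun t _ => by ring
        _ = _ := by
            rw [← h3, Finset.mul_sum]; exact Finset.sum_congr rfl fun t _ => by ring
    exact_mod_cast congrArg (fun u : ℝ => (u : ℂ)) h4
  simp only [hfx]
  rw [Fintype.sum_prod_type]
  refine Finset.sum_congr rfl fun s _ => ?_
  have h5 := congrArg (T (x s)) (hsum s)
  simp only [map_sum, map_smul, smul_eq_mul] at h5
  rw [← h5]
  simp only [map_smul, LinearMap.smul_apply, smul_eq_mul, map_sum]
  refine Finset.sum_congr rfl fun t _ => ?_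
  rw [Finset.mul_sum]
  exact Finset.sum_congr rfl fun ω _ => by ring

/-- Bootstrapping: a bilinear form bounded by one on products of boxes of functionals has a
square-function bound depending only on the cotype 2 constants. -/
lemma OrthBound.bootstrap [FiniteDimensional ℂ W] {c : ℝ} (h : OrthBound T σ τ c)
    (hT : ∀ x y, (∀ i, ‖x i‖ ≤ σ i) → (∀ j, ‖y j‖ ≤ τ j) → ‖T x y‖ ≤ 1)
    (hσ : ∀ i, 0 ≤ σ i) (hτ : ∀ j, 0 ≤ τ j)
    {C D : ℝ} (hC : 1 ≤ C) (hD : 1 ≤ D) (hV : Cotype2With (fun v : V => ‖v‖) C)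
    (hW : Cotype2With (fun w : W => ‖w‖) D) :
    OrthBound T σ τ (6 * C * D * √(6 * C * D)) := by
  have hC0 : 0 < C := by linarith
  have hD0 : 0 < D := by linarith
  set A : Set ℝ := {c | 0 ≤ c ∧ OrthBound T σ τ c} with hA
  have hne : A.Nonempty := ⟨max c 0, le_max_right _ _, fun S _ _ O hO x y hx hy =>
    (h S O hO x y hx hy).trans (le_max_left _ _)⟩
  have hbdd : BddBelow A := ⟨0, fun _ hc => hc.1⟩
  have hK : OrthBound T σ τ (sInf A) := fun S _ _ O hO x y hx hy =>
    le_csInf hne fun c hc => hc.2 S O hO x y hx hy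
  have hK0 : 0 ≤ sInf A := le_csInf hne fun c hc => hc.1
  set q := 6 * C * D with hq
  have hq1 : 1 ≤ q := by nlinarith
  have hs1 : 1 ≤ √q := Real.one_le_sqrt.2 hq1
  have hs0 : 0 < √q := by linarith
  have hstep := hK.step hT hσ hτ hC0 hD0 hV hW (ρ := (√q)⁻¹) (by positivity)
    (inv_le_one_of_one_le₀ hs1)
  have h1 : sInf A ≤ 3 * C * D * (1 / (√q)⁻¹ + (√q)⁻¹ ^ 2 * sInf A) :=
    csInf_le hbdd ⟨by positivity, hstep⟩
  have h2 : (√q)⁻¹ ^ 2 = q⁻¹ := by rw [inv_pow, Real.sq_sqrt (by linarith)]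
  have h3 : 3 * C * D = q / 2 := by rw [hq]; ring
  rw [h2, h3, one_div, inv_inv] at h1
  have h4 : q / 2 * (√q + q⁻¹ * sInf A) = q * √q / 2 + sInf A / 2 := by
    have : q ≠ 0 := by linarith
    field_simp
  rw [h4] at h1
  intro S _ _ O hO x y hx hy
  exact (hK S O hO x y hx hy).trans (by linarith)

/-- Orthogonal matrices give bounded bilinear forms on `ℓ₂`. -/
lemma norm_sum_orthogonal_mul_le {S : Type*} [Fintype S] [DecidableEq S] (O : Matrix S S ℝ)
    (hO : O ∈ Matrix.orthogonalGroup S ℝ) (a b : S → ℂ) :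
    ‖∑ s, ∑ r, (O s r : ℂ) * (a s * b r)‖ ≤ (∑ s, ‖a s‖ ^ 2) + ∑ r, ‖b r‖ ^ 2 := by
  have hOO : ∀ s s', ∑ r, O s r * O s' r = if s = s' then 1 else 0 := fun s s' => by
    have := congrFun (congrFun ((Matrix.mem_orthogonalGroup_iff S ℝ).1 hO) s) s'
    simpa [Matrix.mul_apply, Matrix.one_apply] using this
  have hiso : ∑ r, ‖∑ s, (O s r : ℂ) * a s‖ ^ 2 = ∑ s, ‖a s‖ ^ 2 := by
    have h1 : ((∑ r, ‖∑ s, (O s r : ℂ) * a s‖ ^ 2 : ℝ) : ℂ) = ((∑ s, ‖a s‖ ^ 2 : ℝ) : ℂ) := by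
      push_cast
      simp only [← Complex.mul_conj', map_sum, map_mul, Complex.conj_ofReal, Finset.sum_mul_sum]
      rw [Finset.sum_comm]
      refine Finset.sum_congr rfl fun s _ => ?_
      rw [Finset.sum_comm]
      have h2 : ∀ s', ∑ r, (O s r : ℂ) * a s * ((O s' r : ℂ) * (starRingEnd ℂ) (a s'))
          = (if s = s' then 1 else 0) * (a s * (starRingEnd ℂ) (a s')) := fun s' => by
        have h3 : ((∑ r, O s r * O s' r : ℝ) : ℂ) = if s = s' then 1 else 0 := by
          rw [hOO]; split_ifs <;> simp
        rw [← h3]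
        push_cast
        rw [Finset.sum_mul]
        exact Finset.sum_congr rfl fun r _ => by ring
      simp [h2]
    exact_mod_cast h1
  have h4 : ∑ s, ∑ r, (O s r : ℂ) * (a s * b r) = ∑ r, (∑ s, (O s r : ℂ) * a s) * b r := by
    rw [Finset.sum_comm]
    refine Finset.sum_congr rfl fun r _ => ?_
    rw [Finset.sum_mul]
    exact Finset.sum_congr rfl fun s _ => by ring
  rw [h4, ← hiso, ← Finset.sum_add_distrib]
  refine norm_sum_le_of_le _ fun r _ => ?_
  rw [norm_mul]
  nlinarith [sq_nonneg (‖∑ s, (O s r : ℂ) * a s‖ - ‖b r‖), norm_nonneg (b r),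
    norm_nonneg (∑ s, (O s r : ℂ) * a s)]

lemma sum_sq_norm_le_of_norm_le {E S : Type*} [NormedAddCommGroup E] [Fintype S] [Fintype ι]
    (α : (ι → E) → ℂ) (v σ : ι → ℝ) (hα : ∀ x, ‖α x‖ ≤ ∑ i, v i * ‖x i‖)
    (x : S → ι → E) (hx : ∀ i, ∑ s, ‖x s i‖ ^ 2 ≤ σ i ^ 2) :
    ∑ s, ‖α (x s)‖ ^ 2 ≤ Fintype.card ι * ∑ i, v i ^ 2 * σ i ^ 2 := by
  calc ∑ s, ‖α (x s)‖ ^ 2 ≤ ∑ s, Fintype.card ι * ∑ i, v i ^ 2 * ‖x s i‖ ^ 2 := by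
        refine Finset.sum_le_sum fun s _ => ?_
        have h1 : ‖α (x s)‖ ^ 2 ≤ (∑ i, v i * ‖x s i‖) ^ 2 := by gcongr; exact hα _
        refine h1.trans ?_
        simpa [mul_pow] using sq_sum_le_card_mul_sum_sq (s := Finset.univ)
          (f := fun i => v i * ‖x s i‖)
    _ = Fintype.card ι * ∑ i, v i ^ 2 * ∑ s, ‖x s i‖ ^ 2 := by
        rw [← Finset.mul_sum, Finset.sum_comm]
        simp only [Finset.mul_sum]
    _ ≤ _ := by gcongr with i; exact hx i

/-- A finite sum of products of linear forms has some square-function bound. -/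
lemma exists_orthBound {A : Type*} [Fintype A] [Fintype ι] [Fintype κ]
    (α : A → (ι → StrongDual ℂ V) → ℂ) (β : A → (κ → StrongDual ℂ W) → ℂ)
    (v : A → ι → ℝ) (w : A → κ → ℝ)
    (hα : ∀ a x, ‖α a x‖ ≤ ∑ i, v a i * ‖x i‖) (hβ : ∀ a y, ‖β a y‖ ≤ ∑ j, w a j * ‖y j‖)
    (hT : ∀ x y, T x y = ∑ a, α a x * β a y) :
    ∃ c, OrthBound T σ τ c := by
  refine ⟨∑ a, (Fintype.card ι * ∑ i, v a i ^ 2 * σ i ^ 2 +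
    Fintype.card κ * ∑ j, w a j ^ 2 * τ j ^ 2), fun S _ _ O hO x y hx hy => ?_⟩
  have h1 : ∑ s, ∑ r, (O s r : ℂ) * T (x s) (y r)
      = ∑ a, ∑ s, ∑ r, (O s r : ℂ) * (α a (x s) * β a (y r)) := by
    simp only [hT, Finset.mul_sum]
    conv_rhs => rw [Finset.sum_comm]
    refine Finset.sum_congr rfl fun s _ => ?_
    conv_rhs => rw [Finset.sum_comm]
  rw [h1]
  refine norm_sum_le_of_le _ fun a _ => (norm_sum_orthogonal_mul_le O hO _ _).trans ?_
  exact add_le_add (sum_sq_norm_le_of_norm_le _ _ _ (hα a) x hx)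
    (sum_sq_norm_le_of_norm_le _ _ _ (hβ a) y hy)

end Bootstrap

section MinMax

open scoped Pointwise in
/-- A minimax lemma of Ky Fan type: if every finite nonnegative combination of a family of concave
continuous functions on a compact set is nonnegative somewhere, then the whole family is
nonnegative at a common point. -/
lemma exists_forall_nonneg_of_concave {E I : Type*} [AddCommGroup E] [Module ℝ E]
    [TopologicalSpace E] {W : Set E} (hW : IsCompact W) (Φ : I → E → ℝ)
    (hcont : ∀ i, Continuous (Φ i)) (hconc : ∀ i, ConcaveOn ℝ W (Φ i))
    (H : ∀ (N : ℕ) (f : Fin N → I) (c : Fin N → ℝ), (∀ a, 0 ≤ c a) →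
      ∃ w ∈ W, 0 ≤ ∑ a, c a * Φ (f a) w) :
    ∃ w ∈ W, ∀ i, 0 ≤ Φ i w := by
  obtain ⟨w, hw, hw'⟩ := hW.inter_iInter_nonempty (fun i => {w | 0 ≤ Φ i w})
    (fun i => isClosed_le continuous_const (hcont i)) (fun u => by
      by_contra hne
      obtain ⟨w₀, hw₀, -⟩ := H 0 Fin.elim0 Fin.elim0 fun a => a.elim0
      set F : E → (u → ℝ) := fun w i => Φ i w with hF
      have hFc : Continuous F := continuous_pi fun i => hcont i
      set A : Set (u → ℝ) := {v | ∃ w ∈ W, v ≤ F w} with hA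
      have hAeq : A = F '' W + Set.Iic (0 : u → ℝ) := by
        ext v
        constructor
        · rintro ⟨w, hw, hv⟩
          exact ⟨F w, ⟨w, hw, rfl⟩, v - F w, by simpa using hv, by simp⟩
        · rintro ⟨_, ⟨w, hw, rfl⟩, r, hr, rfl⟩
          exact ⟨w, hw, by simpa using hr⟩
      have hAcl : IsClosed A := by
        rw [hAeq]
        exact isClosed_Iic.add_left_of_isCompact (hW.image hFc)
      have hAcv : Convex ℝ A := by
        rintro v ⟨w, hw, hv⟩ v' ⟨w', hw', hv'⟩ a b ha hb hab
        have hi₀ : u.Nonempty := by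
          rw [Finset.nonempty_iff_ne_empty]
          rintro rfl
          exact hne ⟨w₀, hw₀, by simp⟩
        obtain ⟨i₀, -⟩ := hi₀
        refine ⟨a • w + b • w', (hconc i₀).1 hw hw' ha hb hab, fun i => ?_⟩
        refine le_trans ?_ ((hconc i).2 hw hw' ha hb hab)
        exact add_le_add (mul_le_mul_of_nonneg_left (hv i) ha)
          (mul_le_mul_of_nonneg_left (hv' i) hb)
      have h0 : (0 : u → ℝ) ∉ A := by
        rintro ⟨w, hw, hv⟩
        exact hne ⟨w, hw, by simpa using fun i hi => hv ⟨i, hi⟩⟩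
      obtain ⟨f, r, hf, hr⟩ := geometric_hahn_banach_closed_point hAcv hAcl h0
      rw [map_zero] at hr
      classical
      have hfv : ∀ v : u → ℝ, f v = ∑ i, f (Pi.single i 1) * v i := fun v => by
        conv_lhs => rw [← Finset.univ_sum_single v]
        rw [map_sum]
        refine Finset.sum_congr rfl fun i _ => ?_
        have : Pi.single i (v i) = v i • (Pi.single i 1 : u → ℝ) := by
          rw [← Pi.single_smul, smul_eq_mul, mul_one]
        rw [this, map_smul, smul_eq_mul, mul_comm]
      have hc : ∀ i, 0 ≤ f (Pi.single i 1) := fun i => by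
        by_contra! hneg
        have hw₁ : f (F w₀) < 0 := (hf _ ⟨w₀, hw₀, le_rfl⟩).trans hr
        have h1 := hf (F w₀ - (f (F w₀) / f (Pi.single i 1)) • Pi.single i 1) ⟨w₀, hw₀, by
          have : 0 ≤ (f (F w₀) / f (Pi.single i 1)) • (Pi.single i 1 : u → ℝ) :=
            smul_nonneg (div_nonneg_of_nonpos hw₁.le hneg.le) (Pi.single_nonneg.2 zero_le_one)
          simpa using this⟩
        rw [map_sub, map_smul, smul_eq_mul, div_mul_cancel₀ _ hneg.ne, sub_self] at h1
        linarith
      obtain ⟨w, hw, hpos⟩ := H (Fintype.card u) (fun a => (Fintype.equivFin u).symm a)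
        (fun a => f (Pi.single ((Fintype.equivFin u).symm a) 1)) (fun a => hc _)
      have h2 : f (F w) < r := hf _ ⟨w, hw, le_rfl⟩
      rw [hfv, ← Equiv.sum_comp (Fintype.equivFin u).symm] at h2
      exact absurd hpos (by simp only [hF] at h2; linarith))
  exact ⟨w, hw, fun i => by simpa using Set.mem_iInter.1 hw' i⟩

end MinMax

section Weights

/-- Joint concavity of the weighted geometric mean. -/
lemma geom_mean_add_le {θ a₀ a₁ b₀ b₁ : ℝ} (hθ : 0 < θ) (hθ1 : θ < 1)
    (ha₀ : 0 ≤ a₀) (ha₁ : 0 ≤ a₁) (hb₀ : 0 ≤ b₀) (hb₁ : 0 ≤ b₁) :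
    a₀ ^ (1 - θ) * a₁ ^ θ + b₀ ^ (1 - θ) * b₁ ^ θ ≤ (a₀ + b₀) ^ (1 - θ) * (a₁ + b₁) ^ θ := by
  have h1θ : 0 < 1 - θ := by linarith
  rcases (add_nonneg ha₀ hb₀).eq_or_lt with h0 | h0
  · have e1 : a₀ = 0 := by linarith
    have e2 : b₀ = 0 := by linarith
    simp [e1, e2, Real.zero_rpow h1θ.ne']
  rcases (add_nonneg ha₁ hb₁).eq_or_lt with h1 | h1
  · have e1 : a₁ = 0 := by linarith
    have e2 : b₁ = 0 := by linarith
    simp [e1, e2, Real.zero_rpow hθ.ne']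
  have key : ∀ x y : ℝ, 0 ≤ x → 0 ≤ y → x ^ (1 - θ) * y ^ θ ≤
      (a₀ + b₀) ^ (1 - θ) * (a₁ + b₁) ^ θ * ((1 - θ) * (x / (a₀ + b₀)) + θ * (y / (a₁ + b₁))) :=
    fun x y hx hy => by
      have := Real.geom_mean_le_arith_mean2_weighted h1θ.le hθ.le (div_nonneg hx h0.le)
        (div_nonneg hy h1.le) (by ring)
      rw [Real.div_rpow hx h0.le, Real.div_rpow hy h1.le] at this
      refine le_trans (le_of_eq ?_) (mul_le_mul_of_nonneg_left this (by positivity))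
      have := (Real.rpow_pos_of_pos h0 (1 - θ)).ne'
      have := (Real.rpow_pos_of_pos h1 θ).ne'
      field_simp
  refine (add_le_add (key _ _ ha₀ ha₁) (key _ _ hb₀ hb₁)).trans (le_of_eq ?_)
  have := h0.ne'
  have := h1.ne'
  rw [← mul_add]
  field_simp
  ring

lemma concaveOn_geom_mean {E : Type*} [AddCommGroup E] [Module ℝ E] {θ : ℝ} (hθ : 0 < θ)
    (hθ1 : θ < 1) {W : Set E} (hW : Convex ℝ W) (f g : E →ₗ[ℝ] ℝ) (hf : ∀ w ∈ W, 0 ≤ f w)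
    (hg : ∀ w ∈ W, 0 ≤ g w) :
    ConcaveOn ℝ W fun w => f w ^ (1 - θ) * g w ^ θ := by
  refine ⟨hW, fun x hx y hy a b ha hb hab => ?_⟩
  have h1 : ∀ c : ℝ, 0 ≤ c → ∀ p q : ℝ, 0 ≤ p → 0 ≤ q →
      (c * p) ^ (1 - θ) * (c * q) ^ θ = c * (p ^ (1 - θ) * q ^ θ) := fun c hc p q hp hq => by
    rw [Real.mul_rpow hc hp, Real.mul_rpow hc hq]
    have : c ^ (1 - θ) * c ^ θ = c := by
      rw [← Real.rpow_add_of_nonneg hc (by linarith) hθ.le]; simp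
    linear_combination p ^ (1 - θ) * q ^ θ * this
  have h2 := geom_mean_add_le hθ hθ1 (mul_nonneg ha (hf x hx)) (mul_nonneg ha (hg x hx))
    (mul_nonneg hb (hf y hy)) (mul_nonneg hb (hg y hy))
  rw [h1 a ha _ _ (hf x hx) (hg x hx), h1 b hb _ _ (hf y hy) (hg y hy)] at h2
  simpa using h2

lemma continuous_geom_mean {E : Type*} [TopologicalSpace E] {θ : ℝ} (hθ : 0 < θ) (hθ1 : θ < 1)
    {f g : E → ℝ} (hf : Continuous f) (hg : Continuous g) :
    Continuous fun w => f w ^ (1 - θ) * g w ^ θ :=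
  (hf.rpow_const fun _ => Or.inr (by linarith)).mul (hg.rpow_const fun _ => Or.inr hθ.le)

/-- Linearization of weighted geometric means over a product of compact convex sets. -/
lemma exists_exp_weights {ι : Type*} [Fintype ι] {θ : ℝ} (hθ : 0 < θ) (hθ1 : θ < 1)
    {U₀ U₁ : Set (ι → ℝ)} (hU₀ : IsCompact U₀) (hU₁ : IsCompact U₁) (hc₀ : Convex ℝ U₀)
    (hc₁ : Convex ℝ U₁) (hne₀ : U₀.Nonempty) (hne₁ : U₁.Nonempty)
    (hp₀ : ∀ w ∈ U₀, ∀ i, 0 ≤ w i) (hp₁ : ∀ w ∈ U₁, ∀ i, 0 ≤ w i)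
    (ζ : ι → ℝ) (hζ : ∀ i, 0 ≤ ζ i) {V V' : ℝ} (hV : V < V')
    (H : ∀ w₀ ∈ U₀, ∀ w₁ ∈ U₁, ∑ i, w₀ i ^ (1 - θ) * w₁ i ^ θ * ζ i ≤ V) :
    ∃ t : ι → ℝ, ∀ w₀ ∈ U₀, ∀ w₁ ∈ U₁,
      (1 - θ) * ∑ i, w₀ i * (Real.exp (θ * t i) * ζ i) +
        θ * ∑ i, w₁ i * (Real.exp ((θ - 1) * t i) * ζ i) ≤ V' := by
  by_contra! hcon
  have h1θ : 0 < 1 - θ := by linarith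
  set Φ : (ι → ℝ) → (ι → ℝ) × (ι → ℝ) → ℝ := fun t w =>
    (1 - θ) * ∑ i, w.1 i * (Real.exp (θ * t i) * ζ i) +
        θ * ∑ i, w.2 i * (Real.exp ((θ - 1) * t i) * ζ i) - V' with hΦ
  have hexp : ∀ (N : ℕ) (c : Fin N → ℝ), (∀ a, 0 ≤ c a) → 0 < ∑ a, c a →
      ∀ (u : Fin N → ℝ) (r : ℝ), (∑ a, c a) * Real.exp (r * ((∑ a, c a * u a) / ∑ a, c a)) ≤
        ∑ a, c a * Real.exp (r * u a) := fun N c hc hcs u r => by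
    have h1 := convexOn_exp.map_centerMass_le (t := Finset.univ) (w := c) (p := fun a => r * u a)
      (fun a _ => hc a) hcs (fun a _ => Set.mem_univ _)
    simp only [Finset.centerMass, smul_eq_mul, Function.comp] at h1
    rw [le_inv_mul_iff₀ hcs] at h1
    refine le_trans (le_of_eq ?_) h1
    congr 2
    rw [mul_div_assoc', mul_comm (_⁻¹), ← div_eq_mul_inv, Finset.mul_sum]
    congr 1
    exact Finset.sum_congr rfl fun a _ => by ring
  obtain ⟨w, hw, hall⟩ := exists_forall_nonneg_of_concave (W := U₀ ×ˢ U₁) (hU₀.prod hU₁) Φ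
    (fun t => by simp only [hΦ]; fun_prop)
    (fun t => by
      refine ⟨hc₀.prod hc₁, fun x hx y hy a b ha hb hab => le_of_eq ?_⟩
      simp only [hΦ, Prod.fst_add, Prod.snd_add, Prod.smul_fst, Prod.smul_snd, Pi.add_apply,
        Pi.smul_apply, smul_eq_mul, add_mul, Finset.sum_add_distrib, mul_assoc, ← Finset.mul_sum]
      linear_combination (-V') * hab)
    (fun N f c hc => by
      obtain ⟨v₀, hv₀⟩ := hne₀
      obtain ⟨v₁, hv₁⟩ := hne₁
      rcases (Finset.sum_nonneg fun a _ => hc a : 0 ≤ ∑ a, c a).eq_or_lt with h0 | h0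
      · have : ∀ a, c a = 0 := fun a =>
          (Finset.sum_eq_zero_iff_of_nonneg fun a _ => hc a).1 h0.symm a (Finset.mem_univ a)
        exact ⟨(v₀, v₁), ⟨hv₀, hv₁⟩, by simp [this]⟩
      obtain ⟨w₀, hw₀, w₁, hw₁, hlt⟩ := hcon fun i => (∑ a, c a * f a i) / ∑ a, c a
      refine ⟨(w₀, w₁), ⟨hw₀, hw₁⟩, ?_⟩
      have hge : ∀ (r : ℝ) (w : ι → ℝ), (∀ i, 0 ≤ w i) →
          (∑ a, c a) * ∑ i, w i * (Real.exp (r * ((∑ a, c a * f a i) / ∑ a, c a)) * ζ i) ≤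
          ∑ a, c a * ∑ i, w i * (Real.exp (r * f a i) * ζ i) := fun r w hw => by
        simp only [Finset.mul_sum]
        rw [Finset.sum_comm]
        refine Finset.sum_le_sum fun i _ => ?_
        have := mul_le_mul_of_nonneg_left (hexp N c hc h0 (fun a => f a i) r)
          (mul_nonneg (hw i) (hζ i))
        rw [Finset.mul_sum] at this
        refine (le_of_eq (by ring)).trans (this.trans (le_of_eq ?_))
        exact Finset.sum_congr rfl fun a _ => by ring
      have e0 := mul_le_mul_of_nonneg_left (hge θ w₀ (hp₀ _ hw₀)) h1θ.le
      have e1 := mul_le_mul_of_nonneg_left (hge (θ - 1) w₁ (hp₁ _ hw₁)) hθ.le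
      have e2 := mul_lt_mul_of_pos_left hlt h0
      have e3 : ∑ a, c a * Φ (f a) (w₀, w₁) =
          (1 - θ) * (∑ a, c a * ∑ i, w₀ i * (Real.exp (θ * f a i) * ζ i)) +
          θ * (∑ a, c a * ∑ i, w₁ i * (Real.exp ((θ - 1) * f a i) * ζ i)) -
          (∑ a, c a) * V' := by
        rw [Finset.mul_sum, Finset.mul_sum, Finset.sum_mul, ← Finset.sum_add_distrib,
          ← Finset.sum_sub_distrib]
        exact Finset.sum_congr rfl fun a _ => by simp only [hΦ]; ring
      rw [e3]
      nlinarith)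
  have hle : ∀ δ > 0, V' ≤ ∑ i, (w.1 i + δ) ^ (1 - θ) * (w.2 i + δ) ^ θ * ζ i := fun δ hδ => by
    have h1 := hall fun i => Real.log ((w.2 i + δ) / (w.1 i + δ))
    simp only [hΦ, sub_nonneg] at h1
    refine h1.trans ?_
    rw [Finset.mul_sum, Finset.mul_sum, ← Finset.sum_add_distrib]
    refine Finset.sum_le_sum fun i _ => ?_
    have hA : 0 < w.1 i + δ := by linarith [hp₀ _ hw.1 i]
    have hB : 0 < w.2 i + δ := by linarith [hp₁ _ hw.2 i]
    have hlog : Real.log ((w.2 i + δ) / (w.1 i + δ)) =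
      Real.log (w.2 i + δ) - Real.log (w.1 i + δ) := Real.log_div hB.ne' hA.ne'
    have q0 : (w.1 i + δ) * Real.exp (θ * Real.log ((w.2 i + δ) / (w.1 i + δ))) =
        (w.1 i + δ) ^ (1 - θ) * (w.2 i + δ) ^ θ := by
      rw [Real.rpow_def_of_pos hA, Real.rpow_def_of_pos hB]
      nth_rw 1 [← Real.exp_log hA]
      rw [← Real.exp_add, ← Real.exp_add, hlog]
      congr 1; ring
    have q1 : (w.2 i + δ) * Real.exp ((θ - 1) * Real.log ((w.2 i + δ) / (w.1 i + δ))) =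
        (w.1 i + δ) ^ (1 - θ) * (w.2 i + δ) ^ θ := by
      rw [Real.rpow_def_of_pos hA, Real.rpow_def_of_pos hB]
      nth_rw 1 [← Real.exp_log hB]
      rw [← Real.exp_add, ← Real.exp_add, hlog]
      congr 1; ring
    have r0 : w.1 i * (Real.exp (θ * Real.log ((w.2 i + δ) / (w.1 i + δ))) * ζ i) ≤
        (w.1 i + δ) ^ (1 - θ) * (w.2 i + δ) ^ θ * ζ i := by
      rw [← q0, ← mul_assoc]
      have := hζ i
      gcongr
      linarith
    have r1 : w.2 i * (Real.exp ((θ - 1) * Real.log ((w.2 i + δ) / (w.1 i + δ))) * ζ i) ≤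
        (w.1 i + δ) ^ (1 - θ) * (w.2 i + δ) ^ θ * ζ i := by
      rw [← q1, ← mul_assoc]
      have := hζ i
      gcongr
      linarith
    nlinarith
  have hcont : Continuous fun δ : ℝ => ∑ i, (w.1 i + δ) ^ (1 - θ) * (w.2 i + δ) ^ θ * ζ i :=
    continuous_finsetSum _ fun i _ => (continuous_geom_mean hθ hθ1 (by fun_prop)
      (by fun_prop)).mul continuous_const
  have hlim := (hcont.tendsto 0).mono_left (nhdsWithin_le_nhds (s := Set.Ioi 0))
  have hfin : V' ≤ ∑ i, (w.1 i + 0) ^ (1 - θ) * (w.2 i + 0) ^ θ * ζ i :=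
    ge_of_tendsto hlim (by filter_upwards [self_mem_nhdsWithin] with δ hδ using hle δ hδ)
  simp only [add_zero] at hfin
  exact absurd (hfin.trans (H _ hw.1 _ hw.2)) (not_le.2 hV)

end Weights

section LatticeDuality

variable {n : ℕ} {N : (Fin n → ℝ) → ℝ}

/-- The positive part of the unit ball of the Köthe dual of a lattice norm. -/
def dualBall (N : (Fin n → ℝ) → ℝ) : Set (Fin n → ℝ) :=
  {σ | (∀ i, 0 ≤ σ i) ∧ ∀ x : Fin n → ℝ, (∀ i, 0 ≤ x i) → ∑ i, σ i * x i ≤ N x}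

/-- The polar of the squares of the dual ball. -/
def weightSet (N : (Fin n → ℝ) → ℝ) : Set (Fin n → ℝ) :=
  {w | (∀ i, 0 ≤ w i) ∧ ∀ σ ∈ dualBall N, ∑ i, w i * σ i ^ 2 ≤ 1}

lemma zero_mem_dualBall (hN : IsLatticeNorm N) : (0 : Fin n → ℝ) ∈ dualBall N :=
  ⟨fun _ => le_rfl, fun x _ => by simpa using hN.1 x⟩

lemma IsLatticeNorm.single_pos (hN : IsLatticeNorm N) (i : Fin n) : 0 < N (Pi.single i 1) := by
  refine lt_of_le_of_ne (hN.1 _) fun h => ?_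
  have := congrFun (hN.2.1 _ h.symm) i
  simp at this

lemma single_mem_dualBall (hN : IsLatticeNorm N) (i : Fin n) :
    Pi.single i (N (Pi.single i 1)) ∈ dualBall N := by
  refine ⟨fun j => ?_, fun x hx => ?_⟩
  · rw [Pi.single_apply]; split_ifs; exacts [hN.1 _, le_rfl]
  · have h1 : ∑ j, (Pi.single i (N (Pi.single i 1)) : Fin n → ℝ) j * x j
        = N (x i • Pi.single i 1) := by
      rw [hN.2.2.1, abs_of_nonneg (hx i)]
      simp [Pi.single_apply, mul_comm]
    rw [h1]
    refine hN.2.2.2.2 _ _ fun j => ?_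
    by_cases h : j = i
    · subst h; simp
    · simp [h]

lemma zero_mem_weightSet : (0 : Fin n → ℝ) ∈ weightSet N :=
  ⟨fun _ => le_rfl, fun σ _ => by simp⟩

lemma convex_weightSet : Convex ℝ (weightSet N) := by
  rintro w ⟨hw, hw'⟩ v ⟨hv, hv'⟩ a b ha hb hab
  refine ⟨fun i => add_nonneg (mul_nonneg ha (hw i)) (mul_nonneg hb (hv i)), fun σ hσ => ?_⟩
  have h1 : ∑ i, (a • w + b • v) i * σ i ^ 2 =
      a * ∑ i, w i * σ i ^ 2 + b * ∑ i, v i * σ i ^ 2 := by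
    simp [add_mul, Finset.sum_add_distrib, Finset.mul_sum, mul_assoc]
  rw [h1, ← hab]
  nlinarith [hw' σ hσ, hv' σ hσ]

lemma isCompact_weightSet (hN : IsLatticeNorm N) : IsCompact (weightSet N) := by
  have hcl : IsClosed (weightSet N) := by
    have : weightSet N = (⋂ i, {w | 0 ≤ w i}) ∩
        ⋂ σ ∈ dualBall N, {w : Fin n → ℝ | ∑ i, w i * σ i ^ 2 ≤ 1} := by
      ext w; simp [weightSet]
    rw [this]
    exact (isClosed_iInter fun i => isClosed_le (by fun_prop) (by fun_prop)).inter
      (isClosed_biInter fun σ _ => isClosed_le (by fun_prop) (by fun_prop))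
  refine IsCompact.of_isClosed_subset (isCompact_Icc (a := (0 : Fin n → ℝ))
    (b := fun i => ((N (Pi.single i 1)) ^ 2)⁻¹)) hcl fun w hw => ⟨hw.1, fun i => ?_⟩
  have h1 := hw.2 _ (single_mem_dualBall hN i)
  have h2 := hN.single_pos i
  simp only [Pi.single_apply, ite_pow, mul_ite] at h1
  show w i ≤ ((N (Pi.single i 1)) ^ 2)⁻¹
  rw [← one_div, le_div_iff₀ (by positivity)]
  simpa using h1

lemma ConcaveWith.sqrt_sum_sq_le {M : ℝ} (h : ConcaveWith 2 M N) {a : ℕ} (x : Fin a → Fin n → ℝ) :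
    √(∑ i, N (x i) ^ 2) ≤ M * N fun j => √(∑ i, x i j ^ 2) := by
  have := h a x
  simpa only [Real.sqrt_eq_rpow, Real.rpow_two, sq_abs, one_div] using this

lemma convexHull_sq_dualBall (hN : IsLatticeNorm N) {M : ℝ} (hM : 0 ≤ M) (h : ConcaveWith 2 M N)
    {c : Fin n → ℝ} (hc : c ∈ convexHull ℝ {c | ∃ σ ∈ dualBall N, ∀ i, c i ≤ σ i ^ 2})
    {x : Fin n → ℝ} (hx : ∀ i, 0 ≤ x i) : ∑ i, x i * √(c i) ≤ M * N x := by
  obtain ⟨A, _, w, z, hw, hw1, hz, rfl⟩ := mem_convexHull_iff_exists_fintype.1 hc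
  choose σ hσ hzσ using hz
  obtain ⟨p, ⟨e⟩⟩ : ∃ p, Nonempty (A ≃ Fin p) := ⟨_, ⟨Fintype.equivFin A⟩⟩
  set q : Fin n → ℝ := fun j => √(∑ a, w a * σ a j ^ 2) with hq
  have hqs : ∀ j, q j ^ 2 = ∑ a, w a * σ a j ^ 2 := fun j =>
    Real.sq_sqrt (Finset.sum_nonneg fun a _ => mul_nonneg (hw a) (sq_nonneg _))
  have hle : ∀ j, √((∑ a, w a • z a) j) ≤ q j := fun j => by
    refine Real.sqrt_le_sqrt ?_
    simp only [Finset.sum_apply, Pi.smul_apply, smul_eq_mul]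
    exact Finset.sum_le_sum fun a _ => mul_le_mul_of_nonneg_left (hzσ a j) (hw a)
  set y : A → Fin n → ℝ := fun a j => x j * (√(w a) * σ a j / q j) with hy
  have hy0 : ∀ a j, 0 ≤ y a j := fun a j =>
    mul_nonneg (hx j) (div_nonneg (mul_nonneg (Real.sqrt_nonneg _) ((hσ a).1 j))
      (Real.sqrt_nonneg _))
  have hone : ∀ j, ∑ a, (√(w a) * σ a j / q j) ^ 2 ≤ 1 := fun j => by
    have h1 : ∑ a, (√(w a) * σ a j / q j) ^ 2 = q j ^ 2 / q j ^ 2 := by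
      nth_rw 1 [hqs]
      rw [Finset.sum_div]
      exact Finset.sum_congr rfl fun a _ => by rw [div_pow, mul_pow, Real.sq_sqrt (hw a)]
    rw [h1]
    exact div_self_le_one _
  have hqj : ∀ j, q j = ∑ a, √(w a) * σ a j * (√(w a) * σ a j / q j) := fun j => by
    have h1 : ∑ a, √(w a) * σ a j * (√(w a) * σ a j / q j) = q j ^ 2 / q j := by
      nth_rw 1 [hqs]
      rw [Finset.sum_div]
      exact Finset.sum_congr rfl fun a _ => by
        nth_rw 3 [← Real.mul_self_sqrt (hw a)]
        ring
    rw [h1]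
    by_cases h0 : q j = 0
    · simp [h0]
    · field_simp
  calc ∑ j, x j * √((∑ a, w a • z a) j) ≤ ∑ j, x j * q j :=
        Finset.sum_le_sum fun j _ => mul_le_mul_of_nonneg_left (hle j) (hx j)
    _ = ∑ a, √(w a) * ∑ j, σ a j * y a j := by
        simp only [Finset.mul_sum]
        rw [Finset.sum_comm]
        refine Finset.sum_congr rfl fun j _ => ?_
        conv_lhs => rw [hqj j, Finset.mul_sum]
        exact Finset.sum_congr rfl fun a _ => by simp only [hy]; ring
    _ ≤ ∑ a, √(w a) * N (y a) :=
        Finset.sum_le_sum fun a _ => mul_le_mul_of_nonneg_left ((hσ a).2 _ (hy0 a))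
          (Real.sqrt_nonneg _)
    _ ≤ √(∑ a, √(w a) ^ 2) * √(∑ a, N (y a) ^ 2) := Real.sum_mul_le_sqrt_mul_sqrt _ _ _
    _ = √(∑ a, N (y (e.symm a)) ^ 2) := by
        have : ∑ a, √(w a) ^ 2 = 1 := by
          rw [← hw1]; exact Finset.sum_congr rfl fun a _ => Real.sq_sqrt (hw a)
        rw [this, Real.sqrt_one, one_mul, Equiv.sum_comp e.symm fun a => N (y a) ^ 2]
    _ ≤ M * N fun j => √(∑ a, y (e.symm a) j ^ 2) := h.sqrt_sum_sq_le fun a => y (e.symm a)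
    _ ≤ M * N x := by
        refine mul_le_mul_of_nonneg_left (hN.2.2.2.2 _ _ fun j => ?_) hM
        rw [Equiv.sum_comp e.symm fun a => y a j ^ 2, abs_of_nonneg (Real.sqrt_nonneg _),
          Real.sqrt_le_left (abs_nonneg _), sq_abs]
        simp only [hy, mul_pow, ← Finset.mul_sum]
        simpa only [mul_pow] using mul_le_of_le_one_right (sq_nonneg (x j)) (hone j)

/-- Bipolar theorem for the squares of the dual ball of a 2-concave lattice. -/
lemma sqrt_le_of_weightSet (hN : IsLatticeNorm N) {M : ℝ} (hM : 0 ≤ M) (h : ConcaveWith 2 M N)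
    {ζ : Fin n → ℝ} (hζ : ∀ w ∈ weightSet N, ∑ i, w i * ζ i ≤ 1)
    {x : Fin n → ℝ} (hx : ∀ i, 0 ≤ x i) : ∑ i, x i * √(ζ i) ≤ M * N x := by
  set B : Set (Fin n → ℝ) := {c | ∃ σ ∈ dualBall N, ∀ i, c i ≤ σ i ^ 2} with hB
  have hcl : closure (convexHull ℝ B) ⊆ {c | ∑ i, x i * √(c i) ≤ M * N x} :=
    closure_minimal (fun c hc => convexHull_sq_dualBall hN hM h hc hx)
      (isClosed_le (by fun_prop) continuous_const)
  by_contra hcon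
  obtain ⟨f, r, hf, hr⟩ := geometric_hahn_banach_closed_point
    (convex_convexHull ℝ B).closure isClosed_closure (fun hmem => hcon (hcl hmem))
  have hfB : ∀ c ∈ B, f c < r := fun c hc => hf c (subset_closure (subset_convexHull ℝ B hc))
  have h0 : 0 < r := by
    have := hfB 0 ⟨0, zero_mem_dualBall hN, fun i => by simp⟩
    rwa [map_zero] at this
  have hfv : ∀ v : Fin n → ℝ, f v = ∑ i, f (Pi.single i 1) * v i := fun v => by
    conv_lhs => rw [← Finset.univ_sum_single v]
    rw [map_sum]
    refine Finset.sum_congr rfl fun i _ => ?_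
    have : Pi.single i (v i) = v i • (Pi.single i 1 : Fin n → ℝ) := by
      rw [← Pi.single_smul, smul_eq_mul, mul_one]
    rw [this, map_smul, smul_eq_mul, mul_comm]
  have hw0 : ∀ i, 0 ≤ f (Pi.single i 1) := fun i => by
    by_contra! hneg
    have h1 := hfB ((r / f (Pi.single i 1)) • Pi.single i 1) ⟨0, zero_mem_dualBall hN, fun j => by
      have : (r / f (Pi.single i 1)) • (Pi.single i 1 : Fin n → ℝ) ≤ 0 :=
        smul_nonpos_of_nonpos_of_nonneg (div_nonpos_of_nonneg_of_nonpos h0.le hneg.le)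
          (Pi.single_nonneg.2 zero_le_one)
      simpa using this j⟩
    rw [map_smul, smul_eq_mul, div_mul_cancel₀ _ hneg.ne] at h1
    exact lt_irrefl _ h1
  have hmem : (fun i => f (Pi.single i 1) / r) ∈ weightSet N := by
    refine ⟨fun i => div_nonneg (hw0 i) h0.le, fun σ hσ => ?_⟩
    have h1 := hfB (fun i => σ i ^ 2) ⟨σ, hσ, fun i => le_rfl⟩
    rw [hfv] at h1
    simp only [div_mul_eq_mul_div, ← Finset.sum_div]
    rw [div_le_one h0]
    exact h1.le
  have h2 := hζ _ hmem
  simp only [div_mul_eq_mul_div, ← Finset.sum_div] at h2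
  rw [div_le_one h0, ← hfv] at h2
  linarith

/-- A Lozanovskii-type factorization for the weights of a pair of 2-concave lattices. -/
lemma exists_dualBall_factorization {N₀ N₁ : (Fin n → ℝ) → ℝ} (hN₀ : IsLatticeNorm N₀)
    (hN₁ : IsLatticeNorm N₁) {M₀ M₁ : ℝ} (hM₀ : 0 < M₀) (hM₁ : 0 < M₁)
    (hc₀ : ConcaveWith 2 M₀ N₀) (hc₁ : ConcaveWith 2 M₁ N₁) {θ : ℝ} (hθ : 0 < θ) (hθ1 : θ < 1)
    {ζ : Fin n → ℝ} (hζ : ∀ i, 0 ≤ ζ i) {V ε : ℝ} (hε : 0 < ε)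
    (H : ∀ w₀ ∈ weightSet N₀, ∀ w₁ ∈ weightSet N₁, ∑ i, w₀ i ^ (1 - θ) * w₁ i ^ θ * ζ i ≤ V) :
    ∃ σ₀ ∈ dualBall N₀, ∃ σ₁ ∈ dualBall N₁, ∀ i,
      √(ζ i) ≤ √(V + ε) * (M₀ ^ (1 - θ) * M₁ ^ θ) * (σ₀ i ^ (1 - θ) * σ₁ i ^ θ) := by
  have h1θ : 0 < 1 - θ := by linarith
  obtain ⟨t, ht⟩ := exists_exp_weights hθ hθ1 (isCompact_weightSet hN₀) (isCompact_weightSet hN₁)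
    convex_weightSet convex_weightSet ⟨0, zero_mem_weightSet⟩ ⟨0, zero_mem_weightSet⟩
    (fun w hw => hw.1) (fun w hw => hw.1) ζ hζ (show V < V + ε / 2 by linarith) H
  have hmax : ∀ {N' : (Fin n → ℝ) → ℝ}, IsLatticeNorm N' → ∀ g : Fin n → ℝ,
      ∃ w ∈ weightSet N', ∀ v ∈ weightSet N', ∑ i, v i * g i ≤ ∑ i, w i * g i := fun hN' g => by
    obtain ⟨w, hw, hmax⟩ := (isCompact_weightSet hN').exists_isMaxOn ⟨0, zero_mem_weightSet⟩
      (f := fun v => ∑ i, v i * g i) (by fun_prop)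
    exact ⟨w, hw, fun v hv => hmax hv⟩
  have hσ : ∀ {N' : (Fin n → ℝ) → ℝ} {M' : ℝ}, IsLatticeNorm N' → 0 < M' → ConcaveWith 2 M' N' →
      ∀ (g : Fin n → ℝ) (s : ℝ), 0 < s →
      (∀ v ∈ weightSet N', ∑ i, v i * g i ≤ s) →
      (fun i => √(g i) / (M' * √s)) ∈ dualBall N' := fun {N' M'} hN' hM' hc' g s hs hv => by
    refine ⟨fun i => by positivity, fun x hx => ?_⟩
    have h1 := sqrt_le_of_weightSet hN' hM'.le hc' (ζ := fun i => g i / s) (fun w hw => by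
      simp only [mul_div_assoc', ← Finset.sum_div]
      exact (div_le_one hs).2 (hv w hw)) hx
    have h2 : ∑ i, √(g i) / (M' * √s) * x i = (∑ i, x i * √(g i / s)) / M' := by
      rw [Finset.sum_div]
      refine Finset.sum_congr rfl fun i _ => ?_
      rw [Real.sqrt_div' _ hs.le]
      have := hM'.ne'
      have := (Real.sqrt_pos.2 hs).ne'
      field_simp
    rw [h2, div_le_iff₀ hM', mul_comm]
    exact h1
  obtain ⟨w₀, hw₀, hm₀⟩ := hmax hN₀ fun i => Real.exp (θ * t i) * ζ i
  obtain ⟨w₁, hw₁, hm₁⟩ := hmax hN₁ fun i => Real.exp ((θ - 1) * t i) * ζ i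
  set s₀ := ∑ i, w₀ i * (Real.exp (θ * t i) * ζ i) with hs₀
  set s₁ := ∑ i, w₁ i * (Real.exp ((θ - 1) * t i) * ζ i) with hs₁
  have hs₀p : 0 ≤ s₀ := Finset.sum_nonneg fun i _ =>
    mul_nonneg (hw₀.1 i) (mul_nonneg (Real.exp_pos _).le (hζ i))
  have hs₁p : 0 ≤ s₁ := Finset.sum_nonneg fun i _ =>
    mul_nonneg (hw₁.1 i) (mul_nonneg (Real.exp_pos _).le (hζ i))
  have hsum := ht w₀ hw₀ w₁ hw₁
  have hA : 0 < s₀ + ε / 2 := by linarith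
  have hB : 0 < s₁ + ε / 2 := by linarith
  refine ⟨_, hσ hN₀ hM₀ hc₀ _ (s₀ + ε / 2) hA fun v hv => (hm₀ v hv).trans (by linarith), _,
    hσ hN₁ hM₁ hc₁ _ (s₁ + ε / 2) hB fun v hv => (hm₁ v hv).trans (by linarith), fun i => ?_⟩
  have hgm := Real.geom_mean_le_arith_mean2_weighted h1θ.le hθ.le hA.le hB.le (by ring)
  have hgm' : (s₀ + ε / 2) ^ (1 - θ) * (s₁ + ε / 2) ^ θ ≤ V + ε := by nlinarith
  have hroot : √(s₀ + ε / 2) ^ (1 - θ) * √(s₁ + ε / 2) ^ θ ≤ √(V + ε) := by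
    rw [Real.sqrt_eq_rpow, Real.sqrt_eq_rpow, ← Real.rpow_mul hA.le, ← Real.rpow_mul hB.le,
      mul_comm (1 / 2) (1 - θ), mul_comm (1 / 2) θ, Real.rpow_mul hA.le, Real.rpow_mul hB.le,
      ← Real.mul_rpow (by positivity) (by positivity), ← Real.sqrt_eq_rpow]
    exact Real.sqrt_le_sqrt hgm'
  have hexp : √(Real.exp (θ * t i) * ζ i) ^ (1 - θ) * √(Real.exp ((θ - 1) * t i) * ζ i) ^ θ
      = √(ζ i) := by
    rw [Real.sqrt_mul (Real.exp_pos _).le, Real.sqrt_mul (Real.exp_pos _).le,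
      Real.mul_rpow (by positivity) (by positivity), Real.mul_rpow (by positivity) (by positivity)]
    have e1 : √(Real.exp (θ * t i)) ^ (1 - θ) * √(Real.exp ((θ - 1) * t i)) ^ θ = 1 := by
      rw [← Real.exp_half, ← Real.exp_half, ← Real.exp_mul, ← Real.exp_mul, ← Real.exp_add,
        ← Real.exp_zero]
      congr 1; ring
    have e2 : √(ζ i) ^ (1 - θ) * √(ζ i) ^ θ = √(ζ i) := by
      rw [← Real.rpow_add_of_nonneg (by positivity) h1θ.le hθ.le]; simp
    linear_combination √(ζ i) ^ (1 - θ) * √(ζ i) ^ θ * e1 + e2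
  have hS₀ : 0 < √(s₀ + ε / 2) ^ (1 - θ) := by positivity
  have hS₁ : 0 < √(s₁ + ε / 2) ^ θ := by positivity
  have hP₀ : 0 < M₀ ^ (1 - θ) := by positivity
  have hP₁ : 0 < M₁ ^ θ := by positivity
  rw [Real.div_rpow (by positivity) (by positivity), Real.div_rpow (by positivity) (by positivity),
    Real.mul_rpow hM₀.le (by positivity), Real.mul_rpow hM₁.le (by positivity), div_mul_div_comm,
    hexp]
  have h3 : √(V + ε) * (M₀ ^ (1 - θ) * M₁ ^ θ) * (√(ζ i) /
      (M₀ ^ (1 - θ) * √(s₀ + ε / 2) ^ (1 - θ) * (M₁ ^ θ * √(s₁ + ε / 2) ^ θ)))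
      = √(ζ i) * (√(V + ε) / (√(s₀ + ε / 2) ^ (1 - θ) * √(s₁ + ε / 2) ^ θ)) := by
    have := hP₀.ne'; have := hP₁.ne'
    field_simp
  rw [h3]
  refine le_mul_of_one_le_right (Real.sqrt_nonneg _) ?_
  rw [one_le_div (by positivity)]
  exact hroot

end LatticeDuality

section QuadraticDomination

/-- Maurey-type domination: a bilinear form with uniform square-function bounds is dominated by
a sum of weighted quadratic forms. -/
lemma exists_quadratic_domination {V W : Type*} [NormedAddCommGroup V] [NormedSpace ℂ V]
    [NormedAddCommGroup W] [NormedSpace ℂ W] {n m : ℕ}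
    (T : (Fin n → StrongDual ℂ V) →ₗ[ℂ] (Fin m → StrongDual ℂ W) →ₗ[ℂ] ℂ)
    {X₀ X₁ : (Fin n → ℝ) → ℝ} {Y₀ Y₁ : (Fin m → ℝ) → ℝ}
    (hX₀ : IsLatticeNorm X₀) (hX₁ : IsLatticeNorm X₁)
    (hY₀ : IsLatticeNorm Y₀) (hY₁ : IsLatticeNorm Y₁)
    {A₀ A₁ B₀ B₁ : ℝ} (hA₀ : 0 < A₀) (hA₁ : 0 < A₁) (hB₀ : 0 < B₀) (hB₁ : 0 < B₁)
    (hcX₀ : ConcaveWith 2 A₀ X₀) (hcX₁ : ConcaveWith 2 A₁ X₁)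
    (hcY₀ : ConcaveWith 2 B₀ Y₀) (hcY₁ : ConcaveWith 2 B₁ Y₁)
    {θ : ℝ} (hθ : 0 < θ) (hθ1 : θ < 1) {c : ℝ} (hc : 0 ≤ c)
    (H : ∀ σ₀ ∈ dualBall X₀, ∀ σ₁ ∈ dualBall X₁, ∀ τ₀ ∈ dualBall Y₀, ∀ τ₁ ∈ dualBall Y₁,
      OrthBound T (fun i => σ₀ i ^ (1 - θ) * σ₁ i ^ θ) (fun j => τ₀ j ^ (1 - θ) * τ₁ j ^ θ) c) :
    ∃ w₀ ∈ weightSet X₀, ∃ w₁ ∈ weightSet X₁, ∃ v₀ ∈ weightSet Y₀, ∃ v₁ ∈ weightSet Y₁,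
      ∀ x y, (T x y).re ≤ (A₀ ^ (1 - θ) * A₁ ^ θ) * (B₀ ^ (1 - θ) * B₁ ^ θ) * c / 2 *
        (∑ i, w₀ i ^ (1 - θ) * w₁ i ^ θ * ‖x i‖ ^ 2 +
          ∑ j, v₀ j ^ (1 - θ) * v₁ j ^ θ * ‖y j‖ ^ 2) := by
  set A := A₀ ^ (1 - θ) * A₁ ^ θ with hA
  set B := B₀ ^ (1 - θ) * B₁ ^ θ with hB
  have hAp : 0 < A := by positivity
  have hBp : 0 < B := by positivity
  have hkX₀ := isCompact_weightSet hX₀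
  have hkX₁ := isCompact_weightSet hX₁
  have hkY₀ := isCompact_weightSet hY₀
  have hkY₁ := isCompact_weightSet hY₁
  set U : Set (((Fin n → ℝ) × (Fin n → ℝ)) × ((Fin m → ℝ) × (Fin m → ℝ))) :=
    (weightSet X₀ ×ˢ weightSet X₁) ×ˢ (weightSet Y₀ ×ˢ weightSet Y₁) with hU
  have hUc : Convex ℝ U :=
    (convex_weightSet.prod convex_weightSet).prod (convex_weightSet.prod convex_weightSet)
  set Φ : (Fin n → StrongDual ℂ V) × (Fin m → StrongDual ℂ W) →
      ((Fin n → ℝ) × (Fin n → ℝ)) × ((Fin m → ℝ) × (Fin m → ℝ)) → ℝ := fun p w =>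
    A * B * c / 2 * (∑ i, w.1.1 i ^ (1 - θ) * w.1.2 i ^ θ * ‖p.1 i‖ ^ 2 +
      ∑ j, w.2.1 j ^ (1 - θ) * w.2.2 j ^ θ * ‖p.2 j‖ ^ 2) - (T p.1 p.2).re with hΦ
  have hcX : ∀ i, Continuous fun w : ((Fin n → ℝ) × (Fin n → ℝ)) × ((Fin m → ℝ) × (Fin m → ℝ)) =>
      w.1.1 i ^ (1 - θ) * w.1.2 i ^ θ := fun i =>
    continuous_geom_mean hθ hθ1 (by fun_prop) (by fun_prop)
  have hcY : ∀ j, Continuous fun w : ((Fin n → ℝ) × (Fin n → ℝ)) × ((Fin m → ℝ) × (Fin m → ℝ)) =>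
      w.2.1 j ^ (1 - θ) * w.2.2 j ^ θ := fun j =>
    continuous_geom_mean hθ hθ1 (by fun_prop) (by fun_prop)
  have hvX : ∀ i, ConcaveOn ℝ U fun w => w.1.1 i ^ (1 - θ) * w.1.2 i ^ θ := fun i =>
    concaveOn_geom_mean hθ hθ1 hUc
      (LinearMap.proj i ∘ₗ LinearMap.fst ℝ _ _ ∘ₗ LinearMap.fst ℝ _ _)
      (LinearMap.proj i ∘ₗ LinearMap.snd ℝ _ _ ∘ₗ LinearMap.fst ℝ _ _)
      (fun w hw => hw.1.1.1 i) (fun w hw => hw.1.2.1 i)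
  have hvY : ∀ j, ConcaveOn ℝ U fun w => w.2.1 j ^ (1 - θ) * w.2.2 j ^ θ := fun j =>
    concaveOn_geom_mean hθ hθ1 hUc
      (LinearMap.proj j ∘ₗ LinearMap.fst ℝ _ _ ∘ₗ LinearMap.snd ℝ _ _)
      (LinearMap.proj j ∘ₗ LinearMap.snd ℝ _ _ ∘ₗ LinearMap.snd ℝ _ _)
      (fun w hw => hw.2.1.1 j) (fun w hw => hw.2.2.1 j)
  obtain ⟨w, hw, hall⟩ := exists_forall_nonneg_of_concave (W := U)
    ((hkX₀.prod hkX₁).prod (hkY₀.prod hkY₁)) Φ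
    (fun p => by
      refine (continuous_const.mul ((continuous_finsetSum _ fun i _ => ?_).add
        (continuous_finsetSum _ fun j _ => ?_))).sub continuous_const
      · exact (hcX i).mul continuous_const
      · exact (hcY j).mul continuous_const)
    (fun p => by
      refine ⟨hUc, fun x hx y hy a b ha hb hab => ?_⟩
      have e1 : ∀ i, a * (x.1.1 i ^ (1 - θ) * x.1.2 i ^ θ * ‖p.1 i‖ ^ 2) +
          b * (y.1.1 i ^ (1 - θ) * y.1.2 i ^ θ * ‖p.1 i‖ ^ 2) ≤
          (a • x + b • y).1.1 i ^ (1 - θ) * (a • x + b • y).1.2 i ^ θ * ‖p.1 i‖ ^ 2 := fun i => by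
        have := mul_le_mul_of_nonneg_right ((hvX i).2 hx hy ha hb hab) (sq_nonneg ‖p.1 i‖)
        simp only [smul_eq_mul] at this
        linarith
      have e2 : ∀ j, a * (x.2.1 j ^ (1 - θ) * x.2.2 j ^ θ * ‖p.2 j‖ ^ 2) +
          b * (y.2.1 j ^ (1 - θ) * y.2.2 j ^ θ * ‖p.2 j‖ ^ 2) ≤
          (a • x + b • y).2.1 j ^ (1 - θ) * (a • x + b • y).2.2 j ^ θ * ‖p.2 j‖ ^ 2 := fun j => by
        have := mul_le_mul_of_nonneg_right ((hvY j).2 hx hy ha hb hab) (sq_nonneg ‖p.2 j‖)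
        simp only [smul_eq_mul] at this
        linarith
      have s1 := Finset.sum_le_sum fun i (_ : i ∈ Finset.univ) => e1 i
      have s2 := Finset.sum_le_sum fun j (_ : j ∈ Finset.univ) => e2 j
      rw [Finset.sum_add_distrib, ← Finset.mul_sum, ← Finset.mul_sum] at s1 s2
      have hP : 0 ≤ A * B * c / 2 := by positivity
      have := mul_le_mul_of_nonneg_left (add_le_add s1 s2) hP
      simp only [hΦ, smul_eq_mul]
      linear_combination this - (T p.1 p.2).re * hab)
    (fun N f d hd => by
      set ζ : Fin n → ℝ := fun i => ∑ a, d a * ‖(f a).1 i‖ ^ 2 with hζ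
      set η : Fin m → ℝ := fun j => ∑ a, d a * ‖(f a).2 j‖ ^ 2 with hη
      have hζ0 : ∀ i, 0 ≤ ζ i := fun i => Finset.sum_nonneg fun a _ =>
        mul_nonneg (hd a) (sq_nonneg _)
      have hη0 : ∀ j, 0 ≤ η j := fun j => Finset.sum_nonneg fun a _ =>
        mul_nonneg (hd a) (sq_nonneg _)
      obtain ⟨w, hw, hwm⟩ := (hkX₀.prod hkX₁).exists_isMaxOn
        ⟨(0, 0), zero_mem_weightSet, zero_mem_weightSet⟩
        (f := fun w => ∑ i, w.1 i ^ (1 - θ) * w.2 i ^ θ * ζ i)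
        (continuous_finsetSum _ fun i _ => (continuous_geom_mean hθ hθ1 (by fun_prop)
          (by fun_prop)).mul continuous_const).continuousOn
      obtain ⟨v, hv, hvm⟩ := (hkY₀.prod hkY₁).exists_isMaxOn
        ⟨(0, 0), zero_mem_weightSet, zero_mem_weightSet⟩
        (f := fun w => ∑ j, w.1 j ^ (1 - θ) * w.2 j ^ θ * η j)
        (continuous_finsetSum _ fun i _ => (continuous_geom_mean hθ hθ1 (by fun_prop)
          (by fun_prop)).mul continuous_const).continuousOn
      set P := ∑ i, w.1 i ^ (1 - θ) * w.2 i ^ θ * ζ i with hP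
      set Q := ∑ j, v.1 j ^ (1 - θ) * v.2 j ^ θ * η j with hQ
      have hP0 : 0 ≤ P := Finset.sum_nonneg fun i _ => mul_nonneg (mul_nonneg
        (Real.rpow_nonneg (hw.1.1 i) _) (Real.rpow_nonneg (hw.2.1 i) _)) (hζ0 i)
      have hQ0 : 0 ≤ Q := Finset.sum_nonneg fun j _ => mul_nonneg (mul_nonneg
        (Real.rpow_nonneg (hv.1.1 j) _) (Real.rpow_nonneg (hv.2.1 j) _)) (hη0 j)
      have hmain : ∑ a, d a * (T (f a).1 (f a).2).re ≤ A * B * c / 2 * (P + Q) := by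
        have hε : ∀ ε > 0, ∑ a, d a * (T (f a).1 (f a).2).re ≤
            A * B * c / 2 * (P + Q) + A * B * c * ε := fun ε hε => by
          obtain ⟨σ₀, hσ₀, σ₁, hσ₁, hσ⟩ := exists_dualBall_factorization hX₀ hX₁ hA₀ hA₁ hcX₀ hcX₁
            hθ hθ1 hζ0 hε fun w₀ hw₀ w₁ hw₁ => hwm (show (w₀, w₁) ∈ _ from ⟨hw₀, hw₁⟩)
          obtain ⟨τ₀, hτ₀, τ₁, hτ₁, hτ⟩ := exists_dualBall_factorization hY₀ hY₁ hB₀ hB₁ hcY₀ hcY₁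
            hθ hθ1 hη0 hε fun w₀ hw₀ w₁ hw₁ => hvm (show (w₀, w₁) ∈ _ from ⟨hw₀, hw₁⟩)
          have hnorm : ∀ a, ‖(√(d a) : ℂ)‖ ^ 2 = d a := fun a => by
            rw [Complex.norm_real, Real.norm_eq_abs, sq_abs, Real.sq_sqrt (hd a)]
          have hsq : ∀ {z r : ℝ}, 0 ≤ z → √z ≤ r → z ≤ r ^ 2 := fun hz h =>
            (Real.sqrt_le_left ((Real.sqrt_nonneg _).trans h)).1 h
          have h1 := (H σ₀ hσ₀ σ₁ hσ₁ τ₀ hτ₀ τ₁ hτ₁).scaled (a := √(P + ε) * A)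
            (b := √(Q + ε) * B) (by positivity) (by positivity) (S := Fin N) 1 (one_mem _)
            (fun a => (√(d a) : ℂ) • (f a).1) (fun a => (√(d a) : ℂ) • (f a).2)
            (fun i => by
              refine (le_of_eq ?_).trans (hsq (hζ0 i) (hσ i))
              simp only [Pi.smul_apply, norm_smul, mul_pow, hnorm, hζ])
            (fun j => by
              refine (le_of_eq ?_).trans (hsq (hη0 j) (hτ j))
              simp only [Pi.smul_apply, norm_smul, mul_pow, hnorm, hη])
          have h2 : ∑ s, ∑ r, (((1 : Matrix (Fin N) (Fin N) ℝ) s r : ℝ) : ℂ) *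
              T ((√(d s) : ℂ) • (f s).1) ((√(d r) : ℂ) • (f r).2)
              = ∑ a, (d a : ℂ) * T (f a).1 (f a).2 := by
            refine Finset.sum_congr rfl fun s _ => ?_
            rw [Finset.sum_eq_single s (fun r _ hr => by simp [Matrix.one_apply_ne hr.symm])
              (by simp)]
            have : (√(d s) : ℂ) * (√(d s) : ℂ) = (d s : ℂ) := by
              rw [← Complex.ofReal_mul, Real.mul_self_sqrt (hd s)]
            simp only [map_smul, LinearMap.smul_apply, smul_eq_mul, Matrix.one_apply_eq,
              Complex.ofReal_one, one_mul]
            linear_combination T (f s).1 (f s).2 * this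
          rw [h2] at h1
          have h3 := (Complex.re_le_norm _).trans h1
          simp only [Complex.re_sum, Complex.re_ofReal_mul] at h3
          refine h3.trans ?_
          have h4 : √(P + ε) * √(Q + ε) ≤ (P + Q) / 2 + ε := by
            nlinarith [sq_nonneg (√(P + ε) - √(Q + ε)), Real.sq_sqrt (show 0 ≤ P + ε by linarith),
              Real.sq_sqrt (show 0 ≤ Q + ε by linarith)]
          have h5 : 0 ≤ A * B * c := by positivity
          nlinarith [mul_le_mul_of_nonneg_left h4 h5]
        have hABc : 0 ≤ A * B * c := by positivity
        refine le_of_forall_pos_le_add fun ε hε' => ?_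
        refine (hε (ε / (A * B * c + 1)) (by positivity)).trans ?_
        have : A * B * c * (ε / (A * B * c + 1)) ≤ ε := by
          rw [mul_div_assoc', div_le_iff₀ (by positivity)]
          nlinarith
        linarith
      refine ⟨(w, v), ⟨hw, hv⟩, ?_⟩
      have e : ∑ a, d a * Φ (f a) (w, v) =
          A * B * c / 2 * (P + Q) - ∑ a, d a * (T (f a).1 (f a).2).re := by
        have hPe : P = ∑ a, d a * ∑ i, w.1 i ^ (1 - θ) * w.2 i ^ θ * ‖(f a).1 i‖ ^ 2 := by
          simp only [hP, hζ, Finset.mul_sum]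
          rw [Finset.sum_comm]
          exact Finset.sum_congr rfl fun a _ => Finset.sum_congr rfl fun i _ => by ring
        have hQe : Q = ∑ a, d a * ∑ j, v.1 j ^ (1 - θ) * v.2 j ^ θ * ‖(f a).2 j‖ ^ 2 := by
          simp only [hQ, hη, Finset.mul_sum]
          rw [Finset.sum_comm]
          exact Finset.sum_congr rfl fun a _ => Finset.sum_congr rfl fun i _ => by ring
        rw [hPe, hQe, ← Finset.sum_add_distrib, Finset.mul_sum, ← Finset.sum_sub_distrib]
        exact Finset.sum_congr rfl fun a _ => by simp only [hΦ]; ring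
      rw [e]
      linarith)
  exact ⟨w.1.1, hw.1.1, w.1.2, hw.1.2, w.2.1, hw.2.1, w.2.2, hw.2.2, fun x y => by
    have := hall (x, y)
    simp only [hΦ] at this
    linarith⟩

end QuadraticDomination

section ThreeLines

lemma exists_exp_interpolation {θ a b : ℝ} (hθ : 0 < θ) (hθ1 : θ < 1) (ha : 0 ≤ a) (hb : 0 ≤ b) :
    ∃ κ : ℝ, Real.exp (-θ * κ) * (a ^ (1 - θ) * b ^ θ) ≤ a ∧
      Real.exp ((1 - θ) * κ) * (a ^ (1 - θ) * b ^ θ) ≤ b := by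
  rcases ha.eq_or_lt with rfl | ha
  · exact ⟨0, by simp [Real.zero_rpow (sub_pos.2 hθ1).ne', hb]⟩
  rcases hb.eq_or_lt with rfl | hb
  · exact ⟨0, by simp [Real.zero_rpow hθ.ne', ha.le]⟩
  refine ⟨Real.log b - Real.log a, le_of_eq ?_, le_of_eq ?_⟩
  · rw [Real.rpow_def_of_pos ha, Real.rpow_def_of_pos hb, ← Real.exp_add, ← Real.exp_add]
    conv_rhs => rw [← Real.exp_log ha]
    congr 1; ring
  · rw [Real.rpow_def_of_pos ha, Real.rpow_def_of_pos hb, ← Real.exp_add, ← Real.exp_add]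
    conv_rhs => rw [← Real.exp_log hb]
    congr 1; ring

lemma norm_le_of_strip {f : ℂ → ℂ} {θ B c : ℝ} (hθ : 0 < θ) (hθ1 : θ < 1)
    (hf : ContinuousOn f Strip) (hd : DifferentiableOn ℂ f OStrip)
    (hB : ∀ z ∈ Strip, ‖f z‖ ≤ B) (h₀ : ∀ t : ℝ, ‖f (Complex.I * t)‖ ≤ c)
    (h₁ : ∀ t : ℝ, ‖f (1 + Complex.I * t)‖ ≤ c) : ‖f θ‖ ≤ c := by
  have hc : 0 ≤ c := (norm_nonneg _).trans (h₀ 0)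
  have hcl : closure (Complex.HadamardThreeLines.verticalStrip 0 1) = Strip := by
    rw [Complex.HadamardThreeLines.verticalStrip, Complex.closure_preimage_re,
      closure_Ioo zero_ne_one]
    rfl
  have key := Complex.HadamardThreeLines.norm_le_interp_of_mem_verticalClosedStrip' (f := f)
    (l := 0) (u := 1) (z := (θ : ℂ)) (a := c) (b := c) zero_lt_one
    (by simp [Complex.HadamardThreeLines.verticalClosedStrip, hθ.le, hθ1.le])
    ⟨hd, by rw [hcl]; exact hf⟩
    ⟨B, by rintro _ ⟨z, hz, rfl⟩; exact hB z hz⟩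
    (fun z hz => by
      have hz' : z.re = 0 := hz
      have : z = Complex.I * (z.im : ℝ) := Complex.ext (by simp [hz']) (by simp)
      rw [this]; exact h₀ _)
    (fun z hz => by
      have hz' : z.re = 1 := hz
      have : z = 1 + Complex.I * (z.im : ℝ) := Complex.ext (by simp [hz']) (by simp)
      rw [this]; exact h₁ _)
  refine key.trans (le_of_eq ?_)
  rw [← Real.rpow_add_of_nonneg hc (by simp [hθ1.le]) (by simp [hθ.le])]
  simp

lemma interpN_set_nonempty {D : Type*} [AddCommGroup D] [Module ℂ D] (θ : ℝ) (N₀ N₁ : D → ℝ)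
    (x : D) :
    {c : ℝ | ∃ (m : ℕ) (φ : Fin m → ℂ → ℂ) (v : Fin m → D),
    (∀ i, ContinuousOn (φ i) Strip) ∧
    (∀ i, DifferentiableOn ℂ (φ i) OStrip) ∧
    (∀ i, ∃ B : ℝ, ∀ z ∈ Strip, ‖φ i z‖ ≤ B) ∧
    (∑ i, φ i (θ : ℂ) • v i) = x ∧
    (∀ t : ℝ, N₀ (∑ i, φ i (Complex.I * t) • v i) ≤ c) ∧
    (∀ t : ℝ, N₁ (∑ i, φ i (1 + Complex.I * t) • v i) ≤ c)}.Nonempty :=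
  ⟨max (N₀ x) (N₁ x), 1, fun _ _ => 1, fun _ => x, fun _ => continuousOn_const,
    fun _ => differentiableOn_const _, fun _ => ⟨1, by simp⟩, by simp, by simp, by simp⟩

lemma interpN_le {D ι : Type*} [Fintype ι] [AddCommGroup D] [Module ℂ D] {θ : ℝ} {N₀ N₁ : D → ℝ}
    (hN₀ : ∀ x, 0 ≤ N₀ x) (φ : ι → ℂ → ℂ) (v : ι → D) {c : ℝ}
    (hc : ∀ i, ContinuousOn (φ i) Strip) (hd : ∀ i, DifferentiableOn ℂ (φ i) OStrip)
    (hb : ∀ i, ∃ B : ℝ, ∀ z ∈ Strip, ‖φ i z‖ ≤ B)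
    (h₀ : ∀ t : ℝ, N₀ (∑ i, φ i (Complex.I * t) • v i) ≤ c)
    (h₁ : ∀ t : ℝ, N₁ (∑ i, φ i (1 + Complex.I * t) • v i) ≤ c) :
    interpN θ N₀ N₁ (∑ i, φ i θ • v i) ≤ c := by
  classical
  refine csInf_le ⟨0, ?_⟩ ?_
  · rintro d ⟨m, ψ, u, -, -, -, -, h, -⟩
    exact (hN₀ _).trans (h 0)
  · let e := (Fintype.equivFin ι).symm
    have he (z : ℂ) : ∑ j, φ (e j) z • v (e j) = ∑ i, φ i z • v i :=
      e.sum_comp (fun i => φ i z • v i)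
    refine ⟨Fintype.card ι, fun j => φ (e j), fun j => v (e j), fun j => hc _, fun j => hd _,
      fun j => hb _, he _, fun t => ?_, fun t => ?_⟩
    · rw [he]; exact h₀ t
    · rw [he]; exact h₁ t

lemma norm_cexp_shift_le {θ κ : ℝ} (hθ : 0 < θ) (hθ1 : θ < 1) {z : ℂ} (hz : z ∈ Strip) :
    ‖Complex.exp ((z - θ) * κ)‖ ≤ Real.exp |κ| := by
  rw [Complex.norm_exp]
  refine Real.exp_le_exp.2 ((le_abs_self _).trans ?_)
  have : ((z - θ) * κ).re = (z.re - θ) * κ := by simp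
  rw [this, abs_mul]
  refine mul_le_of_le_one_left (abs_nonneg _) (abs_le.2 ⟨?_, ?_⟩)
  · linarith [hz.1]
  · linarith [hz.2]

lemma norm_sum_apply_le_interpN {V : Type*} [NormedAddCommGroup V] [NormedSpace ℂ V] {n : ℕ}
    {N₀ N₁ : (Fin n → ℝ) → ℝ} {θ : ℝ} (hθ : 0 < θ) (hθ1 : θ < 1) {σ₀ σ₁ : Fin n → ℝ}
    (h₀ : σ₀ ∈ dualBall N₀) (h₁ : σ₁ ∈ dualBall N₁) (x : Fin n → StrongDual ℂ V)
    (hx : ∀ i, ‖x i‖ ≤ σ₀ i ^ (1 - θ) * σ₁ i ^ θ) (v : Fin n → V) :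
    ‖∑ i, x i (v i)‖ ≤
      interpN θ (vecLatNorm N₀ fun v : V => ‖v‖) (vecLatNorm N₁ fun v : V => ‖v‖) v := by
  refine le_csInf (interpN_set_nonempty _ _ _ _) ?_
  rintro c ⟨m, φ, u, hφc, hφd, hφb, rfl, hc₀, hc₁⟩
  choose κ hκ₀ hκ₁ using fun i => exists_exp_interpolation hθ hθ1 (h₀.1 i) (h₁.1 i)
  choose B hB using hφb
  set f : ℂ → ℂ := fun z => ∑ i, Complex.exp ((z - θ) * κ i) * ∑ a, φ a z * x i (u a i) with hf
  have hfx (z : ℂ) : f z = ∑ i, Complex.exp ((z - θ) * κ i) * x i ((∑ a, φ a z • u a) i) := by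
    simp [hf, Finset.sum_apply, smul_eq_mul]
  have hbd {σ : Fin n → ℝ} {N : (Fin n → ℝ) → ℝ} (hσ : σ ∈ dualBall N) (z : ℂ)
      (hz : ∀ i, Real.exp ((z.re - θ) * κ i) * (σ₀ i ^ (1 - θ) * σ₁ i ^ θ) ≤ σ i)
      (hN : vecLatNorm N (fun v : V => ‖v‖) (∑ a, φ a z • u a) ≤ c) : ‖f z‖ ≤ c := by
    rw [hfx]
    refine (norm_sum_le _ _).trans (le_trans ?_ hN)
    refine le_trans (Finset.sum_le_sum fun i _ => ?_)
      (hσ.2 (fun i => ‖(∑ a, φ a z • u a) i‖) fun i => norm_nonneg _)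
    have he : ‖Complex.exp ((z - θ) * κ i)‖ = Real.exp ((z.re - θ) * κ i) := by
      rw [Complex.norm_exp]; simp
    rw [norm_mul, he]
    calc _ ≤ Real.exp ((z.re - θ) * κ i) * (‖x i‖ * ‖(∑ a, φ a z • u a) i‖) := by
          gcongr; exact (x i).le_opNorm _
      _ = (Real.exp ((z.re - θ) * κ i) * ‖x i‖) * ‖(∑ a, φ a z • u a) i‖ := by ring
      _ ≤ _ := by
          gcongr
          exact (mul_le_mul_of_nonneg_left (hx i) (Real.exp_pos _).le).trans (hz i)
  have key : ‖f θ‖ ≤ c := by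
    refine norm_le_of_strip (B := ∑ i, Real.exp |κ i| * ∑ a, B a * ‖x i (u a i)‖) hθ hθ1
      ?_ ?_ ?_ ?_ ?_
    · refine continuousOn_finsetSum _ fun i _ => ContinuousOn.mul (by fun_prop) ?_
      exact continuousOn_finsetSum _ fun a _ => (hφc a).mul continuousOn_const
    · refine DifferentiableOn.fun_sum fun i _ => DifferentiableOn.mul (by fun_prop) ?_
      exact DifferentiableOn.fun_sum fun a _ => (hφd a).mul (differentiableOn_const _)
    · intro z hz
      refine (norm_sum_le _ _).trans (Finset.sum_le_sum fun i _ => ?_)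
      rw [norm_mul]
      refine mul_le_mul (norm_cexp_shift_le hθ hθ1 hz) ?_ (norm_nonneg _) (Real.exp_pos _).le
      refine (norm_sum_le _ _).trans (Finset.sum_le_sum fun a _ => ?_)
      rw [norm_mul]
      exact mul_le_mul_of_nonneg_right (hB a z hz) (norm_nonneg _)
    · refine fun t => hbd h₀ _ (fun i => ?_) (hc₀ t)
      simpa using hκ₀ i
    · refine fun t => hbd h₁ _ (fun i => ?_) (hc₁ t)
      simpa using hκ₁ i
  rw [hfx] at key
  simpa using key

end ThreeLines

section TensorForms

lemma exists_norm_mul_norm_sub_le {V : Type*} [NormedAddCommGroup V] [NormedSpace ℂ V]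
    (x : StrongDual ℂ V) {ε : ℝ} (hε : 0 < ε) :
    ∃ u : V, ‖u‖ ≤ 1 ∧ ∃ r : ℝ, x u = r ∧ ‖x‖ - ε ≤ r := by
  obtain ⟨u, hu, hu'⟩ := x.exists_lt_apply_of_lt_opNorm (sub_lt_self _ hε)
  obtain ⟨c, hc, hcu⟩ := RCLike.exists_norm_eq_mul_self (x u)
  exact ⟨c • u, by rw [norm_smul, hc, one_mul]; exact hu.le, ‖x u‖, by simpa using hcu.symm, hu'.le⟩

/-- The functional on `Vⁿ` with given coordinate functionals. -/
def coordForm (V : Type*) [NormedAddCommGroup V] [NormedSpace ℂ V] (n : ℕ) :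
    (Fin n → StrongDual ℂ V) →ₗ[ℂ] (Fin n → V) →ₗ[ℂ] ℂ :=
  LinearMap.mk₂ ℂ (fun x v => ∑ i, x i (v i))
    (fun x y v => by simp [Finset.sum_add_distrib]) (fun c x v => by simp [Finset.mul_sum])
    (fun x v w => by simp [Finset.sum_add_distrib]) (fun c x v => by simp [Finset.mul_sum])

variable {V W : Type*} [NormedAddCommGroup V] [NormedSpace ℂ V]
  [NormedAddCommGroup W] [NormedSpace ℂ W] {n m : ℕ}

lemma coordForm_apply (x : Fin n → StrongDual ℂ V) (v : Fin n → V) :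
    coordForm V n x v = ∑ i, x i (v i) := rfl

lemma coordForm_single [FiniteDimensional ℂ V] (φ : (Fin n → V) →ₗ[ℂ] ℂ) :
    coordForm V n (fun i => (φ ∘ₗ LinearMap.single ℂ (fun _ => V) i).toContinuousLinearMap) = φ := by
  refine LinearMap.ext fun v => ?_
  conv_rhs => rw [← LinearMap.sum_single_apply (fun _ => V) v]
  simp [coordForm_apply]

lemma norm_single_mem_dualBall [FiniteDimensional ℂ V] {N : (Fin n → ℝ) → ℝ} (hN : IsLatticeNorm N)
    (φ : (Fin n → V) →ₗ[ℂ] ℂ) (hφ : ∀ v, ‖φ v‖ ≤ vecLatNorm N (fun v : V => ‖v‖) v) :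
    (fun i => ‖(φ ∘ₗ LinearMap.single ℂ (fun _ => V) i).toContinuousLinearMap‖) ∈ dualBall N := by
  set x : Fin n → StrongDual ℂ V :=
    fun i => (φ ∘ₗ LinearMap.single ℂ (fun _ => V) i).toContinuousLinearMap with hx
  refine ⟨fun i => norm_nonneg _, fun t ht => ?_⟩
  have hφx (v : Fin n → V) : φ v = ∑ i, x i (v i) := by
    conv_lhs => rw [← coordForm_single φ]
    rfl
  have hS : 0 ≤ ∑ i, t i := Finset.sum_nonneg fun i _ => ht i
  refine le_of_forall_pos_le_add fun δ hδ => ?_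
  have hε : 0 < δ / (∑ i, t i + 1) := by positivity
  choose u hu r hr hr' using fun i => exists_norm_mul_norm_sub_le (x i) hε
  have h1 : ∑ i, (‖x i‖ - δ / (∑ i, t i + 1)) * t i ≤ N t := by
    calc _ ≤ ∑ i, r i * t i :=
          Finset.sum_le_sum fun i _ => mul_le_mul_of_nonneg_right (hr' i) (ht i)
      _ ≤ ‖φ fun i => (t i : ℂ) • u i‖ := by
          rw [hφx]
          simp only [map_smul, hr, smul_eq_mul]
          refine (le_abs_self _).trans (le_of_eq ?_)
          rw [← Real.norm_eq_abs, ← Complex.norm_real]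
          push_cast
          simp only [mul_comm]
      _ ≤ _ := hφ _
      _ ≤ N t := hN.2.2.2.2 _ _ fun i => by
          rw [abs_norm, norm_smul, Complex.norm_real, Real.norm_eq_abs]
          exact mul_le_of_le_one_right (abs_nonneg _) (hu i)
  have h2 : δ / (∑ i, t i + 1) * ∑ i, t i ≤ δ := by
    rw [div_mul_eq_mul_div]
    exact div_le_of_le_mul₀ (by positivity) hδ.le (by nlinarith)
  simp only [sub_mul, Finset.sum_sub_distrib, ← Finset.mul_sum] at h1
  linarith

/-- The bilinear form on the coordinate functionals induced by a tensor. -/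
def tensorForm (z : TensorProduct ℂ (Fin n → V) (Fin m → W)) :
    (Fin n → StrongDual ℂ V) →ₗ[ℂ] (Fin m → StrongDual ℂ W) →ₗ[ℂ] ℂ :=
  LinearMap.mk₂ ℂ (fun x y => TensorProduct.lift
      (((LinearMap.mul ℂ ℂ).comp (coordForm V n x)).compl₂ (coordForm W m y)) z)
    (fun x x' y => by
      induction z with
      | zero => simp
      | tmul v w => simp
      | add z z' h h' =>
        simp only [map_add] at h h' ⊢
        rw [h, h']; ring)
    (fun c x y => by
      induction z with
      | zero => simp
      | tmul v w => simp [mul_assoc]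
      | add z z' h h' => rw [map_add, map_add, h, h', smul_add])
    (fun x y y' => by
      induction z with
      | zero => simp
      | tmul v w => simp [mul_add]
      | add z z' h h' =>
        simp only [map_add] at h h' ⊢
        rw [h, h']; ring)
    (fun c x y => by
      induction z with
      | zero => simp
      | tmul v w => simp [mul_left_comm]
      | add z z' h h' => rw [map_add, map_add, h, h', smul_add])

lemma tensorForm_apply (z : TensorProduct ℂ (Fin n → V) (Fin m → W)) (x : Fin n → StrongDual ℂ V)
    (y : Fin m → StrongDual ℂ W) :
    tensorForm z x y = TensorProduct.lift
      (((LinearMap.mul ℂ ℂ).comp (coordForm V n x)).compl₂ (coordForm W m y)) z := rfl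

/-- Coordinatewise multiplication on `Vⁿ`. -/
def diagMap (V : Type*) [AddCommGroup V] [Module ℂ V] (a : Fin n → ℂ) :
    (Fin n → V) →ₗ[ℂ] (Fin n → V) :=
  LinearMap.pi fun i => a i • LinearMap.proj i

lemma diagMap_apply (a : Fin n → ℂ) (v : Fin n → V) (i : Fin n) :
    diagMap V a v i = a i • v i := rfl

lemma diagMap_single_sum (a : Fin n → ℂ) :
    diagMap V a = ∑ i, a i • diagMap V (Pi.single i 1 : Fin n → ℂ) := by
  ext v i j
  simp [diagMap_apply, Finset.sum_apply, Pi.single_apply, ite_smul]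

lemma diagMap_one : diagMap V (1 : Fin n → ℂ) = LinearMap.id := by
  ext v i j
  simp [diagMap_apply]

lemma sum_smul_map_diagMap (a : Fin n → ℂ) (b : Fin m → ℂ)
    (z : TensorProduct ℂ (Fin n → V) (Fin m → W)) :
    ∑ p : Fin n × Fin m, (a p.1 * b p.2) • TensorProduct.map
      (diagMap V (Pi.single p.1 1 : Fin n → ℂ)) (diagMap W (Pi.single p.2 1 : Fin m → ℂ)) z =
    TensorProduct.map (diagMap V a) (diagMap W b) z := by
  rw [diagMap_single_sum a, diagMap_single_sum b]
  induction z with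
  | zero => simp
  | tmul v w =>
    simp only [TensorProduct.map_tmul, LinearMap.sum_apply, LinearMap.smul_apply,
      TensorProduct.sum_tmul, TensorProduct.tmul_sum, TensorProduct.smul_tmul_smul]
    rw [Fintype.sum_prod_type, Finset.sum_comm]
  | add z z' h h' => simp only [map_add, smul_add, Finset.sum_add_distrib, h, h']

lemma tensorForm_map_diagMap (a : Fin n → ℂ) (b : Fin m → ℂ)
    (z : TensorProduct ℂ (Fin n → V) (Fin m → W)) (x : Fin n → StrongDual ℂ V)
    (y : Fin m → StrongDual ℂ W) :
    tensorForm (TensorProduct.map (diagMap V a) (diagMap W b) z) x y =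
      tensorForm z (fun i => a i • x i) (fun j => b j • y j) := by
  simp only [tensorForm_apply]
  induction z with
  | zero => simp
  | tmul v w => simp [coordForm_apply, diagMap_apply]
  | add z z' h h' => rw [map_add, map_add, map_add, h, h']

lemma bddAbove_injN {V W : Type*} [AddCommGroup V] [Module ℂ V] [AddCommGroup W] [Module ℂ W]
    (NV : V → ℝ) (NW : W → ℝ) (z : TensorProduct ℂ V W) :
    BddAbove {r : ℝ | ∃ (φ : V →ₗ[ℂ] ℂ) (ψ : W →ₗ[ℂ] ℂ),
      (∀ x, ‖φ x‖ ≤ NV x) ∧ (∀ y, ‖ψ y‖ ≤ NW y) ∧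
      r = ‖TensorProduct.lift (((LinearMap.mul ℂ ℂ).comp φ).compl₂ ψ) z‖} := by
  obtain ⟨k, v, w, rfl⟩ := TensorProduct.exists_sum_tmul_eq z
  refine ⟨∑ a, NV (v a) * NW (w a), ?_⟩
  rintro _ ⟨φ, ψ, hφ, hψ, rfl⟩
  rw [map_sum]
  refine (norm_sum_le _ _).trans (Finset.sum_le_sum fun a _ => ?_)
  simp only [TensorProduct.lift.tmul, LinearMap.compl₂_apply, LinearMap.comp_apply,
    LinearMap.mul_apply', norm_mul]
  exact mul_le_mul (hφ _) (hψ _) (norm_nonneg _) ((norm_nonneg _).trans (hφ _))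

lemma injN_nonneg {V W : Type*} [AddCommGroup V] [Module ℂ V] [AddCommGroup W] [Module ℂ W]
    (NV : V → ℝ) (NW : W → ℝ) (z : TensorProduct ℂ V W) : 0 ≤ injN NV NW z :=
  Real.sSup_nonneg fun _ ⟨_, _, _, _, h⟩ => h ▸ norm_nonneg _

lemma exists_orthBound_tensorForm (z : TensorProduct ℂ (Fin n → V) (Fin m → W))
    (σ : Fin n → ℝ) (τ : Fin m → ℝ) : ∃ c, OrthBound (tensorForm z) σ τ c := by
  obtain ⟨k, v, w, hz⟩ := TensorProduct.exists_sum_tmul_eq z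
  refine exists_orthBound (fun a x => coordForm V n x (v a)) (fun a y => coordForm W m y (w a))
    (fun a i => ‖v a i‖) (fun a j => ‖w a j‖) (fun a x => ?_) (fun a y => ?_) fun x y => ?_
  · rw [coordForm_apply]
    refine (norm_sum_le _ _).trans (Finset.sum_le_sum fun i _ => ?_)
    rw [mul_comm]; exact (x i).le_opNorm _
  · rw [coordForm_apply]
    refine (norm_sum_le _ _).trans (Finset.sum_le_sum fun i _ => ?_)
    rw [mul_comm]; exact (y i).le_opNorm _
  · rw [tensorForm_apply, hz, map_sum]
    rfl

end TensorForms

section NormedFibres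

variable {V W : Type*} [NormedAddCommGroup V] [NormedSpace ℂ V]
  [NormedAddCommGroup W] [NormedSpace ℂ W] {n m : ℕ}
  {X₀ X₁ : (Fin n → ℝ) → ℝ} {Y₀ Y₁ : (Fin m → ℝ) → ℝ} {θ : ℝ}

lemma norm_tensorForm_le_one (hθ : 0 < θ) (hθ1 : θ < 1)
    {z : TensorProduct ℂ (Fin n → V) (Fin m → W)}
    (hz : injN (interpN θ (vecLatNorm X₀ fun v : V => ‖v‖) (vecLatNorm X₁ fun v : V => ‖v‖))
      (interpN θ (vecLatNorm Y₀ fun w : W => ‖w‖) (vecLatNorm Y₁ fun w : W => ‖w‖)) z ≤ 1)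
    {σ₀ σ₁ : Fin n → ℝ} (hσ₀ : σ₀ ∈ dualBall X₀) (hσ₁ : σ₁ ∈ dualBall X₁)
    {τ₀ τ₁ : Fin m → ℝ} (hτ₀ : τ₀ ∈ dualBall Y₀) (hτ₁ : τ₁ ∈ dualBall Y₁)
    (x : Fin n → StrongDual ℂ V) (y : Fin m → StrongDual ℂ W)
    (hx : ∀ i, ‖x i‖ ≤ σ₀ i ^ (1 - θ) * σ₁ i ^ θ)
    (hy : ∀ j, ‖y j‖ ≤ τ₀ j ^ (1 - θ) * τ₁ j ^ θ) : ‖tensorForm z x y‖ ≤ 1 :=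
  (le_csSup (bddAbove_injN _ _ z) ⟨coordForm V n x, coordForm W m y,
    norm_sum_apply_le_interpN hθ hθ1 hσ₀ hσ₁ x hx,
    norm_sum_apply_le_interpN hθ hθ1 hτ₀ hτ₁ y hy, rfl⟩).trans hz

lemma injN_map_diagMap_le [FiniteDimensional ℂ V] [FiniteDimensional ℂ W]
    (hX : IsLatticeNorm X₀) (hY : IsLatticeNorm Y₀)
    (z : TensorProduct ℂ (Fin n → V) (Fin m → W)) {K : ℝ} (hK : 0 ≤ K)
    {w u : Fin n → ℝ} {w' u' : Fin m → ℝ}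
    (hw : w ∈ weightSet X₀) (hw' : w' ∈ weightSet Y₀)
    (hT : ∀ x y, ‖tensorForm z x y‖ ≤
      K / 2 * (∑ i, u i * ‖x i‖ ^ 2 + ∑ j, u' j * ‖y j‖ ^ 2))
    (a : Fin n → ℂ) (b : Fin m → ℂ)
    (ha : ∀ i, ‖a i‖ ^ 2 * u i ≤ w i) (hb : ∀ j, ‖b j‖ ^ 2 * u' j ≤ w' j) :
    injN (vecLatNorm X₀ fun v : V => ‖v‖) (vecLatNorm Y₀ fun v : W => ‖v‖)
      (TensorProduct.map (diagMap V a) (diagMap W b) z) ≤ K := by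
  refine Real.sSup_le ?_ hK
  rintro _ ⟨φ, ψ, hφ, hψ, rfl⟩
  have hx := norm_single_mem_dualBall hX φ hφ
  have hy := norm_single_mem_dualBall hY ψ hψ
  set x : Fin n → StrongDual ℂ V :=
    fun i => (φ ∘ₗ LinearMap.single ℂ (fun _ => V) i).toContinuousLinearMap
  set y : Fin m → StrongDual ℂ W :=
    fun i => (ψ ∘ₗ LinearMap.single ℂ (fun _ => W) i).toContinuousLinearMap
  rw [← coordForm_single φ, ← coordForm_single ψ, ← tensorForm_apply, tensorForm_map_diagMap]
  refine (hT _ _).trans ?_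
  have h1 : ∑ i, u i * ‖a i • x i‖ ^ 2 ≤ 1 := by
    refine le_trans (Finset.sum_le_sum fun i _ => ?_) (hw.2 _ hx)
    rw [norm_smul, mul_pow, ← mul_assoc, mul_comm (u i)]
    exact mul_le_mul_of_nonneg_right (ha i) (sq_nonneg _)
  have h2 : ∑ i, u' i * ‖b i • y i‖ ^ 2 ≤ 1 := by
    refine le_trans (Finset.sum_le_sum fun i _ => ?_) (hw'.2 _ hy)
    rw [norm_smul, mul_pow, ← mul_assoc, mul_comm (u' i)]
    exact mul_le_mul_of_nonneg_right (hb i) (sq_nonneg _)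
  calc _ ≤ K / 2 * (1 + 1) := by gcongr
    _ = K := by ring

lemma exists_analytic_weights (hθ : 0 < θ) (hθ1 : θ < 1) {w₀ w₁ : Fin n → ℝ}
    (h₀ : ∀ i, 0 ≤ w₀ i) (h₁ : ∀ i, 0 ≤ w₁ i) :
    ∃ α : Fin n → ℂ → ℂ, (∀ i, Differentiable ℂ (α i)) ∧
      (∀ i, ∃ B : ℝ, ∀ z ∈ Strip, ‖α i z‖ ≤ B) ∧ (∀ i, α i θ = 1) ∧
      (∀ i, ∀ t : ℝ, ‖α i (Complex.I * t)‖ ^ 2 * (w₀ i ^ (1 - θ) * w₁ i ^ θ) ≤ w₀ i) ∧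
      (∀ i, ∀ t : ℝ, ‖α i (1 + Complex.I * t)‖ ^ 2 * (w₀ i ^ (1 - θ) * w₁ i ^ θ) ≤ w₁ i) := by
  choose κ hκ₀ hκ₁ using fun i => exists_exp_interpolation hθ hθ1 (h₀ i) (h₁ i)
  have hn (i : Fin n) (z : ℂ) : ‖Complex.exp ((z - θ) * (κ i / 2 : ℝ))‖ ^ 2 =
      Real.exp ((z.re - θ) * κ i) := by
    rw [Complex.norm_exp, ← Real.exp_nat_mul]
    congr 1
    rw [Complex.re_mul_ofReal, Complex.sub_re, Complex.ofReal_re]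
    push_cast
    ring
  refine ⟨fun i z => Complex.exp ((z - θ) * (κ i / 2 : ℝ)), fun i => by fun_prop,
    fun i => ⟨_, fun z hz => norm_cexp_shift_le hθ hθ1 hz⟩, fun i => by simp,
    fun i t => ?_, fun i t => ?_⟩
  · rw [hn]; simpa using hκ₀ i
  · rw [hn]; simpa using hκ₁ i

lemma interpN_injN_le [FiniteDimensional ℂ V] [FiniteDimensional ℂ W]
    (hX₀ : IsLatticeNorm X₀) (hX₁ : IsLatticeNorm X₁)
    (hY₀ : IsLatticeNorm Y₀) (hY₁ : IsLatticeNorm Y₁)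
    {A₀ A₁ B₀ B₁ : ℝ} (hA₀ : 0 < A₀) (hA₁ : 0 < A₁) (hB₀ : 0 < B₀) (hB₁ : 0 < B₁)
    (hcX₀ : ConcaveWith 2 A₀ X₀) (hcX₁ : ConcaveWith 2 A₁ X₁)
    (hcY₀ : ConcaveWith 2 B₀ Y₀) (hcY₁ : ConcaveWith 2 B₁ Y₁)
    (hθ : 0 < θ) (hθ1 : θ < 1) {C D : ℝ} (hC : 1 ≤ C) (hD : 1 ≤ D)
    (hV : Cotype2With (fun v : V => ‖v‖) C) (hW : Cotype2With (fun w : W => ‖w‖) D)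
    (z : TensorProduct ℂ (Fin n → V) (Fin m → W))
    (hz : injN (interpN θ (vecLatNorm X₀ fun v : V => ‖v‖) (vecLatNorm X₁ fun v : V => ‖v‖))
      (interpN θ (vecLatNorm Y₀ fun w : W => ‖w‖) (vecLatNorm Y₁ fun w : W => ‖w‖)) z ≤ 1) :
    interpN θ (injN (vecLatNorm X₀ fun v : V => ‖v‖) (vecLatNorm Y₀ fun w : W => ‖w‖))
      (injN (vecLatNorm X₁ fun v : V => ‖v‖) (vecLatNorm Y₁ fun w : W => ‖w‖)) z ≤
      (A₀ ^ (1 - θ) * A₁ ^ θ) * (B₀ ^ (1 - θ) * B₁ ^ θ) * (6 * C * D * √(6 * C * D)) := by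
  obtain ⟨w₀, hw₀, w₁, hw₁, v₀, hv₀, v₁, hv₁, hdom⟩ :=
    exists_quadratic_domination (tensorForm z) hX₀ hX₁ hY₀ hY₁ hA₀ hA₁ hB₀ hB₁ hcX₀ hcX₁ hcY₀ hcY₁
      hθ hθ1 (c := 6 * C * D * √(6 * C * D)) (by positivity) fun σ₀ hσ₀ σ₁ hσ₁ τ₀ hτ₀ τ₁ hτ₁ => by
        obtain ⟨c, hc⟩ := exists_orthBound_tensorForm z
          (fun i => σ₀ i ^ (1 - θ) * σ₁ i ^ θ) (fun j => τ₀ j ^ (1 - θ) * τ₁ j ^ θ)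
        exact hc.bootstrap (norm_tensorForm_le_one hθ hθ1 hz hσ₀ hσ₁ hτ₀ hτ₁)
          (fun i => mul_nonneg (Real.rpow_nonneg (hσ₀.1 i) _) (Real.rpow_nonneg (hσ₁.1 i) _))
          (fun i => mul_nonneg (Real.rpow_nonneg (hτ₀.1 i) _) (Real.rpow_nonneg (hτ₁.1 i) _))
          hC hD hV hW
  set K := (A₀ ^ (1 - θ) * A₁ ^ θ) * (B₀ ^ (1 - θ) * B₁ ^ θ) * (6 * C * D * √(6 * C * D)) with hKdef
  have hK : 0 ≤ K := by positivity
  have hnorm (x : Fin n → StrongDual ℂ V) (y : Fin m → StrongDual ℂ W) : ‖tensorForm z x y‖ ≤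
      K / 2 * (∑ i, w₀ i ^ (1 - θ) * w₁ i ^ θ * ‖x i‖ ^ 2 +
        ∑ j, v₀ j ^ (1 - θ) * v₁ j ^ θ * ‖y j‖ ^ 2) := by
    obtain ⟨c, hc, hcT⟩ := RCLike.exists_norm_eq_mul_self (tensorForm z x y)
    have := hdom (c • x) y
    rw [map_smul, LinearMap.smul_apply, smul_eq_mul, ← hcT] at this
    simpa [norm_smul, hc] using this
  obtain ⟨α, hαd, hαb, hαθ, hα₀, hα₁⟩ := exists_analytic_weights hθ hθ1 hw₀.1 hw₁.1
  obtain ⟨β, hβd, hβb, hβθ, hβ₀, hβ₁⟩ := exists_analytic_weights hθ hθ1 hv₀.1 hv₁.1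
  have hzsum : ∑ p : Fin n × Fin m, (α p.1 θ * β p.2 θ) • TensorProduct.map
      (diagMap V (Pi.single p.1 1 : Fin n → ℂ)) (diagMap W (Pi.single p.2 1 : Fin m → ℂ)) z = z := by
    rw [sum_smul_map_diagMap (fun i => α i θ) (fun j => β j θ) z]
    simp only [hαθ, hβθ]
    have h1 := diagMap_one (V := V) (n := n)
    have h2 := diagMap_one (V := W) (n := m)
    simp only [Pi.one_def] at h1 h2
    rw [h1, h2, TensorProduct.map_id, LinearMap.id_apply]
  rw [← hzsum]
  refine interpN_le (injN_nonneg _ _) (fun (p : Fin n × Fin m) ζ => α p.1 ζ * β p.2 ζ) _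
    (fun p => ((hαd p.1).mul (hβd p.2)).continuous.continuousOn)
    (fun p => ((hαd p.1).mul (hβd p.2)).differentiableOn) (fun p => ?_) (fun t => ?_) (fun t => ?_)
  · obtain ⟨B, hB⟩ := hαb p.1
    obtain ⟨B', hB'⟩ := hβb p.2
    refine ⟨B * B', fun ζ hζ => ?_⟩
    rw [norm_mul]
    exact mul_le_mul (hB ζ hζ) (hB' ζ hζ) (norm_nonneg _) ((norm_nonneg _).trans (hB ζ hζ))
  · rw [sum_smul_map_diagMap (fun i => α i (Complex.I * t)) (fun j => β j (Complex.I * t)) z]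
    exact injN_map_diagMap_le hX₀ hY₀ z hK hw₀ hv₀ hnorm _ _ (fun i => hα₀ i t) fun j => hβ₀ j t
  · rw [sum_smul_map_diagMap (fun i => α i (1 + Complex.I * t))
      (fun j => β j (1 + Complex.I * t)) z]
    exact injN_map_diagMap_le hX₁ hY₁ z hK hw₁ hv₁ hnorm _ _ (fun i => hα₁ i t) fun j => hβ₁ j t

end NormedFibres

section Transfer

lemma injN_zero_le {V W : Type*} [AddCommGroup V] [Module ℂ V] [AddCommGroup W] [Module ℂ W]
    (NV : V → ℝ) (NW : W → ℝ) : injN NV NW 0 ≤ 0 := by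
  refine Real.sSup_le ?_ le_rfl
  rintro _ ⟨φ, ψ, -, -, rfl⟩
  simp

lemma interpN_injN_zero_le {V W : Type*} [AddCommGroup V] [Module ℂ V] [AddCommGroup W]
    [Module ℂ W] (θ : ℝ) (NV₀ NV₁ : V → ℝ) (NW₀ NW₁ : W → ℝ) :
    interpN θ (injN NV₀ NW₀) (injN NV₁ NW₁) 0 ≤ 0 := by
  have h := interpN_le (θ := θ) (N₀ := injN NV₀ NW₀) (N₁ := injN NV₁ NW₁) (c := 0)
    (injN_nonneg _ _) (fun (i : Fin 0) _ => i.elim0) (fun i => i.elim0) (fun i => i.elim0)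
    (fun i => i.elim0) (fun i => i.elim0) (fun t => by simpa using injN_zero_le NV₀ NW₀)
    (fun t => by simpa using injN_zero_le NV₁ NW₁)
  simpa using h

lemma ConcaveWith.one_le {n : ℕ} {N : (Fin n → ℝ) → ℝ} {M : ℝ} (h : ConcaveWith 2 M N)
    (hN : IsLatticeNorm N) (i : Fin n) : 1 ≤ M := by
  have hp := hN.single_pos i
  have := h.sqrt_sum_sq_le (fun _ : Fin 1 => (Pi.single i 1 : Fin n → ℝ))
  have hs : (fun j => √(∑ _ : Fin 1, (Pi.single i 1 : Fin n → ℝ) j ^ 2)) = Pi.single i 1 := by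
    ext j
    rcases eq_or_ne j i with rfl | hj <;> simp [*]
  rw [hs] at this
  simp only [Finset.univ_unique, Finset.sum_const, Finset.card_singleton, one_smul,
    Real.sqrt_sq hp.le] at this
  exact le_of_mul_le_mul_right (by simpa using this) hp

lemma Cotype2With.one_le {V : Type*} [AddCommGroup V] [Module ℂ V] {N : V → ℝ} {C : ℝ}
    (h : Cotype2With N C) (hN : IsNormC N) {v : V} (hv : v ≠ 0) : 1 ≤ C := by
  have hp : 0 < N v := lt_of_le_of_ne (hN.1 v) fun h0 => hv (hN.2.1 v h0.symm)
  have hneg : N (-v) = N v := by simpa using hN.2.2.1 (-1) v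
  have hrad : radAvg N (fun _ : Fin 1 => v) = N v ^ 2 := by
    have (ε : Fin 1 → Bool) : N (∑ i, if ε i then v else -v) = N v := by
      rw [Fin.sum_univ_one]
      split_ifs <;> simp [hneg]
    simp only [radAvg, this]
    simp
  have := h 1 fun _ => v
  rw [hrad] at this
  simp only [Finset.univ_unique, Finset.sum_const, Finset.card_singleton, one_smul,
    Real.sqrt_sq hp.le] at this
  exact le_of_mul_le_mul_right (by simpa using this) hp

/-- The norm associated with a norm function. -/
abbrev IsNormC.toNorm {V : Type*} [AddCommGroup V] [Module ℂ V] {N : V → ℝ} (_ : IsNormC N) :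
    Norm V := ⟨N⟩

lemma IsNormC.core {V : Type*} [AddCommGroup V] [Module ℂ V] {N : V → ℝ} (h : IsNormC N) :
    letI := h.toNorm
    NormedSpace.Core ℂ V :=
  letI := h.toNorm
  { norm_nonneg := h.1
    norm_smul := h.2.2.1
    norm_triangle := h.2.2.2
    norm_eq_zero_iff := fun x => ⟨h.2.1 x, fun hx => by
      have := h.2.2.1 0 x
      rw [zero_smul, norm_zero, zero_mul] at this
      rw [hx]; exact this⟩ }

lemma interpN_injN_le_of_isNormC {V W : Type*} [AddCommGroup V] [Module ℂ V]
    [AddCommGroup W] [Module ℂ W] [FiniteDimensional ℂ V] [FiniteDimensional ℂ W] {n m : ℕ}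
    {X₀ X₁ : (Fin n → ℝ) → ℝ} {Y₀ Y₁ : (Fin m → ℝ) → ℝ} {θ : ℝ}
    (hX₀ : IsLatticeNorm X₀) (hX₁ : IsLatticeNorm X₁)
    (hY₀ : IsLatticeNorm Y₀) (hY₁ : IsLatticeNorm Y₁)
    {A₀ A₁ B₀ B₁ : ℝ} (hA₀ : 0 < A₀) (hA₁ : 0 < A₁) (hB₀ : 0 < B₀) (hB₁ : 0 < B₁)
    (hcX₀ : ConcaveWith 2 A₀ X₀) (hcX₁ : ConcaveWith 2 A₁ X₁)
    (hcY₀ : ConcaveWith 2 B₀ Y₀) (hcY₁ : ConcaveWith 2 B₁ Y₁)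
    (hθ : 0 < θ) (hθ1 : θ < 1) {C D : ℝ} (hC : 1 ≤ C) (hD : 1 ≤ D)
    {NE : V → ℝ} {NF : W → ℝ} (hE : IsNormC NE) (hF : IsNormC NF)
    (hV : Cotype2With NE C) (hW : Cotype2With NF D)
    (z : TensorProduct ℂ (Fin n → V) (Fin m → W))
    (hz : injN (interpN θ (vecLatNorm X₀ NE) (vecLatNorm X₁ NE))
      (interpN θ (vecLatNorm Y₀ NF) (vecLatNorm Y₁ NF)) z ≤ 1) :
    interpN θ (injN (vecLatNorm X₀ NE) (vecLatNorm Y₀ NF))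
      (injN (vecLatNorm X₁ NE) (vecLatNorm Y₁ NF)) z ≤
      (A₀ ^ (1 - θ) * A₁ ^ θ) * (B₀ ^ (1 - θ) * B₁ ^ θ) * (6 * C * D * √(6 * C * D)) := by
  let := hE.toNorm
  let := hF.toNorm
  let := NormedAddCommGroup.ofCore hE.core
  let := NormedAddCommGroup.ofCore hF.core
  let := NormedSpace.ofCore hE.core
  let := NormedSpace.ofCore hF.core
  exact interpN_injN_le hX₀ hX₁ hY₀ hY₁ hA₀ hA₁ hB₀ hB₁ hcX₀ hcX₁ hcY₀ hcY₁ hθ hθ1 hC hD hV hW z hz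

lemma six_mul_sqrt_le {C D : ℝ} (hC : 1 ≤ C) (hD : 1 ≤ D) :
    6 * C * D * √(6 * C * D) ≤ 16 * C ^ ((5 : ℝ) / 2) * D ^ ((5 : ℝ) / 2) := by
  have hu : 1 ≤ C * D := one_le_mul_of_one_le_of_one_le hC hD
  have hpow : C ^ ((5 : ℝ) / 2) * D ^ ((5 : ℝ) / 2) = (C * D) ^ 2 * √(C * D) := by
    rw [← Real.mul_rpow (by linarith) (by linarith), Real.sqrt_eq_rpow, ← Real.rpow_natCast,
      ← Real.rpow_add (by linarith)]
    norm_num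
  have h6 : √(6 * C * D) ≤ 8 / 3 * √(C * D) := by
    rw [mul_assoc 6, Real.sqrt_mul (by norm_num)]
    refine mul_le_mul_of_nonneg_right ?_ (Real.sqrt_nonneg _)
    rw [Real.sqrt_le_left (by norm_num)]
    norm_num
  rw [mul_assoc 16, hpow]
  calc 6 * C * D * √(6 * C * D) ≤ 6 * C * D * (8 / 3 * √(C * D)) := by gcongr
    _ = 16 * ((C * D) * √(C * D)) := by ring
    _ ≤ 16 * ((C * D) ^ 2 * √(C * D)) := by
      gcongr
      exact le_self_pow₀ hu two_ne_zero

end Transfer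

/-- Proposition 8, cotype-2 case:
`d_θ[X₀(E),X₁(E);Y₀(F),Y₁(F)] ≤ 16·[(M_(2)(X₀)M_(2)(Y₀))^{1-θ}(M_(2)(X₁)M_(2)(Y₁))^θ]^{5/2}·C₂(E)^{5/2}·C₂(F)^{5/2}`. -/
theorem statement19 {n m k l : ℕ} (θ : ℝ) (hθ : 0 < θ) (hθ1 : θ < 1)
    (NX₀ NX₁ : (Fin n → ℝ) → ℝ) (NY₀ NY₁ : (Fin m → ℝ) → ℝ)
    (hX₀ : IsLatticeNorm NX₀) (hX₁ : IsLatticeNorm NX₁)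
    (hY₀ : IsLatticeNorm NY₀) (hY₁ : IsLatticeNorm NY₁)
    (MX₀ MX₁ MY₀ MY₁ : ℝ) (hMX₀ : 0 ≤ MX₀) (hMX₁ : 0 ≤ MX₁)
    (hMY₀ : 0 ≤ MY₀) (hMY₁ : 0 ≤ MY₁)
    (hcX₀ : ConcaveWith 2 MX₀ NX₀) (hcX₁ : ConcaveWith 2 MX₁ NX₁)
    (hcY₀ : ConcaveWith 2 MY₀ NY₀) (hcY₁ : ConcaveWith 2 MY₁ NY₁)
    (NE : (Fin k → ℂ) → ℝ) (NF : (Fin l → ℂ) → ℝ)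
    (hE : IsNormC NE) (hF : IsNormC NF)
    (CE CF : ℝ) (hCE : 0 ≤ CE) (hCF : 0 ≤ CF)
    (hcotE : Cotype2With NE CE) (hcotF : Cotype2With NF CF) :
    sSup {r : ℝ | ∃ z : TensorProduct ℂ (Fin n → Fin k → ℂ) (Fin m → Fin l → ℂ),
        injN (interpN θ (vecLatNorm NX₀ NE) (vecLatNorm NX₁ NE))
          (interpN θ (vecLatNorm NY₀ NF) (vecLatNorm NY₁ NF)) z ≤ 1 ∧
        r = interpN θ (injN (vecLatNorm NX₀ NE) (vecLatNorm NY₀ NF))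
          (injN (vecLatNorm NX₁ NE) (vecLatNorm NY₁ NF)) z} ≤
      16 * ((MX₀ * MY₀) ^ (1 - θ) * (MX₁ * MY₁) ^ θ) ^ ((5 : ℝ) / 2) *
        CE ^ ((5 : ℝ) / 2) * CF ^ ((5 : ℝ) / 2) := by
  refine Real.sSup_le ?_ (by positivity)
  rintro _ ⟨z, hz, rfl⟩
  by_cases hVn : Nonempty (Fin n) ∧ Nonempty (Fin k) ∧ Nonempty (Fin m) ∧ Nonempty (Fin l)
  · obtain ⟨⟨i⟩, ⟨a⟩, ⟨j⟩, ⟨b⟩⟩ := hVn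
    have hC : 1 ≤ CE := hcotE.one_le hE (v := Pi.single a 1) (by simp)
    have hD : 1 ≤ CF := hcotF.one_le hF (v := Pi.single b 1) (by simp)
    have h1 := hcX₀.one_le hX₀ i
    have h2 := hcX₁.one_le hX₁ i
    have h3 := hcY₀.one_le hY₀ j
    have h4 := hcY₁.one_le hY₁ j
    refine (interpN_injN_le_of_isNormC hX₀ hX₁ hY₀ hY₁ (by positivity) (by positivity)
      (by positivity) (by positivity) hcX₀ hcX₁ hcY₀ hcY₁ hθ hθ1 hC hD hE hF hcotE hcotF z hz).trans ?_
    have hP : 1 ≤ (MX₀ * MY₀) ^ (1 - θ) * (MX₁ * MY₁) ^ θ :=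
      one_le_mul_of_one_le_of_one_le
        (Real.one_le_rpow (one_le_mul_of_one_le_of_one_le h1 h3) (by linarith))
        (Real.one_le_rpow (one_le_mul_of_one_le_of_one_le h2 h4) hθ.le)
    have hPeq : (MX₀ ^ (1 - θ) * MX₁ ^ θ) * (MY₀ ^ (1 - θ) * MY₁ ^ θ) =
        (MX₀ * MY₀) ^ (1 - θ) * (MX₁ * MY₁) ^ θ := by
      rw [Real.mul_rpow hMX₀ hMY₀, Real.mul_rpow hMX₁ hMY₁]; ring
    rw [hPeq]
    calc _ ≤ ((MX₀ * MY₀) ^ (1 - θ) * (MX₁ * MY₁) ^ θ) ^ ((5 : ℝ) / 2) *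
          (16 * CE ^ ((5 : ℝ) / 2) * CF ^ ((5 : ℝ) / 2)) :=
        mul_le_mul (Real.self_le_rpow_of_one_le hP (by norm_num)) (six_mul_sqrt_le hC hD)
          (by positivity) (by positivity)
      _ = _ := by ring
  · have hz0 : z = 0 := by
      clear hz
      induction z with
      | zero => rfl
      | tmul v w =>
        by_contra hne
        have hv : v ≠ 0 := by rintro rfl; exact hne (TensorProduct.zero_tmul _ _)
        have hw : w ≠ 0 := by rintro rfl; exact hne (TensorProduct.tmul_zero _ _)
        obtain ⟨i, hi⟩ := Function.ne_iff.1 hv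
        obtain ⟨a, -⟩ := Function.ne_iff.1 hi
        obtain ⟨j, hj⟩ := Function.ne_iff.1 hw
        obtain ⟨b, -⟩ := Function.ne_iff.1 hj
        exact hVn ⟨⟨i⟩, ⟨a⟩, ⟨j⟩, ⟨b⟩⟩
      | add z z' h h' => rw [h, h', add_zero]
    rw [hz0]
    exact (interpN_injN_zero_le _ _ _ _ _).trans (by positivity)

end Paper
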